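/- Let f be a translation invariant indefinite quadratic form with integer coefficients in s ≥ 10 variables with rank_off(f) ≥ 5. Then there exist constants C_f > 0 and X₀(f) such that for every real X ≥ X₀(f) the following holds: if 𝒜 ⊆ 𝒫 ∩ {1,2,…,X} (𝒫 the set of primes) and there do not exist pairwise distinct primes p₁,…,p_s ∈ 𝒜 with f(p₁,…,p_s) = 0, then |𝒜| ≤ C_f · (X/log X) · (log log X)^{−1/80}. -/

import Mathlib

open scoped BigOperators

noncomputable section

/-- The quadratic form `f(x) = x M xᵀ`. -/
def Qf {s : ℕ} (M : Matrix (Fin s) (Fin s) ℤ) (x : Fin s → ℤ) : ℤ :=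
  ∑ i, ∑ j, x i * M i j * x j

/-- `f` is translation invariant, i.e. `1 · M = 0`. -/
def TransInv {s : ℕ} (M : Matrix (Fin s) (Fin s) ℤ) : Prop :=
  ∀ j, ∑ i, M i j = 0

/-- `f` is indefinite. -/
def Indefinite {s : ℕ} (M : Matrix (Fin s) (Fin s) ℤ) : Prop :=
  (∃ x, 0 < Qf M x) ∧ (∃ y, Qf M y < 0)

/-- The off-diagonal rank of `M` is at least `n`: there is a submatrix of `M`, whose row
index set and column index set are disjoint, of rank at least `n`. -/
def RankOffGe {s : ℕ} (M : Matrix (Fin s) (Fin s) ℤ) (n : ℕ) : Prop :=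
  ∃ (r : ℕ) (ι κ : Fin r → Fin s), Function.Injective ι ∧ Function.Injective κ ∧
    (∀ k l, ι k ≠ κ l) ∧ n ≤ (Matrix.of fun k l => (M (ι k) (κ l) : ℚ)).rank

/-- The additive character `e(t) = exp(2πit)`. -/
def ee (t : ℝ) : ℂ := Complex.exp (Complex.I * ((2 * Real.pi * t : ℝ) : ℂ))

lemma norm_ee (t : ℝ) : ‖ee t‖ = 1 := Complex.norm_exp_I_mul_ofReal _

lemma ee_add (a b : ℝ) : ee (a + b) = ee a * ee b := by
  unfold ee
  rw [← Complex.exp_add]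
  congr 1
  push_cast
  ring

lemma ee_zero : ee 0 = 1 := by simp [ee]

lemma ee_int (n : ℤ) : ee n = 1 := by
  unfold ee
  rw [Complex.exp_eq_one_iff]
  exact ⟨n, by push_cast; ring⟩

lemma ee_neg (a : ℝ) : ee (-a) = (starRingEnd ℂ) (ee a) := by
  unfold ee
  rw [← Complex.exp_conj, map_mul, Complex.conj_I, Complex.conj_ofReal]
  congr 1
  push_cast
  ring

lemma ee_add_int (a : ℝ) (n : ℤ) : ee (a + n) = ee a := by rw [ee_add, ee_int, mul_one]

lemma ee_nat_mul (n : ℕ) (a : ℝ) : ee (n * a) = ee a ^ n := by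
  unfold ee
  rw [← Complex.exp_nat_mul]
  congr 1
  push_cast
  ring

lemma norm_ee_sub_one_le (t : ℝ) : ‖ee t - 1‖ ≤ 2 * Real.pi * |t| := by
  unfold ee
  refine (Real.norm_exp_I_mul_ofReal_sub_one_le).trans ?_
  rw [Real.norm_eq_abs, abs_mul, abs_of_pos (by positivity)]

lemma norm_ee_sub_le (a b : ℝ) : ‖ee a - ee b‖ ≤ 2 * Real.pi * |a - b| := by
  have h : ee a - ee b = ee b * (ee (a - b) - 1) := by
    rw [mul_sub, ← ee_add, mul_one]
    congr 2
    ring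
  rw [h, norm_mul, norm_ee, one_mul]
  exact norm_ee_sub_one_le _

lemma four_mul_le_norm_ee_sub_one {t : ℝ} (ht : |t| ≤ 1 / 2) : 4 * |t| ≤ ‖ee t - 1‖ := by
  unfold ee
  rw [Complex.norm_exp_I_mul_ofReal_sub_one, norm_mul, Real.norm_eq_abs, Real.norm_eq_abs]
  have h1 : (2 * Real.pi * t / 2) = Real.pi * t := by ring
  have h2 : |Real.pi * t| ≤ Real.pi / 2 := by
    rw [abs_mul, abs_of_pos Real.pi_pos]
    nlinarith [Real.pi_pos]
  have h3 := Real.mul_abs_le_abs_sin h2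
  rw [h1]
  rw [abs_mul, abs_of_pos Real.pi_pos] at h3
  have h4 : 2 / Real.pi * (Real.pi * |t|) = 2 * |t| := by
    field_simp
  rw [h4] at h3
  rw [abs_of_pos (by norm_num : (0 : ℝ) < 2)]
  linarith

lemma integral_ee_int (n : ℤ) :
    ∫ θ in (0 : ℝ)..1, ee (θ * n) = if n = 0 then 1 else 0 := by
  split_ifs with h
  · subst h
    simp [ee_zero]
  · have hn : (n : ℂ) ≠ 0 := by exact_mod_cast h
    have hc : (2 * Real.pi * n * Complex.I : ℂ) ≠ 0 := by
      simp [Real.pi_ne_zero, hn]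
    have h1 : ∀ θ : ℝ, ee (θ * n) = Complex.exp ((2 * Real.pi * n * Complex.I : ℂ) * θ) := by
      intro θ
      unfold ee
      congr 1
      push_cast
      ring
    simp_rw [h1]
    rw [integral_exp_mul_complex hc]
    have h2 : Complex.exp ((2 * Real.pi * n * Complex.I : ℂ) * (1 : ℝ)) = 1 := by
      rw [Complex.exp_eq_one_iff]
      exact ⟨n, by push_cast; ring⟩
    rw [h2]
    simp

/-- The geometric sum `∑_{k < n} e(kφ)`. -/
def geomE (n : ℕ) (φ : ℝ) : ℂ := ∑ k ∈ Finset.range n, ee (k * φ)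

lemma norm_geomE_le (n : ℕ) (φ : ℝ) : ‖geomE n φ‖ ≤ n := by
  unfold geomE
  refine (norm_sum_le _ _).trans ?_
  simp [norm_ee]

lemma geomE_add_int (n : ℕ) (φ : ℝ) (m : ℤ) : geomE n (φ + m) = geomE n φ := by
  unfold geomE
  refine Finset.sum_congr rfl fun k _ => ?_
  rw [mul_add]
  have : ((k : ℝ) * (m : ℝ)) = (((k : ℤ) * m : ℤ) : ℝ) := by push_cast; ring
  rw [this, ee_add_int]

lemma norm_geomE_mul_le (n : ℕ) {φ : ℝ} (hφ : |φ| ≤ 1 / 2) : ‖geomE n φ‖ * (2 * |φ|) ≤ 1 := by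
  have h1 : geomE n φ * (ee φ - 1) = ee φ ^ n - 1 := by
    unfold geomE
    simp_rw [ee_nat_mul]
    exact geom_sum_mul _ _
  have h2 : ‖geomE n φ‖ * ‖ee φ - 1‖ ≤ 2 := by
    rw [← norm_mul, h1]
    refine (norm_sub_le _ _).trans ?_
    rw [norm_pow, norm_ee]
    norm_num
  have h3 := four_mul_le_norm_ee_sub_one hφ
  nlinarith [norm_nonneg (geomE n φ)]

lemma norm_geomE_sq_le (N : ℕ) {φ : ℝ} (hφ : |φ| ≤ 1 / 2) :
    ‖geomE (2 * N) φ‖ ^ 2 ≤ 9 * N ^ 2 / (1 + N * |φ|) ^ 2 := by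
  have h1 := norm_geomE_le (2 * N) φ
  have h2 := norm_geomE_mul_le (2 * N) hφ
  push_cast at h1
  have hp : 0 < 1 + (N : ℝ) * |φ| := by positivity
  rw [le_div_iff₀ (by positivity), ← mul_pow]
  have h3 : ‖geomE (2 * N) φ‖ * (1 + N * |φ|) ≤ 3 * N := by
    have : (N : ℝ) * (‖geomE (2 * N) φ‖ * (2 * |φ|)) ≤ N * 1 := by gcongr
    nlinarith
  calc _ ≤ (3 * (N : ℝ)) ^ 2 := by gcongr
    _ = _ := by ring

lemma sum_one_div_one_add_mul_sq_le {y : ℝ} (hy : 0 ≤ y) (L : ℕ) :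
    ∑ l ∈ Finset.range L, 1 / (1 + y * (l + 1)) ^ 2 ≤ L / (1 + y * L) := by
  induction L with
  | zero => simp
  | succ L ih =>
    rw [Finset.sum_range_succ]
    have h1 : 0 < 1 + y * L := by positivity
    have h2 : 0 < 1 + y * ((L : ℝ) + 1) := by positivity
    have h3 : 1 / (1 + y * ((L : ℝ) + 1)) ^ 2
        ≤ ((L : ℝ) + 1) / (1 + y * (L + 1)) - L / (1 + y * L) := by
      rw [div_sub_div _ _ h2.ne' h1.ne', div_le_div_iff₀ (by positivity) (by positivity)]
      have : ((L : ℝ) + 1) * (1 + y * L) - (1 + y * (L + 1)) * L = 1 := by ring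
      rw [this, sq]
      gcongr
      linarith
    push_cast
    linarith

lemma sum_one_div_sq_le_two (n : ℕ) :
    ∑ s ∈ Finset.range n, 1 / ((s : ℝ) + 1) ^ 2 ≤ 2 := by
  have h : ∀ n : ℕ, ∑ s ∈ Finset.range (n + 1), 1 / ((s : ℝ) + 1) ^ 2 ≤ 2 - 1 / ((n : ℝ) + 1) := by
    intro n
    induction n with
    | zero => norm_num
    | succ n ih =>
      rw [Finset.sum_range_succ]
      have h3 : 1 / (((n + 1 : ℕ) : ℝ) + 1) ^ 2
          ≤ 1 / ((n : ℝ) + 1) - 1 / (((n + 1 : ℕ) : ℝ) + 1) := by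
        push_cast
        have h1 : (0 : ℝ) < (n : ℝ) + 1 := by positivity
        have h2 : (0 : ℝ) < (n : ℝ) + 1 + 1 := by positivity
        rw [div_sub_div _ _ h1.ne' h2.ne', div_le_div_iff₀ (by positivity) (by positivity)]
        nlinarith
      linarith
  cases n with
  | zero => simp
  | succ n =>
    refine (h n).trans ?_
    have : (0 : ℝ) ≤ 1 / ((n : ℝ) + 1) := by positivity
    linarith

lemma sum_Ico_one_div_sq_le (q : ℕ) :
    ∑ s ∈ Finset.Ico 1 q, (1 / (s : ℝ) ^ 2 + 1 / ((q : ℝ) - s) ^ 2) ≤ 4 := by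
  have h1 : ∑ s ∈ Finset.Ico 1 q, (1 / (s : ℝ) ^ 2) ≤ 2 := by
    rw [Finset.sum_Ico_eq_sum_range]
    refine le_trans (le_of_eq ?_) (sum_one_div_sq_le_two (q - 1))
    refine Finset.sum_congr rfl fun s _ => ?_
    push_cast
    rw [add_comm]
  have h2 : ∑ s ∈ Finset.Ico 1 q, (1 / ((q : ℝ) - s) ^ 2)
      = ∑ s ∈ Finset.Ico 1 q, (1 / (s : ℝ) ^ 2) := by
    refine Finset.sum_nbij' (fun s => q - s) (fun s => q - s) ?_ ?_ ?_ ?_ ?_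
    · intro s hs; simp only [Finset.mem_Ico] at hs ⊢; omega
    · intro s hs; simp only [Finset.mem_Ico] at hs ⊢; omega
    · intro s hs; simp only [Finset.mem_Ico] at hs; omega
    · intro s hs; simp only [Finset.mem_Ico] at hs; omega
    · intro s hs
      simp only [Finset.mem_Ico] at hs
      rw [Nat.cast_sub (by omega)]
  rw [Finset.sum_add_distrib]
  linarith

lemma sum_le_sum_of_injOn' {α β : Type*} {s : Finset α} {t : Finset β} {f : α → ℝ} {g : β → ℝ}
    (e : α → β) (hg : ∀ i ∈ t, 0 ≤ g i) (he : ∀ i ∈ s, e i ∈ t) (hinj : Set.InjOn e s)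
    (hfg : ∀ i ∈ s, f i ≤ g (e i)) : ∑ i ∈ s, f i ≤ ∑ j ∈ t, g j := by
  classical
  calc ∑ i ∈ s, f i ≤ ∑ i ∈ s, g (e i) := Finset.sum_le_sum hfg
    _ = ∑ j ∈ s.image e, g j := (Finset.sum_image hinj).symm
    _ ≤ _ := Finset.sum_le_sum_of_subset_of_nonneg (Finset.image_subset_iff.mpr he)
      fun i hi _ => hg i hi

/-- Integers of `[-K, K]` that are congruent modulo `q` are at most `2K/q + 1` in number. -/
lemma card_filter_le_of_modEq (K q : ℕ) (hq : 1 ≤ q) (P : ℤ → Prop) [DecidablePred P]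
    (hP : ∀ x y, P x → P y → x % q = y % q) :
    ((Finset.Icc (-(K : ℤ)) K).filter P).card ≤ 2 * K / q + 1 := by
  have hq' : (0 : ℤ) < q := by exact_mod_cast hq
  have : ((Finset.Icc (-(K : ℤ)) K).filter P).card
      ≤ (Finset.Icc (0 : ℤ) (2 * K / q : ℕ)).card := by
    refine Finset.card_le_card_of_injOn (fun k => (k + K) / q) ?_ ?_
    · intro k hk
      simp only [Finset.coe_filter, Finset.mem_Icc, Set.mem_ofPred_eq] at hk
      simp only [Finset.coe_Icc, Set.mem_Icc]
      refine ⟨Int.ediv_nonneg (by omega) hq'.le, ?_⟩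
      push_cast
      exact Int.ediv_le_ediv hq' (by omega)
    · intro x hx y hy hxy
      simp only [Finset.coe_filter, Finset.mem_Icc, Set.mem_ofPred_eq] at hx hy
      have h1 := hP x y hx.2 hy.2
      have h2 : (x + K) % q = (y + K) % q := by
        rw [Int.add_emod, h1, ← Int.add_emod]
      have h3 := Int.mul_ediv_add_emod (x + K) q
      have h4 := Int.mul_ediv_add_emod (y + K) q
      simp only at hxy
      rw [hxy] at h3
      omega
  refine this.trans ?_
  rw [Int.card_Icc]
  generalize 2 * K / q = t
  omega

lemma sum_filter_dvd_le (κ N q : ℕ) (hκ : 1 ≤ κ) (hN : 1 ≤ N) (hq : 1 ≤ q)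
    (b : ℝ) (hb : 0 ≤ b) :
    ∑ k ∈ (Finset.Icc (-((κ * N : ℕ) : ℤ)) (κ * N : ℕ)).filter (fun k => (q : ℤ) ∣ k),
      1 / (1 + N * (b * |(k : ℝ)|)) ^ 2 ≤ 1 + 2 * (κ * N / (q * (1 + N ^ 2 * b))) := by
  set K := κ * N
  have hq' : (0 : ℤ) < q := by exact_mod_cast hq
  have hqr : (0 : ℝ) < q := by exact_mod_cast hq
  set L := K / q
  set ψ : ℕ → ℝ := fun l => 1 / (1 + (N * b * q) * l) ^ 2
  have hψ0 : ∀ l, 0 ≤ ψ l := fun l => by positivity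
  have hsub : ∑ k ∈ (Finset.Icc (-(K : ℤ)) K).filter (fun k => (q : ℤ) ∣ k),
      1 / (1 + N * (b * |(k : ℝ)|)) ^ 2 ≤ ∑ l ∈ Finset.Icc (-(L : ℤ)) L, ψ l.natAbs := by
    refine sum_le_sum_of_injOn' (fun k => k / q) ?_ ?_ ?_ ?_
    · intro i _; exact hψ0 _
    · intro k hk
      simp only [Finset.mem_filter, Finset.mem_Icc] at hk
      obtain ⟨⟨h1, h2⟩, l, rfl⟩ := hk
      rw [Int.mul_ediv_cancel_left _ hq'.ne']
      simp only [Finset.mem_Icc, L]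
      push_cast
      constructor
      · have : -l ≤ (K : ℤ) / q := by
          rw [Int.le_ediv_iff_mul_le hq']
          nlinarith
        linarith
      · rw [Int.le_ediv_iff_mul_le hq']
        nlinarith
    · intro x hx y hy hxy
      simp only [Finset.coe_filter, Finset.mem_Icc, Set.mem_ofPred_eq] at hx hy
      exact Int.ediv_left_inj hx.2 hy.2 |>.mp hxy
    · intro k hk
      simp only [Finset.mem_filter, Finset.mem_Icc] at hk
      obtain ⟨⟨h1, h2⟩, l, rfl⟩ := hk
      rw [Int.mul_ediv_cancel_left _ hq'.ne']
      simp only [ψ]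
      have : ((l.natAbs : ℕ) : ℝ) = |(l : ℝ)| := by
        rw [Nat.cast_natAbs]; push_cast; rfl
      rw [this]
      push_cast
      rw [abs_mul, abs_of_pos hqr]
      apply le_of_eq
      ring
  have hsplit : ∑ l ∈ Finset.Icc (-(L : ℤ)) L, ψ l.natAbs
      ≤ ψ 0 + 2 * ∑ l ∈ Finset.range L, ψ (l + 1) := by
    have : ∀ L : ℕ, ∑ l ∈ Finset.Icc (-(L : ℤ)) L, ψ l.natAbs
        = ψ 0 + 2 * ∑ l ∈ Finset.range L, ψ (l + 1) := by
      intro L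
      induction L with
      | zero => simp
      | succ L ih =>
        have : Finset.Icc (-((L + 1 : ℕ) : ℤ)) ((L + 1 : ℕ) : ℤ)
            = insert (-((L + 1 : ℕ) : ℤ)) (insert ((L + 1 : ℕ) : ℤ) (Finset.Icc (-(L : ℤ)) L)) := by
          ext x
          simp only [Finset.mem_Icc, Finset.mem_insert]
          push_cast
          omega
        rw [this, Finset.sum_insert, Finset.sum_insert, ih, Finset.sum_range_succ]
        · have h1 : (-((L + 1 : ℕ) : ℤ)).natAbs = L + 1 := by omega
          have h2 : (((L + 1 : ℕ) : ℤ)).natAbs = L + 1 := by omega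
          rw [h1, h2]
          ring
        · simp
        · simp only [Finset.mem_Icc, Finset.mem_insert]
          push_cast
          omega
    exact (this L).le
  have hy : (0 : ℝ) ≤ N * b * q := by positivity
  have h5 : ∑ l ∈ Finset.range L, ψ (l + 1) ≤ L / (1 + (N * b * q) * L) := by
    refine le_trans (le_of_eq ?_) (sum_one_div_one_add_mul_sq_le hy L)
    refine Finset.sum_congr rfl fun l _ => ?_
    simp only [ψ]
    push_cast
    rfl
  have h6 : (L : ℝ) ≤ K / q := Nat.cast_div_le
  have h7 : (L : ℝ) / (1 + (N * b * q) * L) ≤ κ * N / (q * (1 + N ^ 2 * b)) := by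
    have hNr : (1 : ℝ) ≤ N := by exact_mod_cast hN
    have hκr : (1 : ℝ) ≤ κ := by exact_mod_cast hκ
    rw [le_div_iff₀ hqr] at h6
    simp only [K] at h6
    push_cast at h6
    rw [div_le_div_iff₀ (by positivity) (by positivity)]
    have e1 : (N : ℝ) ^ 2 * b * (L * q) ≤ κ * N * (N * b * q * L) := by
      have : 0 ≤ (N : ℝ) ^ 2 * b * (L * q) := by positivity
      nlinarith
    nlinarith
  have h8 : ψ 0 = 1 := by simp [ψ]
  linarith

lemma norm_geomE_sq_le_of_not_dvd (κ N q : ℕ) (hκ : 1 ≤ κ) (hN : 1 ≤ N) (hq : 1 ≤ q) (a : ℤ)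
    (θ : ℝ) (hθ : |θ - a / q| ≤ 1 / (2 * κ * N * q)) (k : ℤ) (hk1 : |(k : ℝ)| ≤ κ * N)
    (s : ℕ) (hs : a * k % q = s) (hs1 : 1 ≤ s) :
    ‖geomE (2 * N) (θ * k)‖ ^ 2
      ≤ 36 * q ^ 2 * (1 / (s : ℝ) ^ 2 + 1 / ((q : ℝ) - s) ^ 2) := by
  have hq' : (0 : ℤ) < q := by exact_mod_cast hq
  have hqr : (0 : ℝ) < q := by exact_mod_cast hq
  have hNr : (1 : ℝ) ≤ N := by exact_mod_cast hN
  have hκr : (1 : ℝ) ≤ κ := by exact_mod_cast hκ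
  have hsq : s < q := by
    have := Int.emod_lt_of_pos (a * k) hq'
    omega
  set m := round (θ * k)
  set φ := θ * k - m
  have hφ : |φ| ≤ 1 / 2 := abs_sub_round _
  have h0 : geomE (2 * N) (θ * k) = geomE (2 * N) φ := by
    rw [← geomE_add_int (2 * N) φ m]
    congr 1
    simp [φ]
  set u : ℕ := min s (q - s)
  have hu1 : 1 ≤ u := by simp only [u]; omega
  have hur : (1 : ℝ) ≤ u := by exact_mod_cast hu1
  have h2 : (u : ℤ) ≤ |a * k - m * q| := by
    have h3 := Int.mul_ediv_add_emod (a * k) q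
    rw [hs] at h3
    set t := a * k / q
    have h4 : a * k - m * q = q * (t - m) + s := by rw [← h3]; ring
    rw [h4]
    simp only [u]
    push_cast [Nat.cast_sub hsq.le]
    rcases le_or_gt 0 (t - m) with h | h
    · rw [abs_of_nonneg (by positivity)]
      have : (0 : ℤ) ≤ q * (t - m) := by positivity
      have := min_le_left (s : ℤ) (q - s)
      omega
    · have h5 : (q : ℤ) * (t - m) ≤ q * (-1) := by
        apply mul_le_mul_of_nonneg_left _ hq'.le
        omega
      rw [abs_of_neg (by omega)]
      have := min_le_right (s : ℤ) (q - s)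
      omega
  have h2r : (u : ℝ) ≤ |(a : ℝ) * k - m * q| := by exact_mod_cast h2
  have h6 : (u : ℝ) / (2 * q) ≤ |φ| := by
    have h7 : φ = (a * k - m * q) / q + (θ - a / q) * k := by
      simp only [φ]
      field_simp
      ring
    have h8 : |(θ - a / q) * k| ≤ 1 / (2 * q) := by
      rw [abs_mul]
      calc _ ≤ 1 / (2 * (κ : ℝ) * N * q) * (κ * N) := by gcongr
        _ = 1 / (2 * q) := by field_simp
    have h9 : (u : ℝ) / q ≤ |((a : ℝ) * k - m * q) / q| := by
      rw [abs_div, abs_of_pos hqr]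
      gcongr
    have h10 : |((a : ℝ) * k - m * q) / q| ≤ |φ| + |(θ - a / q) * k| := by
      have : ((a : ℝ) * k - m * q) / q = φ - (θ - a / q) * k := by rw [h7]; ring
      rw [this]
      exact abs_sub _ _
    have h11 : (u : ℝ) / q = u / (2 * q) + u / (2 * q) := by field_simp; ring
    have h12 : 1 / (2 * (q : ℝ)) ≤ u / (2 * q) := by gcongr
    linarith
  have hφpos : 0 < |φ| := lt_of_lt_of_le (by positivity) h6
  rw [h0]
  calc ‖geomE (2 * N) φ‖ ^ 2 ≤ 9 * N ^ 2 / (1 + N * |φ|) ^ 2 := norm_geomE_sq_le N hφ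
    _ ≤ 9 * N ^ 2 / (N * (u / (2 * q))) ^ 2 := by
        gcongr
        nlinarith
    _ = 36 * q ^ 2 * (1 / (u : ℝ) ^ 2) := by field_simp; norm_num
    _ ≤ _ := by
        gcongr
        rcases min_choice s (q - s) with h | h
        · simp only [u, h]
          have : 0 ≤ 1 / ((q : ℝ) - s) ^ 2 := by positivity
          linarith
        · simp only [u, h]
          rw [Nat.cast_sub hsq.le]
          have : 0 ≤ 1 / (s : ℝ) ^ 2 := by positivity
          linarith

lemma sum_geomE_sq_le (κ : ℕ) (hκ : 1 ≤ κ) (N : ℕ) (hN : 1 ≤ N) (θ : ℝ) (q : ℕ) (a : ℤ)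
    (hq : 1 ≤ q) (hcop : IsCoprime a (q : ℤ)) (hqN : q ≤ 2 * κ * N)
    (hθ : |θ - a / q| ≤ 1 / (2 * κ * N * q)) :
    ∑ k ∈ Finset.Icc (-((κ * N : ℕ) : ℤ)) (κ * N : ℕ), ‖geomE (2 * N) (θ * k)‖ ^ 2
      ≤ 1200 * κ ^ 2 * N ^ 3 * (1 / (q * (1 + N ^ 2 * |θ - a / q|)) + 1 / N) := by
  have hq' : (0 : ℤ) < q := by exact_mod_cast hq
  have hqr : (1 : ℝ) ≤ q := by exact_mod_cast hq
  have hNr : (1 : ℝ) ≤ N := by exact_mod_cast hN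
  have hκr : (1 : ℝ) ≤ κ := by exact_mod_cast hκ
  have hqNr : (q : ℝ) ≤ 2 * κ * N := by exact_mod_cast hqN
  set I := Finset.Icc (-((κ * N : ℕ) : ℤ)) (κ * N : ℕ)
  have habs : ∀ k ∈ I, |(k : ℝ)| ≤ κ * N := by
    intro k hk
    simp only [I, Finset.mem_Icc] at hk
    rw [abs_le]
    constructor
    · exact_mod_cast hk.1
    · exact_mod_cast hk.2
  rw [← Finset.sum_filter_add_sum_filter_not I (fun k => (q : ℤ) ∣ k)]
  have hA : ∑ k ∈ I.filter (fun k => (q : ℤ) ∣ k), ‖geomE (2 * N) (θ * k)‖ ^ 2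
      ≤ 9 * N ^ 2 * (1 + 2 * (κ * N / (q * (1 + N ^ 2 * |θ - a / q|)))) := by
    refine le_trans ?_ (mul_le_mul_of_nonneg_left
      (sum_filter_dvd_le κ N q hκ hN hq |θ - a / q| (abs_nonneg _)) (by positivity))
    rw [Finset.mul_sum]
    refine Finset.sum_le_sum fun k hk => ?_
    have hk1 := habs k (Finset.mem_filter.mp hk).1
    obtain ⟨l, hl⟩ := (Finset.mem_filter.mp hk).2
    have e1 : θ * k = (θ - a / q) * k + (a * l : ℤ) := by
      rw [hl]
      push_cast
      field_simp
      ring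
    have e2 : |(θ - a / q) * k| ≤ 1 / 2 := by
      rw [abs_mul]
      calc _ ≤ 1 / (2 * (κ : ℝ) * N * q) * (κ * N) := by gcongr
        _ = 1 / 2 * (1 / (q : ℝ)) := by field_simp
        _ ≤ 1 / 2 * 1 := by
          gcongr
          rw [div_le_one (by positivity)]
          exact hqr
        _ = 1 / 2 := by norm_num
    rw [e1, geomE_add_int]
    refine (norm_geomE_sq_le N e2).trans (le_of_eq ?_)
    rw [abs_mul]
    ring
  have hB : ∑ k ∈ I.filter (fun k => ¬ (q : ℤ) ∣ k), ‖geomE (2 * N) (θ * k)‖ ^ 2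
      ≤ 1152 * κ ^ 2 * N ^ 2 := by
    set G : ℕ → ℝ := fun s => 36 * q ^ 2 * (1 / (s : ℝ) ^ 2 + 1 / ((q : ℝ) - s) ^ 2)
    set ρ : ℤ → ℕ := fun k => (a * k % q).toNat
    have hρ : ∀ k, ((ρ k : ℕ) : ℤ) = a * k % q := fun k =>
      Int.toNat_of_nonneg (Int.emod_nonneg _ hq'.ne')
    have hmaps : ∀ k ∈ I.filter (fun k => ¬ (q : ℤ) ∣ k), ρ k ∈ Finset.Ico 1 q := by
      intro k hk
      have h1 := (Finset.mem_filter.mp hk).2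
      have h2 := Int.emod_lt_of_pos (a * k) hq'
      have h3 : a * k % q ≠ 0 := by
        intro h
        exact h1 (hcop.symm.dvd_of_dvd_mul_left (Int.dvd_of_emod_eq_zero h))
      have h4 := hρ k
      simp only [Finset.mem_Ico]
      omega
    calc ∑ k ∈ I.filter (fun k => ¬ (q : ℤ) ∣ k), ‖geomE (2 * N) (θ * k)‖ ^ 2
        ≤ ∑ k ∈ I.filter (fun k => ¬ (q : ℤ) ∣ k), G (ρ k) := by
          refine Finset.sum_le_sum fun k hk => ?_
          exact norm_geomE_sq_le_of_not_dvd κ N q hκ hN hq a θ hθ k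
            (habs k (Finset.mem_filter.mp hk).1) (ρ k) (hρ k).symm
            (Finset.mem_Ico.mp (hmaps k hk)).1
      _ = ∑ s ∈ Finset.Ico 1 q, ∑ k ∈ (I.filter (fun k => ¬ (q : ℤ) ∣ k)) with ρ k = s,
            G (ρ k) := (Finset.sum_fiberwise_of_maps_to hmaps _).symm
      _ ≤ ∑ s ∈ Finset.Ico 1 q, (4 * (κ * N) / q) * G s := by
          refine Finset.sum_le_sum fun s _ => ?_
          have hG : 0 ≤ G s := by positivity
          have e1 : ∑ k ∈ (I.filter (fun k => ¬ (q : ℤ) ∣ k)) with ρ k = s, G (ρ k)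
              = ((I.filter (fun k => ¬ (q : ℤ) ∣ k)).filter (fun k => ρ k = s)).card * G s := by
            rw [← nsmul_eq_mul]
            refine Finset.sum_eq_card_nsmul fun k hk => ?_
            rw [(Finset.mem_filter.mp hk).2]
          rw [e1]
          refine mul_le_mul_of_nonneg_right ?_ hG
          have e2 : ((I.filter (fun k => ¬ (q : ℤ) ∣ k)).filter (fun k => ρ k = s)).card
              ≤ (I.filter (fun k => ρ k = s)).card :=
            Finset.card_le_card (Finset.filter_subset_filter _ (Finset.filter_subset _ _))
          have e3 := card_filter_le_of_modEq (κ * N) q hq (fun k => ρ k = s) (by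
            intro x y hx hy
            have h5 : a * x % q = a * y % q := by rw [← hρ, ← hρ, hx, hy]
            have h6 : (q : ℤ) ∣ a * (x - y) := by
              rw [mul_sub]
              exact Int.dvd_of_emod_eq_zero (Int.emod_eq_emod_iff_emod_sub_eq_zero.mp h5)
            have h7 := hcop.symm.dvd_of_dvd_mul_left h6
            exact Int.emod_eq_emod_iff_emod_sub_eq_zero.mpr (Int.emod_eq_zero_of_dvd h7))
          have e4 : (((I.filter (fun k => ¬ (q : ℤ) ∣ k)).filter (fun k => ρ k = s)).card : ℝ)
              ≤ ((2 * (κ * N) / q + 1 : ℕ) : ℝ) := by exact_mod_cast e2.trans e3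
          refine e4.trans ?_
          push_cast
          have e5 : ((2 * (κ * N) / q : ℕ) : ℝ) ≤ 2 * (κ * N) / q := by
            refine Nat.cast_div_le.trans ?_
            push_cast
            rfl
          have e6 : (1 : ℝ) ≤ 2 * (κ * N) / q := by
            rw [le_div_iff₀ (by positivity)]
            linarith
          have e7 : 4 * ((κ : ℝ) * N) / q = 2 * (κ * N) / q + 2 * (κ * N) / q := by ring
          linarith
      _ = (4 * (κ * N) / q) * (36 * q ^ 2) *
            ∑ s ∈ Finset.Ico 1 q, (1 / (s : ℝ) ^ 2 + 1 / ((q : ℝ) - s) ^ 2) := by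
          rw [Finset.mul_sum]
          refine Finset.sum_congr rfl fun s _ => ?_
          simp only [G]
          ring
      _ ≤ (4 * (κ * N) / q) * (36 * q ^ 2) * 4 := by
          gcongr
          exact sum_Ico_one_div_sq_le q
      _ = 576 * (κ * N) * q := by field_simp; norm_num
      _ ≤ 576 * (κ * N) * (2 * κ * N) := by gcongr
      _ = _ := by ring
  have hD : 0 < (q : ℝ) * (1 + N ^ 2 * |θ - a / q|) := by positivity
  set D := (q : ℝ) * (1 + N ^ 2 * |θ - a / q|)
  have e1 : 1200 * (κ : ℝ) ^ 2 * N ^ 3 * (1 / D + 1 / N)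
      = 1200 * κ ^ 2 * (N ^ 3 / D) + 1200 * κ ^ 2 * N ^ 2 := by field_simp
  have e2 : 9 * (N : ℝ) ^ 2 * (1 + 2 * (κ * N / D)) = 9 * N ^ 2 + 18 * (κ * (N ^ 3 / D)) := by
    ring
  rw [e1]
  rw [e2] at hA
  have e3 : κ * ((N : ℝ) ^ 3 / D) ≤ κ ^ 2 * (N ^ 3 / D) := by
    gcongr
    nlinarith
  have e4 : (N : ℝ) ^ 2 ≤ κ ^ 2 * N ^ 2 :=
    le_mul_of_one_le_left (sq_nonneg _) (by nlinarith)
  have e6 : 0 ≤ (κ : ℝ) ^ 2 * N ^ 2 := by positivity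
  have e5 : 0 ≤ (κ : ℝ) ^ 2 * (N ^ 3 / D) := by positivity
  linarith

/-- The box `[0, N)^ι` of integer points. -/
def intBox (ι : Type*) [Fintype ι] [DecidableEq ι] (N : ℕ) : Finset (ι → ℤ) :=
  Fintype.piFinset fun _ => Finset.Ico (0 : ℤ) N

lemma card_intBox (ι : Type*) [Fintype ι] [DecidableEq ι] (N : ℕ) :
    (intBox ι N).card = N ^ Fintype.card ι := by
  simp [intBox, Fintype.card_piFinset]

lemma mem_intBox {ι : Type*} [Fintype ι] [DecidableEq ι] {N : ℕ} {x : ι → ℤ} :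
    x ∈ intBox ι N ↔ ∀ i, 0 ≤ x i ∧ x i < N := by
  simp [intBox, Fintype.mem_piFinset]

section Bilinear

variable {r : ℕ} (B : Matrix (Fin r) (Fin r) ℤ) (θ : ℝ)

lemma sum_ee_intBox (n : ℕ) (w : Fin r → ℤ) :
    ∑ u ∈ intBox (Fin r) n, ee (θ * ((u ⬝ᵥ w : ℤ) : ℝ)) = ∏ i, geomE n (θ * w i) := by
  have h : ∀ i, geomE n (θ * w i) = ∑ k ∈ Finset.Ico (0 : ℤ) n, ee (k * (θ * w i)) := by
    intro i
    unfold geomE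
    refine Finset.sum_nbij' (fun k => (k : ℤ)) (fun k => k.toNat) ?_ ?_ ?_ ?_ ?_
    · intro k hk; simp only [Finset.mem_range, Finset.mem_Ico] at hk ⊢; omega
    · intro k hk; simp only [Finset.mem_range, Finset.mem_Ico] at hk ⊢; omega
    · intro k _; simp
    · intro k hk; simp only [Finset.mem_Ico] at hk; omega
    · intro k _; simp
  simp_rw [h]
  rw [Finset.prod_univ_sum]
  refine Finset.sum_congr rfl fun u _ => ?_
  have hprod : ∀ (s : Finset (Fin r)) (g : Fin r → ℝ), ee (∑ i ∈ s, g i) = ∏ i ∈ s, ee (g i) := by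
    intro s g
    classical
    induction s using Finset.induction_on with
    | empty => simp [ee_zero]
    | insert i s hi ih => rw [Finset.sum_insert hi, Finset.prod_insert hi, ee_add, ih]
  rw [← hprod]
  congr 1
  simp only [dotProduct]
  push_cast
  rw [Finset.mul_sum]
  refine Finset.sum_congr rfl fun i _ => ?_
  ring

lemma sum_normSq_eq (S T : Finset (Fin r → ℤ)) (d : (Fin r → ℤ) → ℂ) :
    ∑ n ∈ S, ∑ n' ∈ S,
      (∑ v ∈ T, d v * ee (θ * (((n - n') ⬝ᵥ B.mulVec v : ℤ) : ℝ))) *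
        (starRingEnd ℂ) (∑ v ∈ T, d v * ee (θ * (((n - n') ⬝ᵥ B.mulVec v : ℤ) : ℝ)))
    = ∑ v ∈ T, ∑ v' ∈ T, d v * (starRingEnd ℂ) (d v') *
        ((∑ n ∈ S, ee (θ * ((n ⬝ᵥ B.mulVec (v - v') : ℤ) : ℝ))) *
          (starRingEnd ℂ) (∑ n ∈ S, ee (θ * ((n ⬝ᵥ B.mulVec (v - v') : ℤ) : ℝ)))) := by
  simp_rw [map_sum, Finset.sum_mul_sum, Finset.mul_sum]
  have h1 : ∀ f : (Fin r → ℤ) → (Fin r → ℤ) → (Fin r → ℤ) → (Fin r → ℤ) → ℂ,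
      ∑ n ∈ S, ∑ n' ∈ S, ∑ v ∈ T, ∑ v' ∈ T, f n n' v v'
        = ∑ v ∈ T, ∑ v' ∈ T, ∑ n ∈ S, ∑ n' ∈ S, f n n' v v' := by
    intro f
    simp_rw [← Finset.sum_product']
    refine Finset.sum_nbij' (fun x => (x.2.2.1, x.2.2.2, x.1, x.2.1))
      (fun x => (x.2.2.1, x.2.2.2, x.1, x.2.1)) ?_ ?_ ?_ ?_ ?_
    · intro x hx; simp only [Finset.mem_product] at hx ⊢; tauto
    · intro x hx; simp only [Finset.mem_product] at hx ⊢; tauto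
    · intro x _; rfl
    · intro x _; rfl
    · intro x _; rfl
  have h2 := h1 (fun n n' v v' => d v * ee (θ * (((n - n') ⬝ᵥ B.mulVec v : ℤ) : ℝ)) *
    (starRingEnd ℂ) (d v' * ee (θ * (((n - n') ⬝ᵥ B.mulVec v' : ℤ) : ℝ))))
  rw [h2]
  refine Finset.sum_congr rfl fun v _ => Finset.sum_congr rfl fun v' _ =>
    Finset.sum_congr rfl fun n _ => Finset.sum_congr rfl fun n' _ => ?_
  rw [map_mul, ← ee_neg, ← ee_neg]
  have h3 : ee (θ * (((n - n') ⬝ᵥ B.mulVec v : ℤ) : ℝ)) *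
      ee (-(θ * (((n - n') ⬝ᵥ B.mulVec v' : ℤ) : ℝ)))
      = ee (θ * ((n ⬝ᵥ B.mulVec (v - v') : ℤ) : ℝ)) *
        ee (-(θ * ((n' ⬝ᵥ B.mulVec (v - v') : ℤ) : ℝ))) := by
    rw [← ee_add, ← ee_add]
    congr 1
    simp only [Matrix.mulVec_sub, dotProduct_sub, sub_dotProduct]
    push_cast
    ring
  linear_combination d v * (starRingEnd ℂ) (d v') * h3

lemma sum_norm_sq_le (hdet : B.det ≠ 0) (κ : ℕ) (hκ : ∀ i, ∑ j, |B i j| ≤ κ) (N : ℕ)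
    (d : (Fin r → ℤ) → ℂ) (hd : ∀ v, ‖d v‖ ≤ 1) :
    (N : ℝ) ^ r * ∑ u ∈ intBox (Fin r) N,
        ‖∑ v ∈ intBox (Fin r) N, d v * ee (θ * ((u ⬝ᵥ B.mulVec v : ℤ) : ℝ))‖ ^ 2
      ≤ (N : ℝ) ^ r * (∑ k ∈ Finset.Icc (-((κ * N : ℕ) : ℤ)) (κ * N : ℕ),
          ‖geomE (2 * N) (θ * k)‖ ^ 2) ^ r := by
  set F : (Fin r → ℤ) → ℂ := fun u =>
    ∑ v ∈ intBox (Fin r) N, d v * ee (θ * ((u ⬝ᵥ B.mulVec v : ℤ) : ℝ))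
  set I := Finset.Icc (-((κ * N : ℕ) : ℤ)) (κ * N : ℕ)
  have step1 : (N : ℝ) ^ r * ∑ u ∈ intBox (Fin r) N, ‖F u‖ ^ 2
      ≤ ∑ p ∈ intBox (Fin r) (2 * N) ×ˢ intBox (Fin r) (2 * N), ‖F (p.1 - p.2)‖ ^ 2 := by
    have e : (N : ℝ) ^ r * ∑ u ∈ intBox (Fin r) N, ‖F u‖ ^ 2
        = ∑ p ∈ intBox (Fin r) N ×ˢ intBox (Fin r) N, ‖F p.2‖ ^ 2 := by
      rw [Finset.sum_product]
      simp only [Finset.sum_const, card_intBox, Fintype.card_fin, nsmul_eq_mul]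
      push_cast
      rfl
    rw [e]
    refine sum_le_sum_of_injOn' (fun p => (p.1 + p.2, p.1)) (fun _ _ => by positivity) ?_ ?_ ?_
    · intro p hp
      simp only [Finset.mem_product, mem_intBox, Pi.add_apply] at hp ⊢
      push_cast
      refine ⟨fun i => ?_, fun i => ?_⟩
      · have h1 := hp.1 i
        have h2 := hp.2 i
        omega
      · have h1 := hp.1 i
        omega
    · intro p _ p' _ h
      simp only [Prod.mk.injEq] at h
      obtain ⟨h1, h2⟩ := h
      rw [h2] at h1
      exact Prod.ext h2 (add_left_cancel h1)
    · intro p _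
      simp
  have step2 : ((∑ p ∈ intBox (Fin r) (2 * N) ×ˢ intBox (Fin r) (2 * N),
      ‖F (p.1 - p.2)‖ ^ 2 : ℝ) : ℂ) = ∑ v ∈ intBox (Fin r) N, ∑ v' ∈ intBox (Fin r) N,
        d v * (starRingEnd ℂ) (d v') *
          ((∏ i, geomE (2 * N) (θ * (B.mulVec (v - v') i : ℤ))) *
          (starRingEnd ℂ) (∏ i, geomE (2 * N) (θ * (B.mulVec (v - v') i : ℤ)))) := by
    have h := sum_normSq_eq B θ (intBox (Fin r) (2 * N)) (intBox (Fin r) N) d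
    simp_rw [sum_ee_intBox] at h
    rw [← h, Finset.sum_product]
    push_cast
    refine Finset.sum_congr rfl fun n _ => Finset.sum_congr rfl fun n' _ => ?_
    rw [Complex.mul_conj, Complex.normSq_eq_norm_sq]
    push_cast
    rfl
  have step3 : ∑ p ∈ intBox (Fin r) (2 * N) ×ˢ intBox (Fin r) (2 * N), ‖F (p.1 - p.2)‖ ^ 2
      ≤ ∑ v ∈ intBox (Fin r) N, ∑ v' ∈ intBox (Fin r) N,
        ∏ i, ‖geomE (2 * N) (θ * (B.mulVec (v - v') i : ℤ))‖ ^ 2 := by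
    have h0 : (0 : ℝ) ≤ ∑ p ∈ intBox (Fin r) (2 * N) ×ˢ intBox (Fin r) (2 * N),
      ‖F (p.1 - p.2)‖ ^ 2 := Finset.sum_nonneg fun _ _ => by positivity
    rw [← Complex.norm_of_nonneg h0, step2]
    refine (norm_sum_le _ _).trans (Finset.sum_le_sum fun v _ => ?_)
    refine (norm_sum_le _ _).trans (Finset.sum_le_sum fun v' _ => ?_)
    rw [norm_mul, norm_mul, norm_mul, RCLike.norm_conj, RCLike.norm_conj, norm_prod,
      Finset.prod_pow, ← sq]
    have h1 : ‖d v‖ * ‖d v'‖ ≤ 1 := mul_le_one₀ (hd v) (norm_nonneg _) (hd v')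
    exact mul_le_of_le_one_left (by positivity) h1
  refine step1.trans (step3.trans ?_)
  have step4 : ∀ v ∈ intBox (Fin r) N, ∑ v' ∈ intBox (Fin r) N,
        ∏ i, ‖geomE (2 * N) (θ * (B.mulVec (v - v') i : ℤ))‖ ^ 2
      ≤ (∑ k ∈ I, ‖geomE (2 * N) (θ * k)‖ ^ 2) ^ r := by
    intro v hv
    have e : (∑ k ∈ I, ‖geomE (2 * N) (θ * k)‖ ^ 2) ^ r
        = ∑ k ∈ Fintype.piFinset (fun _ : Fin r => I), ∏ i, ‖geomE (2 * N) (θ * k i)‖ ^ 2 := by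
      have := Finset.prod_univ_sum (fun _ : Fin r => I)
        (fun _ k => ‖geomE (2 * N) (θ * (k : ℤ))‖ ^ 2)
      rw [← this]
      simp
    rw [e]
    refine sum_le_sum_of_injOn' (fun v' => B.mulVec (v - v')) (fun _ _ => by positivity) ?_ ?_ ?_
    · intro v' hv'
      rw [mem_intBox] at hv hv'
      simp only [Fintype.mem_piFinset, I, Finset.mem_Icc]
      intro i
      rw [← abs_le]
      simp only [Matrix.mulVec, dotProduct]
      calc |∑ j, B i j * (v - v') j| ≤ ∑ j, |B i j * (v - v') j| := Finset.abs_sum_le_sum_abs _ _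
        _ ≤ ∑ j, |B i j| * N := by
            refine Finset.sum_le_sum fun j _ => ?_
            rw [abs_mul]
            refine mul_le_mul_of_nonneg_left ?_ (abs_nonneg _)
            have h1 := hv j
            have h2 := hv' j
            rw [Pi.sub_apply, abs_le]
            constructor <;> omega
        _ = (∑ j, |B i j|) * N := by rw [Finset.sum_mul]
        _ ≤ κ * N := mul_le_mul_of_nonneg_right (hκ i) (by positivity)
        _ = _ := by push_cast; rfl
    · intro v1 _ v2 _ h
      have h' : B.mulVec (v2 - v1) = 0 := by
        have h0 : B.mulVec (v - v1) - B.mulVec (v - v2) = 0 := sub_eq_zero.mpr h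
        rw [← Matrix.mulVec_sub] at h0
        simpa using h0
      exact (sub_eq_zero.mp (Matrix.eq_zero_of_mulVec_eq_zero hdet h')).symm
    · intro v' _
      exact le_rfl
  calc _ ≤ ∑ v ∈ intBox (Fin r) N, (∑ k ∈ I, ‖geomE (2 * N) (θ * k)‖ ^ 2) ^ r :=
        Finset.sum_le_sum step4
    _ = _ := by
      rw [Finset.sum_const, card_intBox, Fintype.card_fin, nsmul_eq_mul]
      push_cast
      rfl

lemma norm_bilinear_sq_le (hdet : B.det ≠ 0) (κ : ℕ) (hκ : ∀ i, ∑ j, |B i j| ≤ κ) (N : ℕ)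
    (c d : (Fin r → ℤ) → ℂ) (hc : ∀ v, ‖c v‖ ≤ 1) (hd : ∀ v, ‖d v‖ ≤ 1) :
    ‖∑ u ∈ intBox (Fin r) N, ∑ v ∈ intBox (Fin r) N,
        c u * d v * ee (θ * ((u ⬝ᵥ B.mulVec v : ℤ) : ℝ))‖ ^ 2
      ≤ (N : ℝ) ^ r * (∑ k ∈ Finset.Icc (-((κ * N : ℕ) : ℤ)) (κ * N : ℕ),
          ‖geomE (2 * N) (θ * k)‖ ^ 2) ^ r := by
  set F : (Fin r → ℤ) → ℂ := fun u =>
    ∑ v ∈ intBox (Fin r) N, d v * ee (θ * ((u ⬝ᵥ B.mulVec v : ℤ) : ℝ))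
  have h1 : ‖∑ u ∈ intBox (Fin r) N, ∑ v ∈ intBox (Fin r) N,
        c u * d v * ee (θ * ((u ⬝ᵥ B.mulVec v : ℤ) : ℝ))‖ ≤ ∑ u ∈ intBox (Fin r) N, ‖F u‖ := by
    refine (norm_sum_le _ _).trans (Finset.sum_le_sum fun u _ => ?_)
    have : ∑ v ∈ intBox (Fin r) N, c u * d v * ee (θ * ((u ⬝ᵥ B.mulVec v : ℤ) : ℝ))
        = c u * F u := by
      simp only [F, Finset.mul_sum, mul_assoc]
    rw [this, norm_mul]
    exact mul_le_of_le_one_left (norm_nonneg _) (hc u)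
  have h2 : (∑ u ∈ intBox (Fin r) N, ‖F u‖) ^ 2
      ≤ (N : ℝ) ^ r * ∑ u ∈ intBox (Fin r) N, ‖F u‖ ^ 2 := by
    have := sq_sum_le_card_mul_sum_sq (s := intBox (Fin r) N) (f := fun u => ‖F u‖)
    rw [card_intBox, Fintype.card_fin] at this
    exact_mod_cast this
  calc _ ≤ (∑ u ∈ intBox (Fin r) N, ‖F u‖) ^ 2 := by gcongr
    _ ≤ _ := h2
    _ ≤ _ := sum_norm_sq_le B θ hdet κ hκ N d hd

end Bilinear

section QuadraticForm

variable {s : ℕ} (M : Matrix (Fin s) (Fin s) ℤ)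

lemma Qf_eq_dotProduct (x : Fin s → ℤ) : Qf M x = x ⬝ᵥ M.mulVec x := by
  simp only [Qf, dotProduct, Matrix.mulVec, Finset.mul_sum, mul_assoc]

variable {M}

lemma dotProduct_mulVec_comm_of_isSymm (hM : M.IsSymm) (x y : Fin s → ℤ) :
    x ⬝ᵥ M.mulVec y = y ⬝ᵥ M.mulVec x := by
  rw [Matrix.dotProduct_mulVec, dotProduct_comm, ← Matrix.mulVec_transpose, hM.eq]

lemma Qf_add (hM : M.IsSymm) (x y : Fin s → ℤ) :
    Qf M (x + y) = Qf M x + 2 * (x ⬝ᵥ M.mulVec y) + Qf M y := by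
  simp only [Qf_eq_dotProduct, Matrix.mulVec_add, dotProduct_add, add_dotProduct]
  rw [dotProduct_mulVec_comm_of_isSymm hM y x]
  ring

lemma Qf_add_add (hM : M.IsSymm) (a b c : Fin s → ℤ) :
    Qf M (a + b + c) = Qf M (a + b) + (Qf M (a + c) - Qf M a) + 2 * (b ⬝ᵥ M.mulVec c) := by
  rw [Qf_add hM (a + b) c, Qf_add hM a c, add_dotProduct]
  ring

lemma Qf_smul (d : ℤ) (x : Fin s → ℤ) : Qf M (d • x) = d ^ 2 * Qf M x := by
  simp only [Qf_eq_dotProduct, Matrix.mulVec_smul, dotProduct_smul, smul_dotProduct, smul_eq_mul]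
  ring

lemma mulVec_const_of_transInv (hM : M.IsSymm) (h : TransInv M) (b : ℤ) :
    M.mulVec (fun _ => b) = 0 := by
  funext j
  have h1 := h j
  simp only [Matrix.mulVec, dotProduct, ← Finset.sum_mul, Pi.zero_apply]
  have : ∑ i, M j i = ∑ i, M i j := Finset.sum_congr rfl fun i _ => hM.apply i j
  rw [this, h1, zero_mul]

lemma Qf_add_const (hM : M.IsSymm) (h : TransInv M) (x : Fin s → ℤ) (b : ℤ) :
    Qf M (x + fun _ => b) = Qf M x := by
  rw [Qf_add hM, Qf_eq_dotProduct M (fun _ => b), mulVec_const_of_transInv hM h]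
  simp

end QuadraticForm

section Override

variable {s r : ℕ} (ι κ : Fin r → Fin s)

/-- Replace the coordinates of `x` indexed by `ι` and `κ` by those of `u` and `v`. -/
def override (x : Fin s → ℤ) (u v : Fin r → ℤ) : Fin s → ℤ :=
  Function.extend ι u (Function.extend κ v x)

variable {ι κ} (hι : Function.Injective ι) (hκ : Function.Injective κ) (hικ : ∀ k l, ι k ≠ κ l)

include hι in
lemma override_left (x : Fin s → ℤ) (u v : Fin r → ℤ) (k : Fin r) :
    override ι κ x u v (ι k) = u k := hι.extend_apply _ _ _

include hκ hικ in
lemma override_right (x : Fin s → ℤ) (u v : Fin r → ℤ) (k : Fin r) :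
    override ι κ x u v (κ k) = v k := by
  unfold override
  rw [Function.extend_apply' _ _ _ (by rintro ⟨l, h⟩; exact hικ l k h), hκ.extend_apply]

lemma override_other (x : Fin s → ℤ) (u v : Fin r → ℤ) {i : Fin s} (h1 : i ∉ Set.range ι)
    (h2 : i ∉ Set.range κ) : override ι κ x u v i = x i := by
  unfold override
  rw [Function.extend_apply' _ _ _ h1, Function.extend_apply' _ _ _ h2]

include hι hκ hικ in
lemma override_override (x : Fin s → ℤ) (u v : Fin r → ℤ) :
    override ι κ (override ι κ x u v) (x ∘ ι) (x ∘ κ) = x := by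
  funext i
  by_cases h1 : i ∈ Set.range ι
  · obtain ⟨k, rfl⟩ := h1
    rw [override_left hι]; rfl
  · by_cases h2 : i ∈ Set.range κ
    · obtain ⟨k, rfl⟩ := h2
      rw [override_right hκ hικ]; rfl
    · rw [override_other _ _ _ h1 h2, override_other _ _ _ h1 h2]

include hι hκ hικ in
lemma override_mem_intBox {N : ℕ} {x : Fin s → ℤ} {u v : Fin r → ℤ} (hx : x ∈ intBox (Fin s) N)
    (hu : u ∈ intBox (Fin r) N) (hv : v ∈ intBox (Fin r) N) :
    override ι κ x u v ∈ intBox (Fin s) N := by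
  rw [mem_intBox] at *
  intro i
  by_cases h1 : i ∈ Set.range ι
  · obtain ⟨k, rfl⟩ := h1
    rw [override_left hι]; exact hu k
  · by_cases h2 : i ∈ Set.range κ
    · obtain ⟨k, rfl⟩ := h2
      rw [override_right hκ hικ]; exact hv k
    · rw [override_other _ _ _ h1 h2]; exact hx i

include hι hκ hικ in
lemma sum_override (N : ℕ) (Φ : (Fin s → ℤ) → ℂ) :
    ∑ x ∈ intBox (Fin s) N, ∑ u ∈ intBox (Fin r) N, ∑ v ∈ intBox (Fin r) N, Φ (override ι κ x u v)
      = (N : ℂ) ^ (2 * r) * ∑ x ∈ intBox (Fin s) N, Φ x := by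
  have e : (N : ℂ) ^ (2 * r) * ∑ x ∈ intBox (Fin s) N, Φ x
      = ∑ x ∈ intBox (Fin s) N, ∑ _u ∈ intBox (Fin r) N, ∑ _v ∈ intBox (Fin r) N, Φ x := by
    simp only [Finset.sum_const, card_intBox, Fintype.card_fin, nsmul_eq_mul, ← Finset.mul_sum]
    push_cast
    ring
  rw [e]
  simp_rw [← Finset.sum_product']
  have hmem : ∀ {x : Fin s → ℤ} (e : Fin r → Fin s), x ∈ intBox (Fin s) N →
      x ∘ e ∈ intBox (Fin r) N := by
    intro x e hx
    rw [mem_intBox] at *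
    exact fun i => hx (e i)
  refine Finset.sum_nbij' (fun p => (override ι κ p.1 p.2.1 p.2.2, p.1 ∘ ι, p.1 ∘ κ))
    (fun p => (override ι κ p.1 p.2.1 p.2.2, p.1 ∘ ι, p.1 ∘ κ)) ?_ ?_ ?_ ?_ ?_
  · intro p hp
    simp only [Finset.mem_product] at hp ⊢
    exact ⟨override_mem_intBox hι hκ hικ hp.1 hp.2.1 hp.2.2, hmem _ hp.1, hmem _ hp.1⟩
  · intro p hp
    simp only [Finset.mem_product] at hp ⊢
    exact ⟨override_mem_intBox hι hκ hικ hp.1 hp.2.1 hp.2.2, hmem _ hp.1, hmem _ hp.1⟩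
  · intro p _
    refine Prod.ext (override_override hι hκ hικ _ _ _) (Prod.ext ?_ ?_)
    · funext k; exact override_left hι _ _ _ k
    · funext k; exact override_right hκ hικ _ _ _ k
  · intro p _
    refine Prod.ext (override_override hι hκ hικ _ _ _) (Prod.ext ?_ ?_)
    · funext k; exact override_left hι _ _ _ k
    · funext k; exact override_right hκ hικ _ _ _ k
  · intro p _
    rfl

include hι hκ hικ in
lemma override_eq_add (x : Fin s → ℤ) (u v : Fin r → ℤ) :
    override ι κ x u v = override ι κ x 0 0 + Function.extend ι u 0 + Function.extend κ v 0 := by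
  funext i
  simp only [Pi.add_apply]
  by_cases h1 : i ∈ Set.range ι
  · have h2 : i ∉ Set.range κ := by
      obtain ⟨k, rfl⟩ := h1
      rintro ⟨l, h⟩; exact hικ k l h.symm
    rw [Function.extend_apply' (f := κ) _ _ _ h2]
    obtain ⟨k, rfl⟩ := h1
    rw [override_left hι, override_left hι, hι.extend_apply]; simp
  · rw [Function.extend_apply' (f := ι) _ _ _ h1]
    by_cases h2 : i ∈ Set.range κ
    · obtain ⟨k, rfl⟩ := h2
      rw [override_right hκ hικ, override_right hκ hικ, hκ.extend_apply]; simp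
    · rw [override_other _ _ _ h1 h2, override_other _ _ _ h1 h2, Function.extend_apply' (f := κ) _ _ _ h2]
      simp

lemma extend_dotProduct (hι : Function.Injective ι) (u : Fin r → ℤ) (w : Fin s → ℤ) :
    Function.extend ι u 0 ⬝ᵥ w = u ⬝ᵥ (w ∘ ι) := by
  refine (Fintype.sum_of_injective ι hι _ _ ?_ ?_).symm
  · intro i hi
    rw [Function.extend_apply' _ _ _ hi]; simp
  · intro i
    rw [hι.extend_apply]; rfl

include hι hκ in
lemma extend_dotProduct_mulVec_extend (M : Matrix (Fin s) (Fin s) ℤ) (u v : Fin r → ℤ) :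
    Function.extend ι u 0 ⬝ᵥ M.mulVec (Function.extend κ v 0)
      = u ⬝ᵥ (M.submatrix ι κ).mulVec v := by
  rw [extend_dotProduct hι]
  congr 1
  funext k
  simp only [Function.comp, Matrix.mulVec]
  rw [dotProduct_comm, extend_dotProduct hκ, dotProduct_comm]
  rfl

include hι hκ hικ in
lemma prod_override (x : Fin s → ℤ) (u v : Fin r → ℤ) (g : ℤ → ℂ) :
    ∏ i, g (override ι κ x u v i)
      = (∏ i, open Classical in if i ∈ Set.range ι ∨ i ∈ Set.range κ then 1 else g (x i)) *
        (∏ k, g (u k)) * ∏ k, g (v k) := by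
  classical
  have hu : ∏ k, g (u k) = ∏ i, if i ∈ Set.range ι then g (override ι κ x u v i) else 1 := by
    refine Fintype.prod_of_injective ι hι _ _ ?_ ?_
    · intro i hi; rw [if_neg hi]
    · intro k; rw [if_pos ⟨k, rfl⟩, override_left hι]
  have hv : ∏ k, g (v k) = ∏ i, if i ∈ Set.range κ then g (override ι κ x u v i) else 1 := by
    refine Fintype.prod_of_injective κ hκ _ _ ?_ ?_
    · intro i hi; rw [if_neg hi]
    · intro k; rw [if_pos ⟨k, rfl⟩, override_right hκ hικ]
  rw [hu, hv, ← Finset.prod_mul_distrib, ← Finset.prod_mul_distrib]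
  refine Finset.prod_congr rfl fun i _ => ?_
  by_cases h1 : i ∈ Set.range ι
  · have h2 : i ∉ Set.range κ := by
      obtain ⟨k, rfl⟩ := h1
      rintro ⟨l, h⟩; exact hικ k l h.symm
    rw [if_pos (Or.inl h1), if_pos h1, if_neg h2]; ring
  · by_cases h2 : i ∈ Set.range κ
    · rw [if_pos (Or.inr h2), if_neg h1, if_pos h2]; ring
    · rw [if_neg (by tauto), if_neg h1, if_neg h2, override_other _ _ _ h1 h2]; ring

include hι hκ hικ in
/-- Weyl-type bound for exponential sums of a quadratic form with a nonsingular off-diagonal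
minor of order `r`. -/
theorem norm_expSum_sq_le {M : Matrix (Fin s) (Fin s) ℤ} (hM : M.IsSymm)
    (hdet : (M.submatrix ι κ).det ≠ 0) (K : ℕ) (hK : 1 ≤ K) (hMK : ∀ i, ∑ j, |M i j| ≤ K) (N : ℕ)
    (hN : 1 ≤ N) (θ : ℝ) (q : ℕ) (a : ℤ) (hq : 1 ≤ q) (hcop : IsCoprime a (q : ℤ))
    (hqN : q ≤ 2 * (2 * K) * N) (hθ : |θ - a / q| ≤ 1 / (2 * (2 * K : ℕ) * N * q))
    (Ω : (Fin s → ℤ) → ℂ) (hΩ : ∀ x u v, Ω (override ι κ x u v) = Ω x)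
    (g : ℤ → ℂ) (hg : ∀ n, ‖g n‖ ≤ 1) :
    ‖∑ x ∈ intBox (Fin s) N, Ω x * (∏ i, g (x i)) * ee (θ * (Qf M x : ℤ))‖ ^ 2
      ≤ (4800 * K ^ 2) ^ r * (∑ x ∈ intBox (Fin s) N, ‖Ω x‖) ^ 2 *
        (1 / (q * (1 + N ^ 2 * |θ - a / q|)) + 1 / N) ^ r := by
  classical
  set B : Matrix (Fin r) (Fin r) ℤ := (2 : ℤ) • M.submatrix ι κ with hB
  have hBdet : B.det ≠ 0 := by
    rw [hB, Matrix.det_smul]; positivity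
  have hBK : ∀ i, ∑ j, |B i j| ≤ ((2 * K : ℕ) : ℤ) := by
    intro i
    have h1 : ∑ j, |B i j| = 2 * ∑ j, |M (ι i) (κ j)| := by
      rw [Finset.mul_sum]
      refine Finset.sum_congr rfl fun j _ => ?_
      rw [hB, Matrix.smul_apply, smul_eq_mul, abs_mul, Matrix.submatrix_apply]
      norm_num
    have h2 : ∑ j, |M (ι i) (κ j)| ≤ ∑ j, |M (ι i) j| := by
      rw [← Finset.sum_image (f := fun j => |M (ι i) j|) (g := κ) (s := Finset.univ)
        (fun x _ y _ h => hκ h)]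
      exact Finset.sum_le_sum_of_subset_of_nonneg (Finset.subset_univ _) fun _ _ _ => abs_nonneg _
    have h3 := hMK (ι i)
    rw [h1]; push_cast; linarith
  set E : ℝ := 1200 * ((2 * K : ℕ) : ℝ) ^ 2 * N ^ 3 *
    (1 / (q * (1 + N ^ 2 * |θ - a / q|)) + 1 / N) with hE
  have hE0 : 0 ≤ E := by positivity
  have hEle := sum_geomE_sq_le (2 * K) (by omega) N hN θ q a hq hcop
    (by exact_mod_cast hqN) hθ
  have key : ∀ x : Fin s → ℤ, ‖∑ u ∈ intBox (Fin r) N, ∑ v ∈ intBox (Fin r) N,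
      Ω (override ι κ x u v) * (∏ i, g (override ι κ x u v i)) *
        ee (θ * (Qf M (override ι κ x u v) : ℤ))‖ ≤ ‖Ω x‖ * Real.sqrt (N ^ r * E ^ r) := by
    intro x
    set o := override ι κ x 0 0
    set P : ℂ := ∏ i, if i ∈ Set.range ι ∨ i ∈ Set.range κ then (1 : ℂ) else g (x i) with hP
    have hP1 : ‖P‖ ≤ 1 := by
      rw [hP, norm_prod]
      refine Finset.prod_le_one (fun _ _ => norm_nonneg _) fun i _ => ?_
      split_ifs
      · simp
      · exact hg _
    have e : ∀ u v, Ω (override ι κ x u v) * (∏ i, g (override ι κ x u v i)) *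
        ee (θ * (Qf M (override ι κ x u v) : ℤ))
        = (Ω x * P) * (((∏ k, g (u k)) * ee (θ * (Qf M (o + Function.extend ι u 0) : ℤ))) *
          ((∏ k, g (v k)) * ee (θ * (Qf M (o + Function.extend κ v 0) - Qf M o : ℤ))) *
          ee (θ * ((u ⬝ᵥ B.mulVec v : ℤ) : ℝ))) := by
      intro u v
      rw [hΩ, prod_override hι hκ hικ]
      have h1 : ee (θ * (Qf M (override ι κ x u v) : ℤ))
          = ee (θ * (Qf M (o + Function.extend ι u 0) : ℤ)) *
            ee (θ * (Qf M (o + Function.extend κ v 0) - Qf M o : ℤ)) *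
            ee (θ * ((u ⬝ᵥ B.mulVec v : ℤ) : ℝ)) := by
        rw [← ee_add, ← ee_add, override_eq_add hι hκ hικ, Qf_add_add hM,
          extend_dotProduct_mulVec_extend hι hκ]
        congr 1
        rw [hB, Matrix.smul_mulVec, dotProduct_smul]
        push_cast [smul_eq_mul]
        ring
      rw [h1]
      ring
    simp_rw [e, ← Finset.mul_sum]
    rw [norm_mul]
    have hb := norm_bilinear_sq_le B θ hBdet (2 * K) hBK N
      (fun u => (∏ k, g (u k)) * ee (θ * (Qf M (o + Function.extend ι u 0) : ℤ)))
      (fun v => (∏ k, g (v k)) * ee (θ * (Qf M (o + Function.extend κ v 0) - Qf M o : ℤ)))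
      (fun u => by
        rw [norm_mul, norm_ee, mul_one, norm_prod]
        exact Finset.prod_le_one (fun _ _ => norm_nonneg _) fun _ _ => hg _)
      (fun u => by
        rw [norm_mul, norm_ee, mul_one, norm_prod]
        exact Finset.prod_le_one (fun _ _ => norm_nonneg _) fun _ _ => hg _)
    refine mul_le_mul ?_ (Real.le_sqrt_of_sq_le (hb.trans ?_)) (norm_nonneg _) (norm_nonneg _)
    · rw [norm_mul]; exact mul_le_of_le_one_right (norm_nonneg _) hP1
    · refine mul_le_mul_of_nonneg_left (pow_le_pow_left₀ ?_ hEle r) (by positivity)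
      exact Finset.sum_nonneg fun _ _ => by positivity
  have hsum := sum_override hι hκ hικ N
    (fun x => Ω x * (∏ i, g (x i)) * ee (θ * (Qf M x : ℤ)))
  have hle : (N : ℝ) ^ (2 * r) *
      ‖∑ x ∈ intBox (Fin s) N, Ω x * (∏ i, g (x i)) * ee (θ * (Qf M x : ℤ))‖
      ≤ (∑ x ∈ intBox (Fin s) N, ‖Ω x‖) * Real.sqrt (N ^ r * E ^ r) := by
    have : (N : ℝ) ^ (2 * r) = ‖(N : ℂ) ^ (2 * r)‖ := by simp
    rw [this, ← norm_mul, ← hsum, Finset.sum_mul]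
    exact (norm_sum_le _ _).trans (Finset.sum_le_sum fun x _ => key x)
  have hN0 : (0 : ℝ) < N := by exact_mod_cast hN
  have hsq := pow_le_pow_left₀ (by positivity) hle 2
  rw [mul_pow, mul_pow, Real.sq_sqrt (by positivity)] at hsq
  have hpos : (0 : ℝ) < ((N : ℝ) ^ (2 * r)) ^ 2 := by positivity
  refine le_of_mul_le_mul_left (hsq.trans (le_of_eq ?_)) hpos
  have : (N : ℝ) ^ r * E ^ r = ((N : ℝ) ^ (2 * r)) ^ 2 * ((4800 * K ^ 2) ^ r *
      (1 / (q * (1 + N ^ 2 * |θ - a / q|)) + 1 / N) ^ r) := by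
    rw [← mul_pow, ← mul_pow, ← pow_mul, show 2 * r * 2 = 4 * r by ring, pow_mul, ← mul_pow, hE]
    congr 1
    push_cast
    ring
  rw [this]
  ring

end Override

section Minors

lemma exists_linearIndependent_rows {K : Type*} [Field K] {m r n : ℕ}
    (A : Matrix (Fin m) (Fin r) K) (h : n ≤ A.rank) :
    ∃ e : Fin n → Fin m, Function.Injective e ∧ LinearIndependent K (fun i => A (e i)) := by
  rw [Matrix.rank_eq_finrank_span_row] at h
  obtain ⟨f, hf, -, hli⟩ := Submodule.exists_fun_fin_finrank_span_eq K (Set.range A.row)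
  choose g hg using hf
  have hli' : LinearIndependent K (fun i => A (g (Fin.castLE h i))) := by
    have := hli.comp (Fin.castLE h) (Fin.castLE_injective h)
    have e : (fun i => A (g (Fin.castLE h i))) = f ∘ Fin.castLE h := funext fun i => hg _
    rwa [e]
  refine ⟨fun i => g (Fin.castLE h i), fun i j hij => ?_, hli'⟩
  refine hli'.injective ?_
  simp only at hij
  simp only [hij]

lemma exists_det_ne_zero_of_le_rank {K : Type*} [Field K] {m r n : ℕ}
    (A : Matrix (Fin m) (Fin r) K) (h : n ≤ A.rank) :
    ∃ (e : Fin n → Fin m) (e' : Fin n → Fin r), Function.Injective e ∧ Function.Injective e' ∧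
      (A.submatrix e e').det ≠ 0 := by
  obtain ⟨e, he, hli⟩ := exists_linearIndependent_rows A h
  have h1 : n ≤ (A.submatrix e id).transpose.rank := by
    have := LinearIndependent.rank_matrix (M := A.submatrix e id) hli
    rw [Matrix.rank_transpose, this, Fintype.card_fin]
  obtain ⟨e', he', hli'⟩ := exists_linearIndependent_rows _ h1
  refine ⟨e, e', he, he', ?_⟩
  have h2 : IsUnit (A.submatrix e e').transpose := by
    rw [← Matrix.linearIndependent_rows_iff_isUnit]
    exact hli'
  rw [Matrix.isUnit_transpose, Matrix.isUnit_iff_isUnit_det] at h2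
  exact h2.ne_zero

variable {s : ℕ}

/-- `ι` and `κ` index the rows and columns of a nonsingular off-diagonal submatrix of `M`. -/
structure IsOffMinor (M : Matrix (Fin s) (Fin s) ℤ) {r : ℕ} (ι κ : Fin r → Fin s) : Prop where
  left_injective : Function.Injective ι
  right_injective : Function.Injective κ
  ne : ∀ k l, ι k ≠ κ l
  det_ne_zero : (M.submatrix ι κ).det ≠ 0

variable {M : Matrix (Fin s) (Fin s) ℤ}

lemma RankOffGe.exists_isOffMinor {n : ℕ} (h : RankOffGe M n) :
    ∃ ι κ : Fin n → Fin s, IsOffMinor M ι κ := by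
  obtain ⟨r, ι, κ, hι, hκ, hne, hr⟩ := h
  obtain ⟨e, e', he, he', hdet⟩ := exists_det_ne_zero_of_le_rank _ hr
  refine ⟨ι ∘ e, κ ∘ e', hι.comp he, hκ.comp he', fun k l => hne _ _, fun h0 => hdet ?_⟩
  have := (Int.castRingHom ℚ).map_det (M.submatrix (ι ∘ e) (κ ∘ e'))
  rw [h0, map_zero] at this
  exact this.symm

lemma IsOffMinor.exists_avoiding {n : ℕ} {ι κ : Fin (n + 1) → Fin s} (h : IsOffMinor M ι κ)
    (a : Fin s) : ∃ ι' κ' : Fin n → Fin s, IsOffMinor M ι' κ' ∧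
      Set.range ι' ⊆ Set.range ι ∧ Set.range κ' ⊆ Set.range κ ∧
      a ∉ Set.range ι' ∧ a ∉ Set.range κ' := by
  have sub : ∀ i j : Fin (n + 1),
      ((M.submatrix ι κ).submatrix i.succAbove j.succAbove).det ≠ 0 →
      IsOffMinor M (ι ∘ i.succAbove) (κ ∘ j.succAbove) := fun i j hd =>
    ⟨h.left_injective.comp (Fin.succAbove_right_injective),
      h.right_injective.comp (Fin.succAbove_right_injective), fun _ _ => h.ne _ _, hd⟩
  have hrow : ∀ i : Fin (n + 1), ∃ j : Fin (n + 1), ((M.submatrix ι κ).submatrix i.succAbove j.succAbove).det ≠ 0 := by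
    intro i
    by_contra! hc
    refine h.det_ne_zero ?_
    rw [Matrix.det_succ_row _ i]
    exact Finset.sum_eq_zero fun j _ => by rw [hc j, mul_zero]
  by_cases ha : a ∈ Set.range κ
  · obtain ⟨j, rfl⟩ := ha
    have : ∃ i : Fin (n + 1), ((M.submatrix ι κ).submatrix i.succAbove j.succAbove).det ≠ 0 := by
      by_contra! hc
      refine h.det_ne_zero ?_
      rw [Matrix.det_succ_column _ j]
      exact Finset.sum_eq_zero fun i _ => by rw [hc i, mul_zero]
    obtain ⟨i, hi⟩ := this
    refine ⟨_, _, sub i j hi, Set.range_comp_subset_range _ _, Set.range_comp_subset_range _ _,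
      ?_, ?_⟩
    · rintro ⟨k, hk⟩; exact h.ne _ _ hk
    · rintro ⟨k, hk⟩; exact Fin.succAbove_ne j k (h.right_injective hk)
  · by_cases ha' : a ∈ Set.range ι
    · obtain ⟨i, rfl⟩ := ha'
      obtain ⟨j, hj⟩ := hrow i
      refine ⟨_, _, sub i j hj, Set.range_comp_subset_range _ _, Set.range_comp_subset_range _ _,
        ?_, ?_⟩
      · rintro ⟨k, hk⟩; exact Fin.succAbove_ne i k (h.left_injective hk)
      · rintro ⟨k, hk⟩; exact h.ne _ _ hk.symm
    · obtain ⟨j, hj⟩ := hrow 0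
      refine ⟨_, _, sub 0 j hj, Set.range_comp_subset_range _ _, Set.range_comp_subset_range _ _,
        fun hh => ha' (Set.range_comp_subset_range _ _ hh),
        fun hh => ha (Set.range_comp_subset_range _ _ hh)⟩

lemma IsOffMinor.exists_avoiding_two {n : ℕ} {ι κ : Fin (n + 2) → Fin s} (h : IsOffMinor M ι κ)
    (a b : Fin s) : ∃ ι' κ' : Fin n → Fin s, IsOffMinor M ι' κ' ∧
      (a ∉ Set.range ι' ∧ a ∉ Set.range κ') ∧ b ∉ Set.range ι' ∧ b ∉ Set.range κ' := by
  obtain ⟨ι₁, κ₁, h1, -, -, h2, h3⟩ := h.exists_avoiding a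
  obtain ⟨ι₂, κ₂, h4, h5, h6, h7, h8⟩ := h1.exists_avoiding b
  exact ⟨ι₂, κ₂, h4, ⟨fun h => h2 (h5 h), fun h => h3 (h6 h)⟩, h7, h8⟩

end Minors

section PadicZeros

variable {p : ℕ} [hp : Fact p.Prime]

lemma PadicInt.exists_quadratic_root {A B C : ℤ_[p]} (h : ‖C‖ < ‖B‖ ^ 2) :
    ∃ T : ℤ_[p], A * T ^ 2 + B * T + C = 0 := by
  have h1 : ‖(Polynomial.C A * Polynomial.X ^ 2 + Polynomial.C B * Polynomial.X +
      Polynomial.C C : Polynomial ℤ_[p]).aeval (0 : ℤ_[p])‖ <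
      ‖(Polynomial.C A * Polynomial.X ^ 2 + Polynomial.C B * Polynomial.X +
      Polynomial.C C : Polynomial ℤ_[p]).derivative.aeval (0 : ℤ_[p])‖ ^ 2 := by
    simpa using h
  obtain ⟨z, hz, -⟩ := hensels_lemma h1
  refine ⟨z, ?_⟩
  simpa using hz

lemma PadicInt.exists_isotropic_of_approx {n : ℕ} (a x : Fin n → ℤ_[p]) (k : Fin n)
    (h : ‖∑ i, a i * x i ^ 2‖ < ‖2 * a k * x k‖ ^ 2) :
    ∃ y : Fin n → ℤ_[p], y ≠ 0 ∧ ∑ i, a i * y i ^ 2 = 0 := by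
  obtain ⟨T, hT⟩ := PadicInt.exists_quadratic_root (A := a k) h
  have hsum : ∀ (f : Fin n → ℤ_[p]) (t : ℤ_[p]), ∑ i, f i * (Pi.single k t : Fin n → ℤ_[p]) i
      = f k * t := by
    intro f t
    rw [Finset.sum_eq_single k]
    · simp
    · intro i _ hi; simp [Pi.single_eq_of_ne hi]
    · simp
  have hval : ∀ t : ℤ_[p], ∑ i, a i * (x + Pi.single k t : Fin n → ℤ_[p]) i ^ 2
      = a k * t ^ 2 + 2 * a k * x k * t + ∑ i, a i * x i ^ 2 := by
    intro t
    have e : ∀ i, a i * (x + Pi.single k t : Fin n → ℤ_[p]) i ^ 2 = a i * x i ^ 2 +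
        (2 * a i * x i) * (Pi.single k t : Fin n → ℤ_[p]) i +
        (a i * (Pi.single k t : Fin n → ℤ_[p]) i) * (Pi.single k t : Fin n → ℤ_[p]) i := by
      intro i; simp only [Pi.add_apply]; ring
    simp_rw [e, Finset.sum_add_distrib]
    rw [hsum, hsum]
    simp only [Pi.single_eq_same]
    ring
  refine ⟨x + Pi.single k T, fun h0 => ?_, by rw [hval, hT]⟩
  have hxk : x k = -T := by
    have := congrFun h0 k
    simp only [Pi.add_apply, Pi.single_eq_same, Pi.zero_apply] at this
    exact eq_neg_of_add_eq_zero_left this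
  have h2 : ∑ i, a i * x i ^ 2 = a k * T ^ 2 := by
    rw [hxk] at hT
    linear_combination hT
  rw [h2, hxk, norm_mul, norm_mul, norm_mul, norm_pow, norm_neg] at h
  have h3 : ‖(2 : ℤ_[p])‖ ≤ 1 := PadicInt.norm_le_one _
  have h4 : ‖a k‖ ≤ 1 := PadicInt.norm_le_one _
  have h5 : (‖(2 : ℤ_[p])‖ * ‖a k‖ * ‖T‖) ^ 2 ≤ ‖a k‖ * ‖T‖ ^ 2 := by
    rw [mul_pow]
    refine mul_le_mul_of_nonneg_right ?_ (by positivity)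
    have : ‖(2 : ℤ_[p])‖ * ‖a k‖ ≤ ‖a k‖ := mul_le_of_le_one_left (norm_nonneg _) h3
    calc (‖(2 : ℤ_[p])‖ * ‖a k‖) ^ 2 ≤ ‖a k‖ ^ 2 := by gcongr
      _ ≤ ‖a k‖ := by rw [sq]; exact mul_le_of_le_one_left (norm_nonneg _) h4
  exact absurd h (not_lt.mpr h5)

lemma PadicInt.toZMod_eq_zero_iff (x : ℤ_[p]) : PadicInt.toZMod x = 0 ↔ ‖x‖ < 1 := by
  rw [← RingHom.mem_ker, PadicInt.ker_toZMod, IsLocalRing.mem_maximalIdeal, PadicInt.mem_nonunits]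

lemma PadicInt.exists_quinary_zero_of_ne_two (hp2 : p ≠ 2) (a : Fin 5 → ℤ_[p])
    (h0 : ‖a 0‖ = 1) (h1 : ‖a 1‖ = 1) (h2 : ‖a 2‖ = 1) :
    ∃ y : Fin 5 → ℤ_[p], y ≠ 0 ∧ ∑ i, a i * y i ^ 2 = 0 := by
  have hne : ∀ x : ℤ_[p], ‖x‖ = 1 → PadicInt.toZMod x ≠ 0 := by
    intro x hx h
    rw [PadicInt.toZMod_eq_zero_iff] at h
    linarith
  have hodd : Fintype.card (ZMod p) % 2 = 1 := by
    rw [ZMod.card]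
    exact hp.out.eq_two_or_odd.resolve_left hp2
  obtain ⟨b, c, hbc⟩ := FiniteField.exists_root_sum_quadratic
    (f := Polynomial.C (PadicInt.toZMod (a 0)) * Polynomial.X ^ 2)
    (g := Polynomial.C (PadicInt.toZMod (a 1)) * Polynomial.X ^ 2 +
      Polynomial.C (PadicInt.toZMod (a 2)))
    (Polynomial.degree_C_mul_X_pow 2 (hne _ h0))
    (by
      rw [Polynomial.degree_add_C]
      · exact Polynomial.degree_C_mul_X_pow 2 (hne _ h1)
      · rw [Polynomial.degree_C_mul_X_pow 2 (hne _ h1)]; decide) hodd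
  simp only [Polynomial.eval_mul, Polynomial.eval_C, Polynomial.eval_pow, Polynomial.eval_X,
    Polynomial.eval_add] at hbc
  set x : Fin 5 → ℤ_[p] := ![(b.val : ℤ_[p]), (c.val : ℤ_[p]), 1, 0, 0] with hx
  have hb : PadicInt.toZMod (b.val : ℤ_[p]) = b := by rw [map_natCast, ZMod.natCast_zmod_val]
  have hc : PadicInt.toZMod (c.val : ℤ_[p]) = c := by rw [map_natCast, ZMod.natCast_zmod_val]
  have hsum : ‖∑ i, a i * x i ^ 2‖ < 1 := by
    rw [← PadicInt.toZMod_eq_zero_iff]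
    simp only [Fin.sum_univ_five, hx]
    simp only [Matrix.cons_val]
    simp only [map_add, map_mul, map_pow, hb, hc, map_one, map_zero]
    linear_combination hbc
  have h2' : ‖(2 : ℤ_[p])‖ = 1 := by
    have : ((2 : ℕ) : ℤ_[p]) = 2 := by norm_num
    rw [← this, PadicInt.norm_natCast_eq_one_iff]
    exact (Nat.coprime_primes hp.out Nat.prime_two).mpr hp2
  have hunit : ∀ z : ℤ_[p], PadicInt.toZMod z ≠ 0 → ‖z‖ = 1 := by
    intro z hz
    rw [Ne, PadicInt.toZMod_eq_zero_iff, not_lt] at hz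
    exact le_antisymm (PadicInt.norm_le_one _) hz
  by_cases hb0 : b = 0
  · have hc0 : c ≠ 0 := by
      rintro rfl
      rw [hb0] at hbc
      refine hne _ h2 ?_
      linear_combination hbc
    refine PadicInt.exists_isotropic_of_approx a x 1 ?_
    rw [norm_mul, norm_mul, h2', h1]
    have : ‖x 1‖ = 1 := hunit _ (by simp only [hx, Matrix.cons_val]; rw [hc]; exact hc0)
    rw [this]; linarith
  · refine PadicInt.exists_isotropic_of_approx a x 0 ?_
    rw [norm_mul, norm_mul, h2', h0]
    have : ‖x 0‖ = 1 := hunit _ (by simp only [hx, Matrix.cons_val]; rw [hb]; exact hb0)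
    rw [this]; linarith

lemma exists_quinary_zero_mod_eight (n : Fin 5 → ℤ) (h0 : n 0 % 2 = 1) (h1 : n 1 % 2 = 1)
    (h2 : n 2 % 2 = 1) (h3 : n 3 % 4 ≠ 0) (h4 : n 4 % 4 ≠ 0) :
    ∃ x : Fin 5 → ℤ, (8 : ℤ) ∣ ∑ i, n i * x i ^ 2 ∧
      (x 0 % 2 = 1 ∨ x 1 % 2 = 1 ∨ x 2 % 2 = 1) := by
  have red : ∀ x : Fin 5 → ℤ, (8 ∣ n 0 * x 0 ^ 2 + n 1 * x 1 ^ 2 + n 2 * x 2 ^ 2 +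
      n 3 * x 3 ^ 2 + n 4 * x 4 ^ 2 ∧ (x 0 % 2 = 1 ∨ x 1 % 2 = 1 ∨ x 2 % 2 = 1)) →
      ∃ x : Fin 5 → ℤ, (8 : ℤ) ∣ ∑ i, n i * x i ^ 2 ∧
      (x 0 % 2 = 1 ∨ x 1 % 2 = 1 ∨ x 2 % 2 = 1) := by
    intro x hx
    refine ⟨x, ?_, hx.2⟩
    rw [Fin.sum_univ_five]; exact hx.1
  generalize n 0 = n0 at *
  generalize n 1 = n1 at *
  generalize n 2 = n2 at *
  generalize n 3 = n3 at *
  generalize n 4 = n4 at *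
  by_cases c1 : (n0 + n1) % 4 = 0
  · by_cases c : (n0 + n1) % 8 = 0
    · refine red ![1, 1, 0, 0, 0] ?_; simp; omega
    · refine red ![1, 1, 2, 0, 0] ?_; simp; omega
  by_cases c2 : (n0 + n2) % 4 = 0
  · by_cases c : (n0 + n2) % 8 = 0
    · refine red ![1, 0, 1, 0, 0] ?_; simp; omega
    · refine red ![1, 2, 1, 0, 0] ?_; simp; omega
  by_cases c4 : n3 % 2 = 0
  · by_cases c : (n0 + n1 + n3) % 8 = 0
    · refine red ![1, 1, 0, 1, 0] ?_; simp; omega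
    · refine red ![1, 1, 2, 1, 0] ?_; simp; omega
  by_cases c5 : n4 % 2 = 0
  · by_cases c : (n0 + n1 + n4) % 8 = 0
    · refine red ![1, 1, 0, 0, 1] ?_; simp; omega
    · refine red ![1, 1, 2, 0, 1] ?_; simp; omega
  by_cases c6 : (n0 + n3) % 4 = 0
  · by_cases c : (n0 + n3) % 8 = 0
    · refine red ![1, 0, 0, 1, 0] ?_; simp; omega
    · refine red ![1, 2, 0, 1, 0] ?_; simp; omega
  by_cases c : (n0 + n1 + n2 + n3) % 8 = 0
  · refine red ![1, 1, 1, 1, 0] ?_; simp; omega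
  · refine red ![1, 1, 1, 1, 2] ?_; simp; omega

lemma PadicInt.exists_quinary_zero_two [Fact (Nat.Prime 2)] (a : Fin 5 → ℤ_[2])
    (h0 : ‖a 0‖ = 1) (h1 : ‖a 1‖ = 1) (h2 : ‖a 2‖ = 1) (h3 : (2 : ℝ)⁻¹ ≤ ‖a 3‖)
    (h4 : (2 : ℝ)⁻¹ ≤ ‖a 4‖) :
    ∃ y : Fin 5 → ℤ_[2], y ≠ 0 ∧ ∑ i, a i * y i ^ 2 = 0 := by
  have happ : ∀ i, ∃ w : ℤ_[2], a i = ((((a i).appr 3 : ℕ) : ℤ) : ℤ_[2]) + 8 * w := by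
    intro i
    have := PadicInt.appr_spec 3 (a i)
    rw [Ideal.mem_span_singleton] at this
    obtain ⟨w, hw⟩ := this
    refine ⟨w, ?_⟩
    push_cast at hw ⊢
    linear_combination hw
  choose w hw using happ
  set n : Fin 5 → ℤ := fun i => (((a i).appr 3 : ℕ) : ℤ)
  have n2 : ‖(2 : ℤ_[2])‖ = (2 : ℝ)⁻¹ := by simpa using PadicInt.norm_p (p := 2)
  have n4 : ‖(4 : ℤ_[2])‖ = (4 : ℝ)⁻¹ := by
    rw [show (4 : ℤ_[2]) = 2 * 2 by norm_num, norm_mul, n2]; norm_num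
  have n8 : ‖(8 : ℤ_[2])‖ = (8 : ℝ)⁻¹ := by
    rw [show (8 : ℤ_[2]) = 2 * 4 by norm_num, norm_mul, n2, n4]; norm_num
  have hodd : ∀ i, ‖a i‖ = 1 → n i % 2 = 1 := by
    intro i hi
    by_contra hc
    obtain ⟨m, hm⟩ : (2 : ℤ) ∣ n i := by omega
    have : a i = 2 * ((m : ℤ_[2]) + 4 * w i) := by
      rw [hw i]
      change ((n i : ℤ) : ℤ_[2]) + _ = _
      rw [hm]; push_cast; ring
    rw [this, norm_mul, n2] at hi
    have := PadicInt.norm_le_one ((m : ℤ_[2]) + 4 * w i)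
    linarith
  have hnot4 : ∀ i, (2 : ℝ)⁻¹ ≤ ‖a i‖ → n i % 4 ≠ 0 := by
    intro i hi hc
    obtain ⟨m, hm⟩ : (4 : ℤ) ∣ n i := by omega
    have : a i = 4 * ((m : ℤ_[2]) + 2 * w i) := by
      rw [hw i]
      change ((n i : ℤ) : ℤ_[2]) + _ = _
      rw [hm]; push_cast; ring
    rw [this, norm_mul, n4] at hi
    have := PadicInt.norm_le_one ((m : ℤ_[2]) + 2 * w i)
    linarith
  obtain ⟨x, ⟨t, ht⟩, hx⟩ := exists_quinary_zero_mod_eight n (hodd 0 h0) (hodd 1 h1) (hodd 2 h2)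
    (hnot4 3 h3) (hnot4 4 h4)
  have hval : ∑ i, a i * (x i : ℤ_[2]) ^ 2 = 8 * (t + ∑ i, w i * (x i : ℤ_[2]) ^ 2) := by
    have e : ∀ i, a i * (x i : ℤ_[2]) ^ 2 = ((n i * x i ^ 2 : ℤ) : ℤ_[2]) +
        8 * (w i * (x i : ℤ_[2]) ^ 2) := by
      intro i
      conv_lhs => rw [hw i]
      change (((n i : ℤ) : ℤ_[2]) + _) * _ = _
      push_cast
      ring
    simp_rw [e, Finset.sum_add_distrib]
    rw [← Int.cast_sum, ht, ← Finset.mul_sum]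
    push_cast
    ring
  have hnorm : ‖∑ i, a i * (x i : ℤ_[2]) ^ 2‖ ≤ (8 : ℝ)⁻¹ := by
    rw [hval, norm_mul, n8]
    have := PadicInt.norm_le_one ((t : ℤ_[2]) + ∑ i, w i * (x i : ℤ_[2]) ^ 2)
    linarith
  have fin : ∀ k, ‖a k‖ = 1 → x k % 2 = 1 →
      ∃ y : Fin 5 → ℤ_[2], y ≠ 0 ∧ ∑ i, a i * y i ^ 2 = 0 := by
    intro k hk hxk
    refine PadicInt.exists_isotropic_of_approx a (fun i => (x i : ℤ_[2])) k ?_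
    have hx1 : ‖(x k : ℤ_[2])‖ = 1 := by
      refine le_antisymm (PadicInt.norm_le_one _) ?_
      by_contra hc
      rw [not_le, PadicInt.norm_int_lt_one_iff_dvd] at hc
      push_cast at hc
      omega
    rw [norm_mul, norm_mul, n2, hk, hx1]
    refine hnorm.trans_lt ?_
    norm_num
  rcases hx with hx | hx | hx
  · exact fin 0 h0 hx
  · exact fin 1 h1 hx
  · exact fin 2 h2 hx

lemma PadicInt.exists_quinary_zero (a : Fin 5 → ℤ_[p])
    (h0 : ‖a 0‖ = 1) (h1 : ‖a 1‖ = 1) (h2 : ‖a 2‖ = 1) (h3 : (p : ℝ)⁻¹ ≤ ‖a 3‖)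
    (h4 : (p : ℝ)⁻¹ ≤ ‖a 4‖) :
    ∃ y : Fin 5 → ℤ_[p], y ≠ 0 ∧ ∑ i, a i * y i ^ 2 = 0 := by
  by_cases hp2 : p = 2
  · subst hp2
    exact PadicInt.exists_quinary_zero_two a h0 h1 h2 (by simpa using h3) (by simpa using h4)
  · exact PadicInt.exists_quinary_zero_of_ne_two hp2 a h0 h1 h2

end PadicZeros

section PadicForms

variable {p : ℕ} [hp : Fact p.Prime]

lemma Padic.exists_sq_mul_norm {a : ℚ_[p]} (ha : a ≠ 0) :
    (∃ c : ℚ_[p], c ≠ 0 ∧ ‖c ^ 2 * a‖ = 1) ∨ ∃ c : ℚ_[p], c ≠ 0 ∧ ‖c ^ 2 * a‖ = (p : ℝ)⁻¹ := by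
  have hp0 : (p : ℚ_[p]) ≠ 0 := by exact_mod_cast hp.out.ne_zero
  have hpR : (p : ℝ) ≠ 0 := by exact_mod_cast hp.out.ne_zero
  have hn := Padic.norm_eq_zpow_neg_valuation ha
  rcases Int.even_or_odd' a.valuation with ⟨k, hk | hk⟩
  · refine Or.inl ⟨(p : ℚ_[p]) ^ (-k), zpow_ne_zero _ hp0, ?_⟩
    rw [norm_mul, norm_pow, Padic.norm_p_zpow, hn, hk, ← zpow_natCast, ← zpow_mul, ← zpow_add₀ hpR]
    ring_nf
    simp
  · refine Or.inr ⟨(p : ℚ_[p]) ^ (-k), zpow_ne_zero _ hp0, ?_⟩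
    rw [norm_mul, norm_pow, Padic.norm_p_zpow, hn, hk, ← zpow_natCast, ← zpow_mul, ← zpow_add₀ hpR]
    ring_nf
    simp

lemma Padic.exists_quinary_zero_of_norm (a c : Fin 5 → ℚ_[p]) (hc : ∀ i, c i ≠ 0)
    (h0 : ‖c 0 ^ 2 * a 0‖ = 1) (h1 : ‖c 1 ^ 2 * a 1‖ = 1) (h2 : ‖c 2 ^ 2 * a 2‖ = 1)
    (h3 : ‖c 3 ^ 2 * a 3‖ = 1 ∨ ‖c 3 ^ 2 * a 3‖ = (p : ℝ)⁻¹)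
    (h4 : ‖c 4 ^ 2 * a 4‖ = 1 ∨ ‖c 4 ^ 2 * a 4‖ = (p : ℝ)⁻¹) :
    ∃ y : Fin 5 → ℚ_[p], y ≠ 0 ∧ ∑ i, a i * y i ^ 2 = 0 := by
  have hp1 : (p : ℝ)⁻¹ ≤ 1 := inv_le_one_of_one_le₀ (by exact_mod_cast hp.out.one_le)
  have hle : ∀ i, ‖c i ^ 2 * a i‖ ≤ 1 := by
    intro i
    fin_cases i
    · exact h0.le
    · exact h1.le
    · exact h2.le
    · rcases h3 with h | h
      · exact h.le
      · exact h.le.trans hp1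
    · rcases h4 with h | h
      · exact h.le
      · exact h.le.trans hp1
  obtain ⟨y, hy, hsum⟩ := PadicInt.exists_quinary_zero (fun i => (⟨c i ^ 2 * a i, hle i⟩ : ℤ_[p]))
    h0 h1 h2 (h3.elim (fun h => hp1.trans h.ge) fun h => h.ge)
    (h4.elim (fun h => hp1.trans h.ge) fun h => h.ge)
  refine ⟨fun i => c i * (y i : ℚ_[p]), fun h => hy ?_, ?_⟩
  · funext i
    have := congrFun h i
    simp only [Pi.zero_apply, mul_eq_zero, hc i, false_or] at this
    exact PadicInt.ext this
  · have := congrArg (fun z : ℤ_[p] => (z : ℚ_[p])) hsum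
    simp only [PadicInt.coe_sum, PadicInt.coe_zero] at this
    rw [← this]
    refine Finset.sum_congr rfl fun i _ => ?_
    change _ = (c i ^ 2 * a i) * (y i : ℚ_[p]) ^ 2
    ring

lemma exists_perm_fin_five (e : Fin 5 → Bool) :
    ∃ σ : Equiv.Perm (Fin 5), e (σ 0) = e (σ 1) ∧ e (σ 1) = e (σ 2) := by
  revert e; decide

lemma Padic.exists_quinary_zero (a : Fin 5 → ℚ_[p]) (ha : ∀ i, a i ≠ 0) :
    ∃ y : Fin 5 → ℚ_[p], y ≠ 0 ∧ ∑ i, a i * y i ^ 2 = 0 := by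
  classical
  have hp0 : (p : ℚ_[p]) ≠ 0 := by exact_mod_cast hp.out.ne_zero
  have hpR : (p : ℝ) ≠ 0 := by exact_mod_cast hp.out.ne_zero
  obtain ⟨σ, hσ1, hσ2⟩ := exists_perm_fin_five
    (fun i => decide (∃ c : ℚ_[p], c ≠ 0 ∧ ‖c ^ 2 * a i‖ = 1))
  have key : ∀ b : Fin 5 → ℚ_[p], (∀ i, b i ≠ 0) → (∀ i, i = 0 ∨ i = 1 ∨ i = 2 →
      ∃ c : ℚ_[p], c ≠ 0 ∧ ‖c ^ 2 * b i‖ = 1) →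
      ∃ y : Fin 5 → ℚ_[p], y ≠ 0 ∧ ∑ i, b i * y i ^ 2 = 0 := by
    intro b hb h
    have h' : ∀ i, ∃ c : ℚ_[p], c ≠ 0 ∧ (‖c ^ 2 * b i‖ = 1 ∨ ‖c ^ 2 * b i‖ = (p : ℝ)⁻¹) ∧
        (i = 0 ∨ i = 1 ∨ i = 2 → ‖c ^ 2 * b i‖ = 1) := by
      intro i
      by_cases hi : i = 0 ∨ i = 1 ∨ i = 2
      · obtain ⟨c, hc, hc'⟩ := h i hi
        exact ⟨c, hc, Or.inl hc', fun _ => hc'⟩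
      · rcases Padic.exists_sq_mul_norm (hb i) with ⟨c, hc, hc'⟩ | ⟨c, hc, hc'⟩
        · exact ⟨c, hc, Or.inl hc', fun _ => hc'⟩
        · exact ⟨c, hc, Or.inr hc', fun h => absurd h hi⟩
    choose c hc hc1 hc2 using h'
    exact Padic.exists_quinary_zero_of_norm b c hc (hc2 0 (by simp)) (hc2 1 (by simp))
      (hc2 2 (by simp)) (hc1 3) (hc1 4)
  have back : (∃ (t : ℚ_[p]) (y : Fin 5 → ℚ_[p]), t ≠ 0 ∧ y ≠ 0 ∧
      ∑ i, (t * a (σ i)) * y i ^ 2 = 0) →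
      ∃ y : Fin 5 → ℚ_[p], y ≠ 0 ∧ ∑ i, a i * y i ^ 2 = 0 := by
    rintro ⟨t, y, ht, hy, hsum⟩
    refine ⟨fun i => y (σ.symm i), fun h => hy ?_, ?_⟩
    · funext i
      have := congrFun h (σ i)
      simpa using this
    · rw [← Equiv.sum_comp σ]
      simp only [Equiv.symm_apply_apply]
      simp_rw [mul_assoc, ← Finset.mul_sum] at hsum
      exact (mul_eq_zero.mp hsum).resolve_left ht
  apply back
  by_cases hc : ∃ c : ℚ_[p], c ≠ 0 ∧ ‖c ^ 2 * a (σ 0)‖ = 1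
  · have h1 : ∃ c : ℚ_[p], c ≠ 0 ∧ ‖c ^ 2 * a (σ 1)‖ = 1 := by
      rw [decide_eq_decide] at hσ1; exact hσ1.mp hc
    have h2 : ∃ c : ℚ_[p], c ≠ 0 ∧ ‖c ^ 2 * a (σ 2)‖ = 1 := by
      rw [decide_eq_decide] at hσ2; exact hσ2.mp h1
    obtain ⟨y, hy, hsum⟩ := key (fun i => a (σ i)) (fun i => ha _) (by
      rintro i (rfl | rfl | rfl)
      · exact hc
      · exact h1
      · exact h2)
    exact ⟨1, y, one_ne_zero, hy, by simpa using hsum⟩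
  · have h1 : ¬ ∃ c : ℚ_[p], c ≠ 0 ∧ ‖c ^ 2 * a (σ 1)‖ = 1 := by
      rw [decide_eq_decide] at hσ1; exact fun h => hc (hσ1.mpr h)
    have h2 : ¬ ∃ c : ℚ_[p], c ≠ 0 ∧ ‖c ^ 2 * a (σ 2)‖ = 1 := by
      rw [decide_eq_decide] at hσ2; exact fun h => h1 (hσ2.mpr h)
    have conv : ∀ i, (¬ ∃ c : ℚ_[p], c ≠ 0 ∧ ‖c ^ 2 * a i‖ = 1) →
        ∃ c : ℚ_[p], c ≠ 0 ∧ ‖c ^ 2 * ((p : ℚ_[p])⁻¹ * a i)‖ = 1 := by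
      intro i hi
      obtain ⟨c, hc, hc'⟩ := (Padic.exists_sq_mul_norm (ha i)).resolve_left hi
      refine ⟨c, hc, ?_⟩
      rw [mul_left_comm, norm_mul, hc', norm_inv, Padic.norm_p, inv_inv, mul_inv_cancel₀ hpR]
    obtain ⟨y, hy, hsum⟩ := key (fun i => (p : ℚ_[p])⁻¹ * a (σ i))
      (fun i => mul_ne_zero (inv_ne_zero hp0) (ha _)) (by
      rintro i (rfl | rfl | rfl)
      · exact conv _ hc
      · exact conv _ h1
      · exact conv _ h2)
    exact ⟨_, y, inv_ne_zero hp0, hy, hsum⟩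

end PadicForms

section IsotropicVector

variable {s : ℕ} {M : Matrix (Fin s) (Fin s) ℤ}

lemma IsOffMinor.le_rank_map {K : Type*} [Field K] [CharZero K] {r : ℕ} {ι κ : Fin r → Fin s}
    (h : IsOffMinor M ι κ) : r ≤ (M.map (Int.castRingHom K)).rank := by
  have h1 : ((M.map (Int.castRingHom K)).submatrix ι κ).det ≠ 0 := by
    have := (Int.castRingHom K).map_det (M.submatrix ι κ)
    intro h0
    refine h.det_ne_zero ?_
    have h2 : (Int.castRingHom K) (M.submatrix ι κ).det = 0 := by rw [this]; exact h0
    simpa using h2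
  have h2 := Matrix.rank_of_isUnit _ ((Matrix.isUnit_iff_isUnit_det _).mpr (isUnit_iff_ne_zero.mpr h1))
  rw [Fintype.card_fin] at h2
  rw [← h2]
  exact Matrix.rank_submatrix_le _ _ _

lemma exists_orthogonal_family {K : Type*} [Field K] [CharZero K] {r : ℕ}
    {A : Matrix (Fin s) (Fin s) K} (hA : A.IsSymm) (hr : r ≤ A.rank) :
    ∃ v : Fin r → Fin s → K, (∀ i j, i ≠ j → v i ⬝ᵥ A.mulVec (v j) = 0) ∧
      ∀ i, v i ⬝ᵥ A.mulVec (v i) ≠ 0 := by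
  classical
  have : Invertible (2 : K) := invertibleOfNonzero two_ne_zero
  have hB : LinearMap.IsSymm (Matrix.toBilin' A) := by
    refine ⟨fun x y => ?_⟩
    simp only [Matrix.toBilin'_apply', RingHom.id_apply]
    rw [Matrix.dotProduct_mulVec, dotProduct_comm, ← Matrix.mulVec_transpose, hA.eq]
  obtain ⟨v, hv⟩ := LinearMap.BilinForm.exists_orthogonal_basis (K := K) hB
  have hv' : ∀ i j, i ≠ j → v i ⬝ᵥ A.mulVec (v j) = 0 := by
    intro i j hij
    have := hv hij
    simpa [Function.onFun, Matrix.toBilin'_apply'] using this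
  set S := Finset.univ.filter fun i => v i ⬝ᵥ A.mulVec (v i) ≠ 0 with hS
  have hker : ∀ i, i ∉ S → A.mulVec (v i) = 0 := by
    intro i hi
    simp only [hS, Finset.mem_filter, Finset.mem_univ, true_and, not_not] at hi
    have hall : ∀ j, v j ⬝ᵥ A.mulVec (v i) = 0 := by
      intro j
      by_cases hji : j = i
      · rw [hji]; exact hi
      · exact hv' j i hji
    have hz : ∀ w : Fin s → K, w ⬝ᵥ A.mulVec (v i) = 0 := by
      intro w
      rw [← v.sum_repr w, sum_dotProduct]
      exact Finset.sum_eq_zero fun j _ => by rw [smul_dotProduct, hall, smul_zero]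
    funext k
    have := hz (Pi.single k 1)
    simpa using this
  have hcard : A.rank ≤ S.card := by
    have h1 : LinearMap.range A.mulVecLin ≤
        Submodule.span K ((S.image fun i => A.mulVec (v i) : Finset (Fin s → K)) : Set (Fin s → K)) := by
      rintro _ ⟨w, rfl⟩
      rw [Matrix.mulVecLin_apply, ← v.sum_repr w, Matrix.mulVec_sum]
      refine Submodule.sum_mem _ fun i _ => ?_
      rw [Matrix.mulVec_smul]
      refine Submodule.smul_mem _ _ ?_
      by_cases hi : i ∈ S
      · exact Submodule.subset_span (by
          rw [Finset.coe_image]; exact ⟨i, hi, rfl⟩)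
      · rw [hker i hi]; exact Submodule.zero_mem _
    exact (Submodule.finrank_mono h1).trans
      ((finrank_span_finset_le_card _).trans Finset.card_image_le)
  refine ⟨fun i => v (S.orderEmbOfCardLe (hr.trans hcard) i), fun i j hij => hv' _ _ ?_, fun i => ?_⟩
  · exact fun h => hij ((S.orderEmbOfCardLe (hr.trans hcard)).injective h)
  · have := S.orderEmbOfCardLe_mem (hr.trans hcard) i
    exact (Finset.mem_filter.mp this).2

/-- A symmetric integer matrix of rank at least five has a nonsingular `p`-adic zero. -/
lemma exists_padicInt_isotropic (hM : M.IsSymm) {ι κ : Fin 5 → Fin s} (h : IsOffMinor M ι κ)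
    (p : ℕ) [hp : Fact p.Prime] :
    ∃ z : Fin s → ℤ_[p], z ⬝ᵥ (M.map (Int.castRingHom ℤ_[p])).mulVec z = 0 ∧
      (M.map (Int.castRingHom ℤ_[p])).mulVec z ≠ 0 := by
  set A := M.map (Int.castRingHom ℚ_[p]) with hA
  have hAs : A.IsSymm := hM.map _
  obtain ⟨v, hv, hv'⟩ := exists_orthogonal_family hAs (h.le_rank_map (K := ℚ_[p]))
  obtain ⟨y, hy, hsum⟩ := Padic.exists_quinary_zero (fun i => v i ⬝ᵥ A.mulVec (v i)) hv'
  set z : Fin s → ℚ_[p] := ∑ i, y i • v i with hz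
  have hvz : ∀ i, v i ⬝ᵥ A.mulVec z = y i * (v i ⬝ᵥ A.mulVec (v i)) := by
    intro i
    rw [hz, Matrix.mulVec_sum, dotProduct_sum, Finset.sum_eq_single i]
    · rw [Matrix.mulVec_smul, dotProduct_smul, smul_eq_mul]
    · intro j _ hj
      rw [Matrix.mulVec_smul, dotProduct_smul, hv i j hj.symm, smul_zero]
    · simp
  have hzz : z ⬝ᵥ A.mulVec z = 0 := by
    rw [← hsum]
    conv_lhs => rw [hz, sum_dotProduct]
    refine Finset.sum_congr rfl fun i _ => ?_
    rw [smul_dotProduct, ← hz, hvz, smul_eq_mul]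
    ring
  have hAz : A.mulVec z ≠ 0 := by
    intro h0
    refine hy ?_
    funext i
    have := hvz i
    rw [h0, dotProduct_zero] at this
    exact (mul_eq_zero.mp this.symm).resolve_right (hv' i)
  have hp0 : (p : ℚ_[p]) ≠ 0 := by exact_mod_cast hp.out.ne_zero
  have hp1 : (1 : ℝ) < p := by exact_mod_cast hp.out.one_lt
  obtain ⟨n, hn⟩ := pow_unbounded_of_one_lt ‖z‖ hp1
  have hle : ∀ i, ‖(p : ℚ_[p]) ^ n * z i‖ ≤ 1 := by
    intro i
    rw [norm_mul, norm_pow, Padic.norm_p, inv_pow]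
    rw [inv_mul_le_iff₀ (by positivity), mul_one]
    exact (norm_le_pi_norm z i).trans hn.le
  set w : Fin s → ℤ_[p] := fun i => ⟨(p : ℚ_[p]) ^ n * z i, hle i⟩ with hw
  have hwz : (fun i => PadicInt.Coe.ringHom (w i)) = (p : ℚ_[p]) ^ n • z := by
    funext i; rfl
  have hmv : (fun i => PadicInt.Coe.ringHom ((M.map (Int.castRingHom ℤ_[p])).mulVec w i))
      = A.mulVec ((p : ℚ_[p]) ^ n • z) := by
    funext i
    rw [← hwz]
    simp only [Matrix.mulVec, dotProduct, map_sum, map_mul, hA, Matrix.map_apply]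
    simp
  refine ⟨w, ?_, fun h0 => hAz ?_⟩
  · have : PadicInt.Coe.ringHom (w ⬝ᵥ (M.map (Int.castRingHom ℤ_[p])).mulVec w) = 0 := by
      have e : PadicInt.Coe.ringHom (w ⬝ᵥ (M.map (Int.castRingHom ℤ_[p])).mulVec w)
          = (fun i => PadicInt.Coe.ringHom (w i)) ⬝ᵥ
            (fun i => PadicInt.Coe.ringHom ((M.map (Int.castRingHom ℤ_[p])).mulVec w i)) := by
        simp only [dotProduct, map_sum, map_mul]
      rw [e, hmv, hwz, Matrix.mulVec_smul, smul_dotProduct, dotProduct_smul, hzz]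
      simp
    exact PadicInt.ext this
  · rw [h0] at hmv
    rw [Matrix.mulVec_smul] at hmv
    have : (p : ℚ_[p]) ^ n • A.mulVec z = 0 := by
      rw [← hmv]; funext i; simp
    exact (smul_eq_zero.mp this).resolve_left (pow_ne_zero _ hp0)

end IsotropicVector

section LocalCount

variable {s : ℕ}

/-- The number of zeros of the quadratic form of `M` modulo `m`. -/
def zeroCount (M : Matrix (Fin s) (Fin s) ℤ) (m : ℕ) : ℕ :=
  ((intBox (Fin s) m).filter fun z => (m : ℤ) ∣ Qf M z).card

variable {M : Matrix (Fin s) (Fin s) ℤ}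

lemma one_le_zeroCount {m : ℕ} (hm : 1 ≤ m) : 1 ≤ zeroCount M m := by
  refine Finset.card_pos.mpr ⟨0, ?_⟩
  rw [Finset.mem_filter, mem_intBox]
  refine ⟨fun i => ⟨le_rfl, ?_⟩, ?_⟩
  · simp only [Pi.zero_apply]; omega
  · simp [Qf]

lemma Matrix.dotProduct_mulVec_add {n R : Type*} [Fintype n] [CommRing R] {F : Matrix n n R}
    (hF : F.IsSymm) (x y : n → R) :
    (x + y) ⬝ᵥ F.mulVec (x + y) = x ⬝ᵥ F.mulVec x + 2 * (y ⬝ᵥ F.mulVec x) + y ⬝ᵥ F.mulVec y := by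
  have h : x ⬝ᵥ F.mulVec y = y ⬝ᵥ F.mulVec x := by
    rw [Matrix.dotProduct_mulVec, dotProduct_comm, ← Matrix.mulVec_transpose, hF.eq]
  simp only [Matrix.mulVec_add, dotProduct_add, add_dotProduct, h]
  ring

lemma exists_padicInt_lift {p : ℕ} [hp : Fact p.Prime] {F : Matrix (Fin s) (Fin s) ℤ_[p]}
    (hF : F.IsSymm) {z : Fin s → ℤ_[p]} (hz : z ⬝ᵥ F.mulVec z = 0) {i : Fin s} {t : ℕ}
    (ht : ‖2 * F.mulVec z i‖ = (p : ℝ) ^ (-t : ℤ)) (w : Fin s → ℤ_[p]) :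
    ∃ y : Fin s → ℤ_[p], y ⬝ᵥ F.mulVec y = 0 ∧
      ∀ j, j ≠ i → y j = z j + (p : ℤ_[p]) ^ (2 * t + 1) * w j := by
  have hp1 : (1 : ℝ) < p := by exact_mod_cast hp.out.one_lt
  set P : ℤ_[p] := (p : ℤ_[p]) ^ (2 * t + 1) with hP
  have hPn : ‖P‖ = (p : ℝ) ^ (-(2 * t + 1 : ℕ) : ℤ) := by
    rw [hP]; exact PadicInt.norm_p_pow _
  set x : Fin s → ℤ_[p] := z + P • w with hx
  have hB : ‖2 * F.mulVec x i‖ = (p : ℝ) ^ (-t : ℤ) := by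
    have e : 2 * F.mulVec x i = 2 * F.mulVec z i + P * (2 * F.mulVec w i) := by
      simp only [hx, Matrix.mulVec_add, Matrix.mulVec_smul, Pi.add_apply, Pi.smul_apply, smul_eq_mul]
      ring
    have hlt : ‖P * (2 * F.mulVec w i)‖ < ‖2 * F.mulVec z i‖ := by
      rw [ht, norm_mul, hPn]
      refine (mul_le_of_le_one_right (by positivity) (PadicInt.norm_le_one _)).trans_lt ?_
      exact zpow_lt_zpow_right₀ hp1 (by push_cast; omega)
    rw [e, PadicInt.norm_add_eq_max_of_ne hlt.ne', max_eq_left hlt.le, ht]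
  have hC : ‖x ⬝ᵥ F.mulVec x‖ < ‖2 * F.mulVec x i‖ ^ 2 := by
    have e : x ⬝ᵥ F.mulVec x = P * (2 * (w ⬝ᵥ F.mulVec z) + P * (w ⬝ᵥ F.mulVec w)) := by
      rw [hx, Matrix.dotProduct_mulVec_add hF, hz]
      simp only [Matrix.mulVec_smul, smul_dotProduct, dotProduct_smul, smul_eq_mul]
      ring
    rw [e, norm_mul, hPn, hB]
    refine (mul_le_of_le_one_right (by positivity) (PadicInt.norm_le_one _)).trans_lt ?_
    rw [← zpow_natCast, ← zpow_mul]
    exact zpow_lt_zpow_right₀ hp1 (by push_cast; omega)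
  obtain ⟨T, hT⟩ := PadicInt.exists_quadratic_root (A := F i i) hC
  refine ⟨x + Pi.single i T, ?_, fun j hj => ?_⟩
  · rw [Matrix.dotProduct_mulVec_add hF, ← hT]
    simp
    ring
  · simp [hx, hj]

lemma exists_zeroCount_prime_pow (hM : M.IsSymm) {ι κ : Fin 5 → Fin s} (h : IsOffMinor M ι κ)
    (p : ℕ) [hp : Fact p.Prime] :
    ∃ c : ℝ, 0 < c ∧ ∀ k : ℕ, c * ((p ^ k : ℕ) : ℝ) ^ s ≤ (p ^ k : ℕ) * zeroCount M (p ^ k) := by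
  obtain ⟨z, hz, hz'⟩ := exists_padicInt_isotropic hM h p
  set F := M.map (Int.castRingHom ℤ_[p]) with hFdef
  have hF : F.IsSymm := hM.map _
  obtain ⟨i, hi⟩ := Function.ne_iff.mp hz'
  have hb : 2 * F.mulVec z i ≠ 0 := mul_ne_zero two_ne_zero hi
  set t := (2 * F.mulVec z i).valuation with htdef
  have ht : ‖2 * F.mulVec z i‖ = (p : ℝ) ^ (-t : ℤ) := PadicInt.norm_eq_zpow_neg_valuation hb
  set e := 2 * t + 1 with he
  have hp0 : 0 < p := hp.out.pos
  have hpR : (0 : ℝ) < p := by exact_mod_cast hp0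
  refine ⟨(((p ^ e : ℕ) : ℝ) ^ s)⁻¹, by positivity, fun k => ?_⟩
  rw [inv_mul_le_iff₀ (by positivity)]
  have hnat : (p ^ k) ^ s ≤ (p ^ e) ^ s * (p ^ k * zeroCount M (p ^ k)) := by
    have hpk : 1 ≤ p ^ k := Nat.one_le_pow _ _ hp0
    rcases lt_or_ge k e with hk | hk
    · calc (p ^ k) ^ s ≤ (p ^ e) ^ s * (1 * 1) := by
            rw [mul_one, mul_one]
            exact Nat.pow_le_pow_left (Nat.pow_le_pow_right hp0 hk.le) s
        _ ≤ _ := by gcongr; exact one_le_zeroCount hpk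
    · set n := p ^ (k - e) with hn
      have hkn : p ^ k = p ^ e * n := by rw [hn, ← pow_add]; congr 1; omega
      have : NeZero (p ^ k) := ⟨by omega⟩
      choose y hy0 hyj using fun w : Fin s → ℤ =>
        exists_padicInt_lift hF hz ht (fun j => ((w j : ℤ) : ℤ_[p]))
      have hmain : n ^ s ≤ n * zeroCount M (p ^ k) := by
        have hc := card_intBox (Fin s) n
        rw [Fintype.card_fin] at hc
        rw [← hc]
        have hc2 : n * zeroCount M (p ^ k) = ((Finset.Ico (0 : ℤ) n) ×ˢ
            ((intBox (Fin s) (p ^ k)).filter fun z => ((p ^ k : ℕ) : ℤ) ∣ Qf M z)).card := by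
          rw [Finset.card_product, Int.card_Ico]; simp [zeroCount]
        rw [hc2]
        refine Finset.card_le_card_of_injOn
          (fun w => (w i, fun j => ((PadicInt.toZModPow k (y w j)).val : ℤ))) ?_ ?_
        · intro w hw
          rw [Finset.mem_coe, mem_intBox] at hw
          rw [Finset.mem_coe, Finset.mem_product, Finset.mem_filter, mem_intBox]
          refine ⟨Finset.mem_Ico.mpr (hw i), fun j => ⟨by positivity, ?_⟩, ?_⟩
          · exact Int.ofNat_lt.mpr (ZMod.val_lt _)
          · rw [← ZMod.intCast_zmod_eq_zero_iff_dvd, Qf]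
            have := congrArg (PadicInt.toZModPow k) (hy0 w)
            simp only [dotProduct, Matrix.mulVec, map_sum, map_mul, map_zero, Finset.mul_sum, hFdef,
              Matrix.map_apply, eq_intCast, map_intCast] at this
            push_cast
            simp only [ZMod.natCast_val, ZMod.cast_id', id_eq]
            rw [← this]
            exact Finset.sum_congr rfl fun a _ => Finset.sum_congr rfl fun b _ => by ring
        · intro w hw w' hw' hww
          rw [Finset.mem_coe, mem_intBox] at hw hw'
          simp only [Prod.mk.injEq] at hww
          funext j
          by_cases hj : j = i
          · rw [hj]; exact hww.1
          · have h1 := congrFun hww.2 j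
            simp only [Nat.cast_inj] at h1
            have h2 := ZMod.val_injective _ h1
            rw [hyj w j hj, hyj w' j hj] at h2
            simp only [map_add, map_mul, map_pow, map_natCast, map_intCast, add_right_inj] at h2
            have h3 : ((p ^ k : ℕ) : ℤ) ∣ (p : ℤ) ^ e * (w j - w' j) := by
              rw [← ZMod.intCast_zmod_eq_zero_iff_dvd]
              push_cast
              rw [mul_sub, h2, sub_self]
            rw [hkn] at h3
            push_cast at h3
            have h4 : (n : ℤ) ∣ w j - w' j :=
              Int.dvd_of_mul_dvd_mul_left (by positivity) h3
            have h5 := Int.eq_zero_of_abs_lt_dvd h4 (by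
              rw [abs_lt]; have := hw j; have := hw' j; constructor <;> omega)
            omega
      calc (p ^ k) ^ s = (p ^ e) ^ s * n ^ s := by rw [hkn, mul_pow]
        _ ≤ (p ^ e) ^ s * (n * zeroCount M (p ^ k)) := by gcongr
        _ ≤ _ := by
            gcongr
            rw [hkn]
            exact Nat.le_mul_of_pos_left _ (by positivity)
  exact_mod_cast hnat

end LocalCount

section LocalDensity

lemma ee_eq_one_iff (t : ℝ) : ee t = 1 ↔ ∃ n : ℤ, t = n := by
  constructor
  · intro h
    unfold ee at h
    obtain ⟨n, hn⟩ := Complex.exp_eq_one_iff.mp h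
    refine ⟨n, ?_⟩
    have h1 : ((2 * Real.pi * t : ℝ) : ℂ) = ((2 * Real.pi * n : ℝ) : ℂ) := by
      have : Complex.I * ((2 * Real.pi * t : ℝ) : ℂ) = Complex.I * ((2 * Real.pi * n : ℝ) : ℂ) := by
        rw [hn]; push_cast; ring
      exact mul_left_cancel₀ Complex.I_ne_zero this
    have h2 : 2 * Real.pi * t = 2 * Real.pi * n := Complex.ofReal_injective h1
    exact mul_left_cancel₀ (by positivity) h2
  · rintro ⟨n, rfl⟩
    exact ee_int n

lemma sum_range_ee_div {m : ℕ} (hm : 1 ≤ m) (n : ℤ) :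
    ∑ a ∈ Finset.range m, ee ((a : ℝ) / m * n) = if (m : ℤ) ∣ n then (m : ℂ) else 0 := by
  have hmR : (m : ℝ) ≠ 0 := by positivity
  have h : ∀ a : ℕ, ee ((a : ℝ) / m * n) = ee ((n : ℝ) / m) ^ a := by
    intro a; rw [← ee_nat_mul]; congr 1; ring
  simp_rw [h]
  split_ifs with hd
  · obtain ⟨k, rfl⟩ := hd
    have : ee (((m * k : ℤ) : ℝ) / m) = 1 := by
      rw [ee_eq_one_iff]; exact ⟨k, by push_cast; field_simp⟩
    simp_rw [this]
    simp
  · have h1 : ee ((n : ℝ) / m) ≠ 1 := by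
      intro h1
      obtain ⟨k, hk⟩ := (ee_eq_one_iff _).mp h1
      refine hd ⟨k, ?_⟩
      rw [div_eq_iff hmR] at hk
      rw [mul_comm]; exact_mod_cast hk
    rw [geom_sum_eq h1, ← ee_nat_mul]
    have : (m : ℝ) * ((n : ℝ) / m) = n := by field_simp
    rw [this, ee_int]; simp

variable {s : ℕ} {M : Matrix (Fin s) (Fin s) ℤ}

lemma exists_row_bound (M : Matrix (Fin s) (Fin s) ℤ) :
    ∃ K : ℕ, 1 ≤ K ∧ ∀ i, ∑ j, |M i j| ≤ K := by
  refine ⟨1 + ∑ i, ∑ j, (M i j).natAbs, by omega, fun i => ?_⟩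
  push_cast
  have := Finset.single_le_sum (f := fun i => ∑ j, |M i j|) (s := Finset.univ)
    (fun i _ => Finset.sum_nonneg fun j _ => abs_nonneg _) (Finset.mem_univ i)
  linarith

lemma mul_zeroCount_eq {m : ℕ} (hm : 1 ≤ m) :
    (m : ℂ) * zeroCount M m
      = ∑ a ∈ Finset.range m, ∑ z ∈ intBox (Fin s) m, ee ((a : ℝ) / m * (Qf M z : ℤ)) := by
  rw [Finset.sum_comm]
  simp_rw [sum_range_ee_div hm]
  rw [← Finset.sum_filter, Finset.sum_const, nsmul_eq_mul, mul_comm]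
  rfl

/-- The denominator of the fraction `a / m` in lowest terms. -/
def redDen (m a : ℕ) : ℕ := m / Nat.gcd a m

lemma card_filter_redDen_le (m q : ℕ) (hm : 1 ≤ m) :
    ((Finset.range m).filter fun a => redDen m a = q).card ≤ q := by
  have : ((Finset.range m).filter fun a => redDen m a = q).card ≤ (Finset.range q).card := by
    refine Finset.card_le_card_of_injOn (fun a => a / Nat.gcd a m) ?_ ?_
    · intro a ha
      rw [Finset.mem_coe, Finset.mem_filter, Finset.mem_range] at ha
      rw [Finset.mem_coe, Finset.mem_range, ← ha.2]
      exact Nat.div_lt_div_of_lt_of_dvd (Nat.gcd_dvd_right a m) ha.1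
    · intro a ha b hb hab
      rw [Finset.mem_coe, Finset.mem_filter, Finset.mem_range] at ha hb
      simp only at hab
      have hga := Nat.gcd_pos_of_pos_right a (show 0 < m from hm)
      have hgb := Nat.gcd_pos_of_pos_right b (show 0 < m from hm)
      have e1 := Nat.div_mul_cancel (Nat.gcd_dvd_right a m)
      have e2 := Nat.div_mul_cancel (Nat.gcd_dvd_right b m)
      rw [← redDen, ha.2] at e1
      rw [← redDen, hb.2] at e2
      have hq : 0 < q := by
        rcases Nat.eq_zero_or_pos q with h | h
        · subst h; omega
        · exact h
      have hg : Nat.gcd a m = Nat.gcd b m := Nat.eq_of_mul_eq_mul_left hq (e1.trans e2.symm)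
      rw [← Nat.div_mul_cancel (Nat.gcd_dvd_left a m), ← Nat.div_mul_cancel (Nat.gcd_dvd_left b m),
        hab, hg]
  simpa using this

lemma norm_sum_ee_div_le (hM : M.IsSymm) {ι κ : Fin 5 → Fin s} (h : IsOffMinor M ι κ) {K : ℕ}
    (hK : 1 ≤ K) (hMK : ∀ i, ∑ j, |M i j| ≤ K) {m : ℕ} (hm : 1 ≤ m) (a : ℕ) :
    ‖∑ z ∈ intBox (Fin s) m, ee ((a : ℝ) / m * (Qf M z : ℤ))‖
      ≤ (9600 * K ^ 2) ^ 3 * m ^ s * (redDen m a : ℝ) ^ (-(5 / 2) : ℝ) := by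
  set g := Nat.gcd a m with hg
  have hg0 : 0 < g := Nat.gcd_pos_of_pos_right a hm
  set q := redDen m a with hq
  have hqm : q * g = m := Nat.div_mul_cancel (Nat.gcd_dvd_right a m)
  have hag : (a / g) * g = a := Nat.div_mul_cancel (Nat.gcd_dvd_left a m)
  have hq1 : 1 ≤ q := by
    rcases Nat.eq_zero_or_pos q with h0 | h0
    · rw [h0, zero_mul] at hqm; omega
    · exact h0
  have hqle : q ≤ m := by rw [← hqm]; exact Nat.le_mul_of_pos_right _ hg0
  have hgR : (g : ℝ) ≠ 0 := by positivity
  have hqR : (q : ℝ) ≠ 0 := by positivity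
  have hfrac : (a : ℝ) / m = ((a / g : ℕ) : ℤ) / (q : ℕ) := by
    have e1 : (a : ℝ) = ((a / g : ℕ) : ℝ) * g := by exact_mod_cast hag.symm
    have e2 : (m : ℝ) = q * g := by exact_mod_cast hqm.symm
    rw [e1, e2, Int.cast_natCast]; field_simp
  have hcop : IsCoprime (((a / g : ℕ) : ℤ)) (q : ℤ) :=
    Nat.isCoprime_iff_coprime.mpr (Nat.coprime_div_gcd_div_gcd hg0)
  have key := norm_expSum_sq_le h.left_injective h.right_injective h.ne hM h.det_ne_zero K hK hMK m hm
    ((a : ℝ) / m) q ((a / g : ℕ) : ℤ) hq1 hcop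
    (hqle.trans (Nat.le_mul_of_pos_left _ (by omega))) (by
      rw [hfrac, sub_self, abs_zero]; positivity) (fun _ => 1) (fun _ _ _ => rfl) (fun _ => 1)
    (fun _ => by simp)
  rw [← hfrac, sub_self, abs_zero] at key
  simp only [Finset.prod_const_one, one_mul, norm_one, Finset.sum_const, card_intBox,
    Fintype.card_fin, nsmul_eq_mul, mul_one, mul_zero, add_zero] at key
  push_cast at key
  have hqm' : (1 : ℝ) / m ≤ 1 / q := by
    apply one_div_le_one_div_of_le (by positivity); exact_mod_cast hqle
  have hK1 : (1 : ℝ) ≤ K := by exact_mod_cast hK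
  refine (pow_le_pow_iff_left₀ (norm_nonneg _) (by positivity) two_ne_zero).mp ?_
  refine key.trans ?_
  calc (4800 * (K : ℝ) ^ 2) ^ 5 * ((m : ℝ) ^ s) ^ 2 * (1 / q + 1 / m) ^ 5
      ≤ (4800 * (K : ℝ) ^ 2) ^ 5 * ((m : ℝ) ^ s) ^ 2 * (1 / q + 1 / q) ^ 5 := by gcongr
    _ = (9600 * (K : ℝ) ^ 2) ^ 5 * ((m : ℝ) ^ s) ^ 2 * ((q : ℝ) ^ 5)⁻¹ := by field_simp; ring
    _ ≤ (9600 * (K : ℝ) ^ 2) ^ 6 * ((m : ℝ) ^ s) ^ 2 * ((q : ℝ) ^ 5)⁻¹ := by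
        gcongr
        · nlinarith
        · norm_num
    _ = _ := by
        have : ((q : ℝ) ^ (-(5 / 2) : ℝ)) ^ 2 = ((q : ℝ) ^ 5)⁻¹ := by
          rw [← Real.rpow_natCast, ← Real.rpow_mul (by positivity), ← Real.rpow_natCast,
            ← Real.rpow_neg (by positivity)]
          norm_num
        rw [← this]
        ring

lemma exists_le_zeroCount_of_large_primes (hM : M.IsSymm) {ι κ : Fin 5 → Fin s}
    (h : IsOffMinor M ι κ) :
    ∃ P : ℕ, ∀ m : ℕ, 1 ≤ m → (∀ p : ℕ, p.Prime → p ∣ m → P ≤ p) →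
      1 / 2 * (m : ℝ) ^ s ≤ m * zeroCount M m := by
  obtain ⟨K, hK, hMK⟩ := exists_row_bound M
  set C : ℝ := (9600 * K ^ 2) ^ 3 with hC
  have hC0 : 0 < C := by positivity
  have hsum : Summable fun n : ℕ => (n : ℝ) ^ (-(3 / 2) : ℝ) :=
    Real.summable_nat_rpow.mpr (by norm_num)
  obtain ⟨S, hS⟩ := summable_iff_vanishing_norm.mp hsum (1 / (2 * C)) (by positivity)
  refine ⟨S.sup id + 1, fun m hm hP => ?_⟩
  have hmR : (1 : ℝ) ≤ m := by exact_mod_cast hm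
  have heq := mul_zeroCount_eq (M := M) hm
  obtain ⟨n, rfl⟩ : ∃ n, m = n + 1 := ⟨m - 1, by omega⟩
  rw [Finset.sum_range_succ'] at heq
  have h0 : ∑ z ∈ intBox (Fin s) (n + 1), ee (((0 : ℕ) : ℝ) / ((n + 1 : ℕ) : ℝ) * (Qf M z : ℤ))
      = ((n + 1 : ℕ) : ℂ) ^ s := by
    simp only [Nat.cast_zero, zero_div, zero_mul, ee_zero, Finset.sum_const, card_intBox,
      Fintype.card_fin, nsmul_eq_mul, mul_one]
    push_cast; rfl
  rw [h0] at heq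
  set m := n + 1 with hmn
  have hden : ∀ a ∈ Finset.range n, S.sup id + 1 ≤ redDen m (a + 1) := by
    intro a ha
    rw [Finset.mem_range] at ha
    have hg0 : 0 < Nat.gcd (a + 1) m := Nat.gcd_pos_of_pos_right _ hm
    have hqm : redDen m (a + 1) * Nat.gcd (a + 1) m = m :=
      Nat.div_mul_cancel (Nat.gcd_dvd_right _ m)
    have hne : redDen m (a + 1) ≠ 1 := by
      intro h1
      rw [h1, one_mul] at hqm
      have := Nat.le_of_dvd (by omega) (Nat.gcd_dvd_left (a + 1) m)
      omega
    have h1 := hP _ (Nat.minFac_prime hne) ((Nat.minFac_dvd _).trans ⟨_, hqm.symm⟩)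
    refine h1.trans (Nat.minFac_le ?_)
    rcases Nat.eq_zero_or_pos (redDen m (a + 1)) with h2 | h2
    · rw [h2, zero_mul] at hqm; omega
    · exact h2
  have hbound : ∑ a ∈ Finset.range n, (redDen m (a + 1) : ℝ) ^ (-(5 / 2) : ℝ) ≤ 1 / (2 * C) := by
    set T := (Finset.range n).image fun a => redDen m (a + 1) with hT
    rw [← Finset.sum_fiberwise_of_maps_to (g := fun a => redDen m (a + 1)) (t := T)
      (fun a ha => Finset.mem_image_of_mem _ ha)]
    have hT1 : ∀ q ∈ T, S.sup id + 1 ≤ q := by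
      intro q hq
      obtain ⟨a, ha, rfl⟩ := Finset.mem_image.mp hq
      exact hden a ha
    have hdisj : Disjoint T S := by
      rw [Finset.disjoint_left]
      intro q hq hqS
      have h1 := hT1 q hq
      have h2 := Finset.le_sup (f := id) hqS
      simp only [id] at h2
      omega
    have hlt := hS T hdisj
    refine le_trans ?_ ((le_abs_self _).trans hlt.le)
    refine Finset.sum_le_sum fun q hq => ?_
    have hq1 : 1 ≤ q := by have := hT1 q hq; omega
    have hqR : (0 : ℝ) < q := by positivity
    rw [Finset.sum_congr rfl (g := fun _ => (q : ℝ) ^ (-(5 / 2) : ℝ)) (fun a ha => by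
      rw [(Finset.mem_filter.mp ha).2])]
    rw [Finset.sum_const, nsmul_eq_mul]
    have hcard : ((Finset.range n).filter fun a => redDen m (a + 1) = q).card ≤ q := by
      refine le_trans ?_ (card_filter_redDen_le m q hm)
      refine Finset.card_le_card_of_injOn (fun a => a + 1) ?_ (fun a _ b _ hab => by simpa using hab)
      intro a ha
      simp only [Finset.mem_coe, Finset.mem_filter, Finset.mem_range] at ha ⊢
      exact ⟨by omega, ha.2⟩
    calc (((Finset.range n).filter fun a => redDen m (a + 1) = q).card : ℝ) * (q : ℝ) ^ (-(5 / 2) : ℝ)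
        ≤ (q : ℝ) * (q : ℝ) ^ (-(5 / 2) : ℝ) := by
          gcongr
      _ = (q : ℝ) ^ (-(3 / 2) : ℝ) := by
          conv_lhs => rw [← Real.rpow_one_add' hqR.le (by norm_num)]
          norm_num
  have hnorm : ‖(m : ℂ) ^ s - m * zeroCount M m‖ ≤ 1 / 2 * (m : ℝ) ^ s := by
    rw [heq, norm_sub_rev, add_sub_cancel_right]
    refine (norm_sum_le _ _).trans ?_
    calc ∑ a ∈ Finset.range n, ‖∑ z ∈ intBox (Fin s) m, ee (((a + 1 : ℕ) : ℝ) / m * (Qf M z : ℤ))‖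
        ≤ ∑ a ∈ Finset.range n, C * (m : ℝ) ^ s * (redDen m (a + 1) : ℝ) ^ (-(5 / 2) : ℝ) :=
          Finset.sum_le_sum fun a _ => norm_sum_ee_div_le hM h hK hMK hm (a + 1)
      _ ≤ C * (m : ℝ) ^ s * (1 / (2 * C)) := by
          rw [← Finset.mul_sum]; gcongr
      _ = _ := by field_simp
  have hre : ‖(m : ℂ) ^ s - m * zeroCount M m‖ = |(m : ℝ) ^ s - m * zeroCount M m| := by
    rw [← Real.norm_eq_abs, ← Complex.norm_real]; push_cast; rfl
  rw [hre] at hnorm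
  have := le_abs_self ((m : ℝ) ^ s - m * zeroCount M m)
  linarith

lemma dvd_Qf_sub {d : ℤ} {x y : Fin s → ℤ} (h : ∀ i, d ∣ x i - y i) : d ∣ Qf M x - Qf M y := by
  simp only [Qf, ← Finset.sum_sub_distrib]
  refine Finset.dvd_sum fun i _ => Finset.dvd_sum fun j _ => ?_
  have e : x i * M i j * x j - y i * M i j * y j
      = (x i - y i) * (M i j * x j) + (x j - y j) * (y i * M i j) := by ring
  rw [e]
  exact dvd_add (Dvd.dvd.mul_right (h i) _) (Dvd.dvd.mul_right (h j) _)

lemma zeroCount_mul_le {m n : ℕ} (hm : 1 ≤ m) (hn : 1 ≤ n) (hmn : Nat.Coprime m n) :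
    zeroCount M m * zeroCount M n ≤ zeroCount M (m * n) := by
  obtain ⟨u, v, huv⟩ := Nat.isCoprime_iff_coprime.mpr hmn
  unfold zeroCount
  rw [← Finset.card_product]
  set φ : (Fin s → ℤ) × (Fin s → ℤ) → Fin s → ℤ :=
    fun zw i => (v * n * zw.1 i + u * m * zw.2 i) % ((m * n : ℕ) : ℤ) with hφ
  have hmn0 : (0 : ℤ) < ((m * n : ℕ) : ℤ) := by positivity
  have hmod : ∀ zw i, ((m * n : ℕ) : ℤ) ∣ φ zw i - (v * n * zw.1 i + u * m * zw.2 i) := by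
    intro zw i
    exact (Int.mod_modEq _ _).symm.dvd
  have h1 : ∀ zw i, (m : ℤ) ∣ φ zw i - zw.1 i := by
    intro zw i
    have e : φ zw i - zw.1 i = (φ zw i - (v * n * zw.1 i + u * m * zw.2 i))
        + m * (u * (zw.2 i - zw.1 i)) := by linear_combination zw.1 i * huv
    rw [e]
    exact dvd_add ((Dvd.intro _ (by push_cast; rfl)).trans (hmod zw i)) (Dvd.intro _ rfl)
  have h2 : ∀ zw i, (n : ℤ) ∣ φ zw i - zw.2 i := by
    intro zw i
    have e : φ zw i - zw.2 i = (φ zw i - (v * n * zw.1 i + u * m * zw.2 i))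
        + n * (v * (zw.1 i - zw.2 i)) := by linear_combination zw.2 i * huv
    rw [e]
    exact dvd_add ((Dvd.intro_left _ (by push_cast; rfl)).trans (hmod zw i)) (Dvd.intro _ rfl)
  have small : ∀ (k : ℕ) (a b c : ℤ), 0 ≤ a ∧ a < k → 0 ≤ b ∧ b < k → (k : ℤ) ∣ c - a →
      (k : ℤ) ∣ c - b → a = b := by
    intro k a b c ha hb hca hcb
    have h3 : (k : ℤ) ∣ a - b := by
      have := dvd_sub hcb hca
      rwa [sub_sub_sub_cancel_left] at this
    have := Int.eq_zero_of_abs_lt_dvd h3 (by rw [abs_lt]; constructor <;> omega)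
    omega
  refine Finset.card_le_card_of_injOn φ ?_ ?_
  · intro zw hzw
    rw [Finset.mem_coe, Finset.mem_product, Finset.mem_filter, Finset.mem_filter] at hzw
    rw [Finset.mem_coe, Finset.mem_filter, mem_intBox]
    refine ⟨fun i => ⟨Int.emod_nonneg _ hmn0.ne', Int.emod_lt_of_pos _ hmn0⟩, ?_⟩
    push_cast
    refine (Nat.isCoprime_iff_coprime.mpr hmn).mul_dvd ?_ ?_
    · exact (dvd_iff_dvd_of_dvd_sub (dvd_Qf_sub (h1 zw))).mpr hzw.1.2
    · exact (dvd_iff_dvd_of_dvd_sub (dvd_Qf_sub (h2 zw))).mpr hzw.2.2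
  · intro zw hzw zwt hzwt heq
    rw [Finset.mem_coe, Finset.mem_product, Finset.mem_filter, Finset.mem_filter, mem_intBox,
      mem_intBox] at hzw hzwt
    refine Prod.ext (funext fun i => ?_) (funext fun i => ?_)
    · exact small m _ _ _ (hzw.1.1 i) (hzwt.1.1 i) (h1 zw i) (heq ▸ h1 zwt i)
    · exact small n _ _ _ (hzw.2.1 i) (hzwt.2.1 i) (h2 zw i) (heq ▸ h2 zwt i)

/-- The density of zeros modulo `m` is bounded below uniformly in `m`. -/
theorem exists_le_zeroCount (hM : M.IsSymm) {ι κ : Fin 5 → Fin s} (h : IsOffMinor M ι κ) :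
    ∃ c : ℝ, 0 < c ∧ ∀ m : ℕ, 1 ≤ m → c * (m : ℝ) ^ s ≤ m * zeroCount M m := by
  obtain ⟨P, hP⟩ := exists_le_zeroCount_of_large_primes hM h
  have key : ∀ n ≤ P, ∃ c : ℝ, 0 < c ∧ ∀ m : ℕ, 1 ≤ m → (∀ p : ℕ, p.Prime → p ∣ m → n ≤ p) →
      c * (m : ℝ) ^ s ≤ m * zeroCount M m := by
    intro n hn
    induction hn using Nat.decreasingInduction with
    | self => exact ⟨1 / 2, by norm_num, hP⟩
    | of_succ n hn ih =>
      obtain ⟨c, hc, ih⟩ := ih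
      by_cases hp : n.Prime
      · have : Fact n.Prime := ⟨hp⟩
        obtain ⟨c', hc', hpow⟩ := exists_zeroCount_prime_pow hM h n
        refine ⟨c' * c, by positivity, fun m hm hmp => ?_⟩
        obtain ⟨k, m', hm', rfl⟩ := Nat.exists_eq_pow_mul_and_not_dvd (show m ≠ 0 by omega) n hp.ne_one
        have hm1 : 1 ≤ m' := by
          rcases Nat.eq_zero_or_pos m' with h0 | h0
          · subst h0; simp at hm'
          · exact h0
        have hk1 : 1 ≤ n ^ k := Nat.one_le_pow _ _ hp.pos
        have hcop : Nat.Coprime (n ^ k) m' :=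
          Nat.Coprime.pow_left _ ((Nat.Prime.coprime_iff_not_dvd hp).mpr hm')
        have h1 := hpow k
        have h2 := ih m' hm1 (fun p hpp hpm => by
          have := hmp p hpp (Dvd.dvd.mul_left hpm _)
          rcases this.lt_or_eq with h3 | h3
          · exact h3
          · exact absurd (h3 ▸ hpm) hm')
        have h3 : ((zeroCount M (n ^ k) * zeroCount M m' : ℕ) : ℝ) ≤ zeroCount M (n ^ k * m') := by
          exact_mod_cast zeroCount_mul_le hk1 hm1 hcop
        push_cast at h1 h3 ⊢
        calc c' * c * ((n : ℝ) ^ k * m') ^ s = (c' * ((n : ℝ) ^ k) ^ s) * (c * (m' : ℝ) ^ s) := by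
              rw [mul_pow]; ring
          _ ≤ ((n : ℝ) ^ k * zeroCount M (n ^ k)) * (m' * zeroCount M m') := by gcongr
          _ = ((n : ℝ) ^ k * m') * (zeroCount M (n ^ k) * zeroCount M m') := by ring
          _ ≤ _ := by gcongr
      · refine ⟨c, hc, fun m hm hmp => ih m hm fun p hpp hpm => ?_⟩
        have := hmp p hpp hpm
        rcases this.lt_or_eq with h3 | h3
        · exact h3
        · exact absurd (h3 ▸ hpp) hp
  obtain ⟨c, hc, hk⟩ := key 0 (Nat.zero_le _)
  exact ⟨c, hc, fun m hm => hk m hm fun p _ _ => Nat.zero_le _⟩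

end LocalDensity

section Tube

variable {s : ℕ} {M : Matrix (Fin s) (Fin s) ℤ}

/-- The sum of the absolute values of the entries of `M`. -/
def entrySum (M : Matrix (Fin s) (Fin s) ℤ) : ℤ := ∑ i, ∑ j, |M i j|

lemma entrySum_nonneg (M : Matrix (Fin s) (Fin s) ℤ) : 0 ≤ entrySum M :=
  Finset.sum_nonneg fun _ _ => Finset.sum_nonneg fun _ _ => abs_nonneg _

lemma abs_Qf_sub_le {x y : Fin s → ℤ} {R d : ℤ} (hx : ∀ i, |x i| ≤ R) (hy : ∀ i, |y i| ≤ R)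
    (hd : ∀ i, |x i - y i| ≤ d) : |Qf M x - Qf M y| ≤ 2 * entrySum M * R * d := by
  have e : 2 * entrySum M * R * d = ∑ i, ∑ j, 2 * |M i j| * R * d := by
    simp only [entrySum, Finset.mul_sum, Finset.sum_mul]
  rw [e]
  simp only [Qf, ← Finset.sum_sub_distrib]
  refine (Finset.abs_sum_le_sum_abs _ _).trans (Finset.sum_le_sum fun i _ =>
    (Finset.abs_sum_le_sum_abs _ _).trans (Finset.sum_le_sum fun j _ => ?_))
  have e : x i * M i j * x j - y i * M i j * y j
      = M i j * ((x i - y i) * x j + y i * (x j - y j)) := by ring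
  rw [e, abs_mul]
  have h1 : |(x i - y i) * x j + y i * (x j - y j)| ≤ d * R + R * d := by
    refine (abs_add_le _ _).trans ?_
    rw [abs_mul, abs_mul]
    have hR : 0 ≤ R := (abs_nonneg _).trans (hx i)
    have hd0 : 0 ≤ d := (abs_nonneg _).trans (hd i)
    exact add_le_add (mul_le_mul (hd i) (hx j) (abs_nonneg _) hd0)
      (mul_le_mul (hy i) (hd j) (abs_nonneg _) hR)
  calc |M i j| * |(x i - y i) * x j + y i * (x j - y j)| ≤ |M i j| * (d * R + R * d) :=
        mul_le_mul_of_nonneg_left h1 (abs_nonneg _)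
    _ = _ := by ring

lemma exists_nonneg_add_const (hM : M.IsSymm) (h : TransInv M) (x : Fin s → ℤ) :
    ∃ y : Fin s → ℤ, (∀ i, 0 ≤ y i) ∧ Qf M y = Qf M x := by
  refine ⟨x + fun _ => ∑ i, |x i|, fun i => ?_, Qf_add_const hM h x _⟩
  have := Finset.single_le_sum (f := fun i => |x i|) (s := Finset.univ)
    (fun i _ => abs_nonneg _) (Finset.mem_univ i)
  have := neg_abs_le (x i)
  simp only [Pi.add_apply]
  linarith

/-- A sequence of reals with small steps which descends from above `μ` to below `0` spends many
steps near `μ`. -/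
lemma exists_run_near {a : ℕ → ℝ} {n V : ℕ} {σ μ : ℝ} (hσ : 0 ≤ σ)
    (hstep : ∀ t < n, |a (t + 1) - a t| ≤ σ) (h0 : μ < a 0) (hn : a n ≤ 0)
    (hV : V * σ < μ) :
    ∃ t₀, ∀ u < V, t₀ + u ≤ n ∧ |a (t₀ + u) - μ| ≤ V * σ := by
  classical
  have hVσ : 0 ≤ (V : ℝ) * σ := by positivity
  have hex : ∃ t, a t ≤ μ := ⟨n, by linarith⟩
  have h1 := Nat.find_spec hex
  have hmin := fun t => Nat.find_min hex (m := t)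
  have hle : Nat.find hex ≤ n := Nat.find_min' hex (by linarith)
  set t₀ := Nat.find hex
  have ht0 : t₀ ≠ 0 := fun h => by rw [h] at h1; linarith
  obtain ⟨t₁, ht₁⟩ : ∃ t₁, t₀ = t₁ + 1 := ⟨t₀ - 1, by omega⟩
  have hb : |a t₀ - μ| ≤ σ := by
    have h2 := hmin t₁ (by omega)
    have h3 := hstep t₁ (by omega)
    rw [← ht₁] at h3
    rw [abs_le] at h3 ⊢
    constructor <;> linarith [not_le.mp h2]
  refine ⟨t₀, fun u hu => ?_⟩
  have key : ∀ u < V, t₀ + u ≤ n ∧ |a (t₀ + u) - μ| ≤ (u + 1 : ℝ) * σ := by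
    intro u
    induction u with
    | zero => intro _; exact ⟨hle, by simpa using hb⟩
    | succ u ih =>
      intro hu
      obtain ⟨h2, h3⟩ := ih (by omega)
      have hne : t₀ + u ≠ n := by
        intro h
        rw [h] at h3
        have h4 : ((u : ℝ) + 1) * σ ≤ V * σ :=
          mul_le_mul_of_nonneg_right (by exact_mod_cast (by omega : u + 1 ≤ V)) hσ
        rw [abs_le] at h3
        linarith
      have h4 := hstep (t₀ + u) (by omega)
      refine ⟨by omega, ?_⟩
      rw [← add_assoc]
      push_cast
      rw [abs_le] at h3 h4 ⊢
      constructor <;> linarith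
  obtain ⟨h2, h3⟩ := key u hu
  refine ⟨h2, h3.trans (mul_le_mul_of_nonneg_right ?_ hσ)⟩
  exact_mod_cast (by omega : u + 1 ≤ V)

/-- The real density of points at which an indefinite form is small and positive. -/
lemma exists_le_card_filter_small (hM : M.IsSymm) (htri : TransInv M) (hind : Indefinite M) :
    ∃ c : ℝ, 0 < c ∧ ∃ δ₀ : ℝ, 0 < δ₀ ∧ ∀ δ : ℝ, 0 < δ → δ ≤ δ₀ → ∀ B₀ : ℕ, ∃ B : ℕ, B₀ ≤ B ∧ 1 ≤ B ∧
      c * δ * (B : ℝ) ^ s ≤ (((intBox (Fin s) B).filter fun b =>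
        δ * B ^ 2 / 8 ≤ (Qf M b : ℝ) ∧ (Qf M b : ℝ) ≤ δ * B ^ 2 / 4).card : ℝ) := by
  obtain ⟨⟨x₁, hx₁⟩, ⟨x₂, hx₂⟩⟩ := hind
  obtain ⟨P, hP0, hP⟩ := exists_nonneg_add_const hM htri x₁
  obtain ⟨P', hP0', hP'⟩ := exists_nonneg_add_const hM htri x₂
  rw [← hP] at hx₁
  rw [← hP'] at hx₂
  obtain ⟨i₀, hi₀⟩ : ∃ i, P i ≠ P' i := by
    by_contra! hc
    rw [funext hc] at hx₁
    omega
  obtain ⟨W, hW⟩ : ∃ W : ℕ, entrySum M = W := ⟨_, (Int.toNat_of_nonneg (entrySum_nonneg M)).symm⟩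
  have hW1 : 1 ≤ W := by
    rcases Nat.eq_zero_or_pos W with h | h
    · exfalso
      have h1 := abs_Qf_sub_le (M := M) (x := P) (y := 0) (R := ∑ i, P i) (d := ∑ i, P i)
      have h2 : ∀ i, |P i| ≤ ∑ i, P i := fun i => by
        rw [abs_of_nonneg (hP0 i)]
        exact Finset.single_le_sum (f := P) (fun i _ => hP0 i) (Finset.mem_univ i)
      have h3 := h1 h2 (fun i => by simpa using (abs_nonneg _).trans (h2 i)) (fun i => by simpa using h2 i)
      rw [hW, h] at h3
      have h4 : Qf M 0 = 0 := by simp [Qf]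
      rw [h4] at h3
      simp at h3
      omega
    · exact h
  obtain ⟨L, hL⟩ : ∃ L : ℕ, ∑ i, P i + ∑ i, P' i + 1 = L :=
    ⟨_, (Int.toNat_of_nonneg (by
      have := Finset.sum_nonneg fun i (_ : i ∈ Finset.univ) => hP0 i
      have := Finset.sum_nonneg fun i (_ : i ∈ Finset.univ) => hP0' i
      omega)).symm⟩
  have hPL : ∀ i, P i + P' i + 1 ≤ L := by
    intro i
    have h1 := Finset.single_le_sum (f := P) (fun i _ => hP0 i) (Finset.mem_univ i)
    have h2 := Finset.single_le_sum (f := P') (fun i _ => hP0' i) (Finset.mem_univ i)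
    omega
  have hL1 : 1 ≤ L := by
    have := hPL i₀; have := hP0 i₀; have := hP0' i₀; omega
  set k := 4 * W * L with hk
  have hk1 : 1 ≤ k := by rw [hk]; nlinarith [Nat.mul_le_mul hW1 hL1]
  have hWR : (1 : ℝ) ≤ W := by exact_mod_cast hW1
  have hLR : (1 : ℝ) ≤ L := by exact_mod_cast hL1
  have hkR : (1 : ℝ) ≤ k := by exact_mod_cast hk1
  refine ⟨k / (64 * W * (L * k) ^ s), by positivity, 1 / L ^ 2, by positivity, fun δ hδ hδ0 B₀ => ?_⟩
  obtain ⟨G, hGB, hGδ⟩ : ∃ G : ℕ, B₀ + 1 ≤ G ∧ 32 * W / δ ≤ G :=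
    ⟨max (B₀ + 1) ⌈32 * W / δ⌉₊, le_max_left _ _,
      (Nat.le_ceil _).trans (by exact_mod_cast le_max_right _ _)⟩
  set n := k * G with hn
  have hG1 : 1 ≤ G := by omega
  have hGn : G ≤ n := Nat.le_mul_of_pos_left _ (by omega)
  have hn1 : 1 ≤ n := hG1.trans hGn
  have hBn : n ≤ L * n := Nat.le_mul_of_pos_left _ (by omega)
  refine ⟨L * n, by omega, by omega, ?_⟩
  set X : ℕ → (Fin s → ℤ) → Fin s → ℤ := fun t g i => n * P i + t * (P' i - P i) + g i with hX
  have hXbox : ∀ t ≤ n, ∀ g ∈ intBox (Fin s) G, ∀ i, 0 ≤ X t g i ∧ X t g i < ((L * n : ℕ) : ℤ) := by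
    intro t ht g hg i
    have hg := mem_intBox.mp hg i
    have e : X t g i = ((n - t : ℕ) : ℤ) * P i + t * P' i + g i := by
      rw [hX]; push_cast [ht]; ring
    rw [e]
    have h1 := hPL i; have h2 := hP0 i; have h3 := hP0' i
    have h4 : ((n - t : ℕ) : ℤ) * P i ≤ ((n - t : ℕ) : ℤ) * (L - 1) := by gcongr; omega
    have h5 : (t : ℤ) * P' i ≤ t * (L - 1) := by gcongr; omega
    have h6 : ((n - t : ℕ) : ℤ) * (L - 1) + t * (L - 1) + n = ((L * n : ℕ) : ℤ) := by
      push_cast [ht]; ring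
    refine ⟨by have := hg.1; positivity, by omega⟩
  have hXabs : ∀ t ≤ n, ∀ g ∈ intBox (Fin s) G, ∀ i, |X t g i| ≤ ((L * n : ℕ) : ℤ) := by
    intro t ht g hg i
    have := hXbox t ht g hg i
    rw [abs_of_nonneg this.1]; exact this.2.le
  have hg0 : (0 : Fin s → ℤ) ∈ intBox (Fin s) G := mem_intBox.mpr fun i => by
    simp only [Pi.zero_apply]; omega
  have hdev : ∀ t ≤ n, ∀ g ∈ intBox (Fin s) G, 2 * |Qf M (X t g) - Qf M (X t 0)| ≤ (n : ℤ) ^ 2 := by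
    intro t ht g hg
    have h1 := abs_Qf_sub_le (M := M) (hXabs t ht g hg) (hXabs t ht 0 hg0) (d := G) (fun i => by
      have hg := mem_intBox.mp hg i
      have e : X t g i - X t 0 i = g i := by rw [hX]; simp
      rw [e, abs_of_nonneg hg.1]; exact hg.2.le)
    rw [hW] at h1
    have e : 2 * (2 * (W : ℤ) * ((L * n : ℕ) : ℤ) * G) = (n : ℤ) ^ 2 := by
      rw [hn, hk]; push_cast; ring
    omega
  have hstart : ∀ g ∈ intBox (Fin s) G, (n : ℤ) ^ 2 ≤ 2 * Qf M (X 0 g) := by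
    intro g hg
    have h1 := hdev 0 (by omega) g hg
    have e : X 0 0 = (n : ℤ) • P := by funext i; simp [hX]
    rw [e, Qf_smul] at h1
    have h2 : (n : ℤ) ^ 2 ≤ (n : ℤ) ^ 2 * Qf M P := le_mul_of_one_le_right (by positivity) hx₁
    have h3 := neg_abs_le (Qf M (X 0 g) - (n : ℤ) ^ 2 * Qf M P)
    linarith
  have hend : ∀ g ∈ intBox (Fin s) G, Qf M (X n g) ≤ 0 := by
    intro g hg
    have h1 := hdev n le_rfl g hg
    have e : X n 0 = (n : ℤ) • P' := by funext i; simp [hX]; ring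
    rw [e, Qf_smul] at h1
    have h2 : (n : ℤ) ^ 2 * Qf M P' ≤ (n : ℤ) ^ 2 * (-1) :=
      mul_le_mul_of_nonneg_left (by omega) (by positivity)
    have h3 := le_abs_self (Qf M (X n g) - (n : ℤ) ^ 2 * Qf M P')
    have h4 : 0 ≤ (n : ℤ) ^ 2 := by positivity
    linarith
  set σ : ℝ := 2 * W * (L * n) * L with hσ
  have hstep : ∀ g ∈ intBox (Fin s) G, ∀ t < n,
      |(Qf M (X (t + 1) g) : ℝ) - Qf M (X t g)| ≤ σ := by
    intro g hg t ht
    have h1 := abs_Qf_sub_le (M := M) (hXabs (t + 1) ht g hg) (hXabs t ht.le g hg) (d := L) (fun i => by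
      have e : X (t + 1) g i - X t g i = P' i - P i := by rw [hX]; push_cast; ring
      have h1 := hPL i; have h2 := hP0 i; have h3 := hP0' i
      rw [e, abs_le]; constructor <;> omega)
    rw [hW] at h1
    have h2 : ((|Qf M (X (t + 1) g) - Qf M (X t g)| : ℤ) : ℝ) ≤
        ((2 * (W : ℤ) * ((L * n : ℕ) : ℤ) * L : ℤ) : ℝ) := by exact_mod_cast h1
    push_cast at h2
    exact h2
  set V := ⌊δ * n / (32 * W)⌋₊ with hV
  have hnR : (1 : ℝ) ≤ n := by exact_mod_cast hn1
  have hVle : (V : ℝ) ≤ δ * n / (32 * W) := Nat.floor_le (by positivity)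
  have hVge : δ * n / (64 * W) ≤ V := by
    have h1 : (1 : ℝ) ≤ δ * n / (32 * W) := by
      rw [le_div_iff₀ (by positivity), one_mul]
      rw [div_le_iff₀ hδ] at hGδ
      have : (G : ℝ) ≤ n := by exact_mod_cast hGn
      nlinarith
    have h2 := Nat.lt_floor_add_one (δ * n / (32 * W))
    have h3 : 1 ≤ V := (Nat.one_le_floor_iff _).mpr h1
    have h3 : (1 : ℝ) ≤ V := by exact_mod_cast h3
    have h4 : δ * n / (64 * W) = δ * n / (32 * W) / 2 := by rw [div_div]; ring
    rw [h4]; linarith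
  have hVσ : V * σ ≤ δ * (L * n) ^ 2 / 16 := by
    calc V * σ ≤ δ * n / (32 * W) * σ := by gcongr
      _ = _ := by rw [hσ]; field_simp; ring
  have hμ : 0 < δ * (L * n : ℝ) ^ 2 := by positivity
  have hδL : δ * (L * n : ℝ) ^ 2 ≤ (n : ℝ) ^ 2 := by
    rw [le_div_iff₀ (by positivity)] at hδ0
    calc δ * (L * n : ℝ) ^ 2 = (δ * L ^ 2) * (n : ℝ) ^ 2 := by ring
      _ ≤ 1 * (n : ℝ) ^ 2 := by gcongr
      _ = _ := one_mul _
  have hrun : ∀ g ∈ intBox (Fin s) G, ∃ t₀, ∀ u < V, t₀ + u ≤ n ∧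
      |(Qf M (X (t₀ + u) g) : ℝ) - 3 * (δ * (L * n) ^ 2) / 16| ≤ V * σ := by
    intro g hg
    refine exists_run_near (a := fun t => (Qf M (X t g) : ℝ)) (by positivity) (hstep g hg) ?_
      (by exact_mod_cast hend g hg) (by linarith)
    have h1 : ((n : ℝ)) ^ 2 ≤ 2 * Qf M (X 0 g) := by exact_mod_cast hstart g hg
    linarith
  choose! t₀ ht₀ using hrun
  set F := (intBox (Fin s) (L * n)).filter fun b =>
        δ * (L * n : ℕ) ^ 2 / 8 ≤ (Qf M b : ℝ) ∧ (Qf M b : ℝ) ≤ δ * (L * n : ℕ) ^ 2 / 4 with hF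
  have hcount : V * G ^ s ≤ G * F.card := by
    have e1 : V * G ^ s = (Finset.range V ×ˢ intBox (Fin s) G).card := by
      rw [Finset.card_product, card_intBox]; simp
    have e2 : G * F.card = (Finset.Ico (0 : ℤ) G ×ˢ F).card := by
      rw [Finset.card_product]; simp
    rw [e1, e2]
    refine Finset.card_le_card_of_injOn (fun ug => (ug.2 i₀, X (t₀ ug.2 + ug.1) ug.2)) ?_ ?_
    · rintro ⟨u, g⟩ hug
      rw [Finset.mem_coe, Finset.mem_product, Finset.mem_range] at hug
      obtain ⟨hu, hg⟩ := hug
      obtain ⟨h1, h2⟩ := ht₀ g hg u hu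
      rw [Finset.mem_coe, Finset.mem_product, hF, Finset.mem_filter, mem_intBox]
      refine ⟨Finset.mem_Ico.mpr (mem_intBox.mp hg i₀), hXbox _ h1 g hg, ?_⟩
      rw [abs_le] at h2
      push_cast
      constructor <;> linarith
    · rintro ⟨u, g⟩ hug ⟨u', g'⟩ hug' heq
      simp only [Prod.mk.injEq] at heq
      obtain ⟨h1, h2⟩ := heq
      have h3 := congrFun h2 i₀
      simp only [hX, h1, add_left_inj, add_right_inj] at h3
      have h4 := mul_right_cancel₀ (sub_ne_zero.mpr hi₀.symm) h3
      have h5 : g = g' := by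
        funext i
        have h6 := congrFun h2 i
        simp only [hX, h4] at h6
        exact add_left_cancel h6
      subst h5
      simp only [Prod.mk.injEq, and_true]
      have : t₀ g + u = t₀ g + u' := by exact_mod_cast h4
      omega
  have hcountR : (V : ℝ) * G ^ s ≤ G * F.card := by exact_mod_cast hcount
  have hGR : (0 : ℝ) < G := by exact_mod_cast hG1
  refine le_of_mul_le_mul_left (le_trans ?_ hcountR) hGR
  have hB : ((L * n : ℕ) : ℝ) = (L * k) * G := by rw [hn]; push_cast; ring
  have hnG : (n : ℝ) = k * G := by rw [hn]; push_cast; ring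
  calc (G : ℝ) * (k / (64 * W * (L * k) ^ s) * δ * ((L * n : ℕ) : ℝ) ^ s)
      = δ * n / (64 * W) * G ^ s := by
        rw [hB, hnG, mul_pow ((L : ℝ) * k)]; field_simp
    _ ≤ _ := by gcongr

end Tube

section Cells

/-- The number of terms of the progression `b, b + q, …, b + (L - 1) q` lying in `A`. -/
def apCount (A : Finset ℤ) (b : ℤ) (q L : ℕ) : ℕ :=
  ((Finset.range L).filter fun j : ℕ => b + (q : ℤ) * (j : ℤ) ∈ A).card

/-- The elements of `A` which are `r` modulo `q` and lie in the `b`-th interval of length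
`q * l`. -/
def cell (A : Finset ℤ) (q l : ℕ) (b r : ℤ) : Finset ℤ :=
  A.filter fun a => a / ((q * l : ℕ) : ℤ) = b ∧ a % q = r

lemma exists_eq_of_mem_cell {A : Finset ℤ} {q l : ℕ} (hq : 1 ≤ q) (hl : 1 ≤ l) {b r a : ℤ}
    (ha : a ∈ cell A q l b r) :
    ∃ j : ℕ, j < l ∧ a = ((q * l : ℕ) : ℤ) * b + r + q * j ∧ 0 ≤ r ∧ r < q := by
  obtain ⟨-, h1, h2⟩ := Finset.mem_filter.mp ha
  have hql : (0 : ℤ) < ((q * l : ℕ) : ℤ) := by positivity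
  have hq0 : (0 : ℤ) < q := by positivity
  set y := a % ((q * l : ℕ) : ℤ) with hy
  have hy0 : 0 ≤ y := Int.emod_nonneg _ hql.ne'
  have hy1 : y < ((q * l : ℕ) : ℤ) := Int.emod_lt_of_pos _ hql
  have hay : ((q * l : ℕ) : ℤ) * b + y = a := by rw [← h1]; exact Int.mul_ediv_add_emod _ _
  have hyr : y % q = r := by
    rw [← h2, hy]
    exact Int.emod_emod_of_dvd a (by push_cast; exact Dvd.intro _ rfl)
  have hyj : (q : ℤ) * (y / q) + r = y := by rw [← hyr]; exact Int.mul_ediv_add_emod _ _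
  have hj0 : 0 ≤ y / q := Int.ediv_nonneg hy0 hq0.le
  refine ⟨(y / q).toNat, ?_, ?_, ?_, ?_⟩
  · have : y / q < l := Int.ediv_lt_of_lt_mul hq0 (by rw [mul_comm]; exact_mod_cast hy1)
    omega
  · rw [Int.toNat_of_nonneg hj0]; linarith
  · rw [← hyr]; exact Int.emod_nonneg _ hq0.ne'
  · rw [← hyr]; exact Int.emod_lt_of_pos _ hq0

lemma card_cell_le_apCount (A : Finset ℤ) {q l : ℕ} (hq : 1 ≤ q) (hl : 1 ≤ l) (b r : ℤ) :
    (cell A q l b r).card ≤ apCount A (((q * l : ℕ) : ℤ) * b + r) q l := by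
  refine Finset.card_le_card_of_surjOn
    (fun j : ℕ => ((q * l : ℕ) : ℤ) * b + r + (q : ℤ) * (j : ℤ)) ?_
  intro a ha
  obtain ⟨j, hj, haj, -, -⟩ := exists_eq_of_mem_cell hq hl ha
  refine ⟨j, ?_, haj.symm⟩
  rw [Finset.mem_coe, Finset.mem_filter, Finset.mem_range, ← haj]
  exact ⟨hj, (Finset.mem_filter.mp ha).1⟩

/-- If no cell is overfull, then every cell is well filled. -/
lemma le_card_cell {A : Finset ℤ} {N q B : ℕ} {α : ℝ} (hα : 0 < α) (hq : 1 ≤ q) (hB : 1 ≤ B)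
    (hN : 4 * (q * B) ^ 2 ≤ N) (hA : A ⊆ Finset.Ico 0 (N : ℤ)) (hcard : α * N ≤ A.card)
    {l : ℕ} (hl : N ≤ q * B * l) (hlR : (l : ℝ) ≤ N / (q * B : ℕ) + 1)
    (hreg : ∀ b, (apCount A b q l : ℝ) ≤ (1 + 1 / (4 * (q * B : ℕ))) * α * l)
    {b₀ r₀ : ℤ} (hb₀ : b₀ ∈ Finset.Ico (0 : ℤ) B) (hr₀ : r₀ ∈ Finset.Ico (0 : ℤ) q) :
    α * l / 2 ≤ (cell A q l b₀ r₀).card := by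
  set m := q * B with hm
  have hm1 : 1 ≤ m := Nat.mul_pos hq hB
  have hN1 : 1 ≤ N := by nlinarith
  have hl1 : 1 ≤ l := by
    rcases Nat.eq_zero_or_pos l with h | h
    · subst h; omega
    · exact h
  have hql : (0 : ℤ) < ((q * l : ℕ) : ℤ) := by positivity
  have hq0 : (0 : ℤ) < q := by positivity
  set T := Finset.Ico (0 : ℤ) B ×ˢ Finset.Ico (0 : ℤ) q with hT
  have hsum : A.card = ∑ br ∈ T, (cell A q l br.1 br.2).card := by
    rw [Finset.card_eq_sum_card_fiberwise (f := fun a => (a / ((q * l : ℕ) : ℤ), a % q)) (t := T)]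
    · refine Finset.sum_congr rfl fun br _ => ?_
      unfold cell
      congr 1
      exact Finset.filter_congr fun a _ => by rw [Prod.ext_iff]
    · intro a ha
      have ha := Finset.mem_Ico.mp (hA ha)
      rw [Finset.mem_coe, hT, Finset.mem_product, Finset.mem_Ico, Finset.mem_Ico]
      refine ⟨⟨Int.ediv_nonneg ha.1 hql.le, Int.ediv_lt_of_lt_mul hql ?_⟩,
        Int.emod_nonneg _ hq0.ne', Int.emod_lt_of_pos _ hq0⟩
      refine ha.2.trans_le ?_
      have : N ≤ B * (q * l) := by rw [hm] at hl; linarith [mul_comm q B, mul_assoc B q l, (by ring : q * B * l = B * (q * l))]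
      exact_mod_cast this
  have hTmem : (b₀, r₀) ∈ T := Finset.mem_product.mpr ⟨hb₀, hr₀⟩
  rw [← Finset.add_sum_erase T _ hTmem] at hsum
  have hupper : ∑ br ∈ T.erase (b₀, r₀), ((cell A q l br.1 br.2).card : ℝ)
      ≤ ((m : ℝ) - 1) * ((1 + 1 / (4 * (m : ℕ))) * α * l) := by
    have hTc : ((T.erase (b₀, r₀)).card : ℝ) = m - 1 := by
      rw [Finset.card_erase_of_mem hTmem, hT, Finset.card_product]
      simp only [Int.card_Ico, sub_zero, Int.toNat_natCast]
      rw [mul_comm B q, ← hm, Nat.cast_sub hm1, Nat.cast_one]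
    rw [← hTc, ← nsmul_eq_mul]
    refine Finset.sum_le_card_nsmul _ _ _ fun br _ => ?_
    refine le_trans ?_ (hreg (((q * l : ℕ) : ℤ) * br.1 + br.2))
    exact_mod_cast card_cell_le_apCount A hq hl1 br.1 br.2
  have hsumR : (A.card : ℝ) = (cell A q l b₀ r₀).card +
      ∑ br ∈ T.erase (b₀, r₀), ((cell A q l br.1 br.2).card : ℝ) := by exact_mod_cast hsum
  have hmR : (1 : ℝ) ≤ m := by exact_mod_cast hm1
  have hNR : 4 * (m : ℝ) ^ 2 ≤ N := by exact_mod_cast hN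
  have hkey : (l : ℝ) * (((m : ℝ) - 1) * (1 + 1 / (4 * m)) + 1 / 2) ≤ N := by
    calc (l : ℝ) * (((m : ℝ) - 1) * (1 + 1 / (4 * m)) + 1 / 2)
        ≤ (N / m + 1) * (m - 1 / 4) := by
          have h1 : ((m : ℝ) - 1) * (1 + 1 / (4 * m)) = m - 3 / 4 - 1 / (4 * m) := by
            field_simp; ring
          have h2 : 0 ≤ 1 / (4 * (m : ℝ)) := by positivity
          have h3 : 0 ≤ ((m : ℝ) - 1) * (1 + 1 / (4 * m)) :=
            mul_nonneg (by linarith) (by positivity)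
          exact mul_le_mul hlR (by linarith) (by linarith) (by positivity)
      _ = N - N / (4 * m) + m - 1 / 4 := by field_simp; ring
      _ ≤ N := by
          have : (m : ℝ) ≤ N / (4 * m) := by
            rw [le_div_iff₀ (by positivity)]; nlinarith
          linarith
  have := mul_le_mul_of_nonneg_left hkey hα.le
  nlinarith

variable {s : ℕ} {M : Matrix (Fin s) (Fin s) ℤ}

/-- A set without large density increments contains the expected number of tuples at which the
form is small and divisible by `q`. -/
theorem exists_le_card_filter_dvd_small (hM : M.IsSymm) (htri : TransInv M) (hind : Indefinite M)
    {ι κ : Fin 5 → Fin s} (h : IsOffMinor M ι κ) :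
    ∃ c : ℝ, 0 < c ∧ ∃ δ₀ : ℝ, 0 < δ₀ ∧ ∀ δ : ℝ, 0 < δ → δ ≤ δ₀ → ∀ q : ℕ, 1 ≤ q →
      ∃ m : ℕ, 1 ≤ m ∧ ∀ N : ℕ, 4 * m ^ 2 ≤ N → ∀ (A : Finset ℤ) (α : ℝ), 0 < α →
        A ⊆ Finset.Ico 0 (N : ℤ) → α * N ≤ A.card →
        (∀ (b : ℤ) (L : ℕ), N ≤ m * L → L ≤ N →
          (apCount A b q L : ℝ) ≤ (1 + 1 / (4 * m)) * α * L) →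
        c * δ / q * α ^ s * N ^ s ≤ (((Fintype.piFinset fun _ : Fin s => A).filter fun x =>
          (q : ℤ) ∣ Qf M x ∧ 0 ≤ Qf M x ∧ (Qf M x : ℝ) < δ * N ^ 2).card : ℝ) := by
  obtain ⟨c₁, hc₁, hloc⟩ := exists_le_zeroCount hM h
  obtain ⟨c₂, hc₂, δ₀, hδ₀, htube⟩ := exists_le_card_filter_small hM htri hind
  refine ⟨c₁ * c₂ * (1 / 2) ^ s, by positivity, δ₀, hδ₀, fun δ hδ hδδ q hq => ?_⟩
  obtain ⟨B, hBB, hB, hgood⟩ := htube δ hδ hδδ ⌈16 * (entrySum M : ℝ) / δ⌉₊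
  have hW0 : (0 : ℝ) ≤ entrySum M := by exact_mod_cast entrySum_nonneg M
  have hBW : 16 * (entrySum M : ℝ) ≤ δ * B := by
    have := Nat.ceil_le.mp hBB
    rw [div_le_iff₀ hδ] at this; linarith
  refine ⟨q * B, Nat.mul_pos hq hB, fun N hN A α hα hA hcard hreg => ?_⟩
  have hm1 : 1 ≤ q * B := Nat.mul_pos hq hB
  have hN1 : 1 ≤ N := by nlinarith
  set m := q * B with hm
  set l := (N + m - 1) / m with hl
  have hl1 : N ≤ m * l := by
    have h1 := Nat.lt_mul_div_succ (N + m - 1) (show 0 < m from hm1)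
    rw [← hl, mul_add, mul_one] at h1; omega
  have hl2 : m * l ≤ N + m := by
    have := Nat.mul_div_le (N + m - 1) m
    rw [← hl] at this; omega
  have hmR : (1 : ℝ) ≤ m := by exact_mod_cast hm1
  have hl2R : (m : ℝ) * l ≤ N + m := by exact_mod_cast hl2
  have hl1R : (N : ℝ) ≤ m * l := by exact_mod_cast hl1
  have hlR : (l : ℝ) ≤ N / m + 1 := by
    rw [div_add_one (by positivity), le_div_iff₀ (by positivity)]; linarith
  have hlN : l ≤ N := by
    rcases Nat.lt_or_ge N 2 with h2 | h2
    · nlinarith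
    · by_contra! hc
      have h3 : m * (N + 1) ≤ N + m := (Nat.mul_le_mul_left m hc).trans hl2
      have h4 : m * N ≤ N := by linarith
      have h5 : m ≤ 1 := by
        by_contra! h6
        nlinarith
      have h6 : m = 1 := by omega
      rw [hl, h6] at hc
      simp at hc
  have hl0 : 1 ≤ l := by
    rcases Nat.eq_zero_or_pos l with h0 | h0
    · rw [h0] at hl1; omega
    · exact h0
  have hcell := fun b₀ r₀ hb₀ hr₀ => le_card_cell (b₀ := b₀) (r₀ := r₀) hα hq hB hN hA hcard hl1 hlR
    (fun b => hreg b l hl1 hlN) hb₀ hr₀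
  set good := (intBox (Fin s) B).filter fun b =>
        δ * B ^ 2 / 8 ≤ (Qf M b : ℝ) ∧ (Qf M b : ℝ) ≤ δ * B ^ 2 / 4 with hgooddef
  set zer := (intBox (Fin s) q).filter fun z => (q : ℤ) ∣ Qf M z with hzer
  set S := (Fintype.piFinset fun _ : Fin s => A).filter fun x =>
          (q : ℤ) ∣ Qf M x ∧ 0 ≤ Qf M x ∧ (Qf M x : ℝ) < δ * N ^ 2 with hS
  set D := ((q * l : ℕ) : ℤ) with hD
  have hDpos : 0 < D := by rw [hD]; positivity
  have hsub : ∀ br ∈ good ×ˢ zer, (Fintype.piFinset fun i => cell A q l (br.1 i) (br.2 i)) ⊆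
      S.filter fun x => ((fun i => x i / D), fun i => x i % (q : ℤ)) = br := by
    rintro ⟨b, r⟩ hbr x hx
    rw [Finset.mem_product, hgooddef, hzer, Finset.mem_filter, Finset.mem_filter] at hbr
    obtain ⟨⟨hb, hb1, hb2⟩, hr, hr1⟩ := hbr
    simp only at hb hb1 hb2 hr hr1 hx
    rw [Fintype.mem_piFinset] at hx
    choose j hj hxj hr0 hrq using fun i => exists_eq_of_mem_cell hq hl0 (hx i)
    have hdvd : (q : ℤ) ∣ Qf M x := by
      refine (dvd_iff_dvd_of_dvd_sub (dvd_Qf_sub (y := r) fun i => ?_)).mpr hr1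
      refine ⟨l * b i + j i, ?_⟩
      rw [hxj i]; push_cast; ring
    have hclose : |(Qf M x : ℝ) - D ^ 2 * Qf M b| ≤ D ^ 2 * (δ * B ^ 2 / 8) := by
      have h1 : |Qf M x - Qf M (D • b)| ≤ 2 * entrySum M * (D * B) * D := by
        have hxy : ∀ i, 0 ≤ x i - D * b i ∧ x i - D * b i < D := by
          intro i
          have h2 : (q : ℤ) * (j i + 1) ≤ D := by
            rw [hD]; push_cast
            exact mul_le_mul_of_nonneg_left (by exact_mod_cast hj i) (by positivity)
          have h3 := hr0 i; have h4 := hrq i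
          have h5 : (0 : ℤ) ≤ q * j i := by positivity
          rw [hxj i]
          constructor <;> linarith
        have hbB : ∀ i, 0 ≤ D * b i ∧ D * b i + D ≤ D * B := by
          intro i
          have h2 := mem_intBox.mp hb i
          refine ⟨mul_nonneg hDpos.le h2.1, ?_⟩
          have h3 : D * (b i + 1) ≤ D * B := mul_le_mul_of_nonneg_left (by omega) hDpos.le
          linarith
        refine abs_Qf_sub_le (fun i => ?_) (fun i => ?_) (fun i => ?_)
        · rw [abs_of_nonneg] <;> linarith [hxy i, hbB i]
        · rw [Pi.smul_apply, smul_eq_mul, abs_of_nonneg] <;> linarith [hxy i, hbB i]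
        · rw [Pi.smul_apply, smul_eq_mul, abs_of_nonneg] <;> linarith [hxy i, hbB i]
      rw [Qf_smul] at h1
      have h2 : ((|Qf M x - D ^ 2 * Qf M b| : ℤ) : ℝ) ≤ ((2 * entrySum M * (D * B) * D : ℤ) : ℝ) := by
        exact_mod_cast h1
      push_cast at h2
      refine h2.trans ?_
      have h3 : (D : ℝ) ^ 2 * B * (16 * (entrySum M : ℝ)) ≤ D ^ 2 * B * (δ * B) :=
        mul_le_mul_of_nonneg_left hBW (by positivity)
      linarith
    rw [abs_le] at hclose
    have hD2 : (0 : ℝ) < (D : ℝ) ^ 2 := by positivity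
    have h0 : (0 : ℝ) ≤ Qf M x := by
      have := mul_le_mul_of_nonneg_left hb1 hD2.le
      linarith [hclose.1]
    have hlt : (Qf M x : ℝ) < δ * N ^ 2 := by
      have h1 := mul_le_mul_of_nonneg_left hb2 hD2.le
      have hDB : (D : ℝ) * B ≤ 5 / 4 * N := by
        have e : (D : ℝ) * B = m * l := by rw [hD, hm]; push_cast; ring
        rw [e]
        have hNR : 4 * (m : ℝ) ^ 2 ≤ N := by exact_mod_cast hN
        nlinarith
      have hDB0 : (0 : ℝ) ≤ D * B := by positivity
      have hDB2 : ((D : ℝ) * B) ^ 2 ≤ (5 / 4 * N) ^ 2 := pow_le_pow_left₀ hDB0 hDB 2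
      have hNR : (0 : ℝ) < (N : ℝ) ^ 2 := by positivity
      have h2 : (Qf M x : ℝ) ≤ 3 / 8 * δ * (D * B) ^ 2 := by linarith [hclose.2]
      have h3 : 3 / 8 * δ * (D * B) ^ 2 ≤ 3 / 8 * δ * (5 / 4 * (N : ℝ)) ^ 2 := by gcongr
      have h4 : 0 < δ * (N : ℝ) ^ 2 := by positivity
      linarith
    rw [Finset.mem_filter, hS, Finset.mem_filter, Fintype.mem_piFinset]
    refine ⟨⟨fun i => (Finset.mem_filter.mp (hx i)).1, hdvd, by exact_mod_cast h0, hlt⟩, ?_⟩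
    exact Prod.ext (funext fun i => (Finset.mem_filter.mp (hx i)).2.1)
      (funext fun i => (Finset.mem_filter.mp (hx i)).2.2)
  have hcardS : ∑ br ∈ good ×ˢ zer, (α * l / 2) ^ s ≤ (S.card : ℝ) := by
    calc ∑ br ∈ good ×ˢ zer, (α * l / 2) ^ s
        ≤ ∑ br ∈ good ×ˢ zer, ((S.filter fun x =>
            ((fun i => x i / D), fun i => x i % (q : ℤ)) = br).card : ℝ) := by
          refine Finset.sum_le_sum fun br hbr => ?_
          refine le_trans ?_ (Nat.cast_le.mpr (Finset.card_le_card (hsub br hbr)))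
          rw [Fintype.card_piFinset]
          push_cast
          rw [← Fin.prod_const s (α * l / 2 : ℝ)]
          refine Finset.prod_le_prod (fun i _ => by positivity) fun i _ => ?_
          rw [Finset.mem_product, hgooddef, hzer, Finset.mem_filter, Finset.mem_filter] at hbr
          exact hcell _ _ (Finset.mem_Ico.mpr (mem_intBox.mp hbr.1.1 i))
            (Finset.mem_Ico.mpr (mem_intBox.mp hbr.2.1 i))
      _ ≤ S.card := by
          rw [← Nat.cast_sum, Finset.sum_card_fiberwise_eq_card_filter]
          exact_mod_cast Finset.card_filter_le _ _
  refine le_trans ?_ hcardS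
  rw [Finset.sum_const, Finset.card_product, nsmul_eq_mul]
  have hz : c₁ * (q : ℝ) ^ s / q ≤ zer.card := by
    rw [div_le_iff₀ (by positivity), mul_comm (zer.card : ℝ)]
    exact hloc q hq
  push_cast
  have hqR : (0 : ℝ) < q := by positivity
  calc c₁ * c₂ * (1 / 2) ^ s * δ / q * α ^ s * N ^ s
      ≤ c₁ * c₂ * (1 / 2) ^ s * δ / q * α ^ s * (m * l) ^ s := by gcongr
    _ = (c₂ * δ * B ^ s) * (c₁ * q ^ s / q) * (α * l / 2) ^ s := by
        have e : (α * l / 2) ^ s = α ^ s * l ^ s * (1 / 2) ^ s := by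
          rw [← mul_pow, ← mul_pow]; congr 1; ring
        rw [hm, e]; push_cast
        rw [mul_pow, mul_pow]
        ring
    _ ≤ _ := by gcongr

end Cells

section Pointwise

/-- `a / q` is an approximation to `θ` of the quality provided by Dirichlet's theorem. -/
structure RatApprox (K N : ℕ) (θ : ℝ) (q : ℕ) (a : ℤ) : Prop where
  one_le : 1 ≤ q
  isCoprime : IsCoprime a (q : ℤ)
  den_le : q ≤ 2 * (2 * K) * (2 * N)
  abs_sub_le : |θ - a / q| ≤ 1 / (2 * (2 * K : ℕ) * (2 * N : ℕ) * q)

/-- The size parameter of the point `θ` relative to the fraction `a / q`. -/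
def arcSize (N : ℕ) (θ : ℝ) (q : ℕ) (a : ℤ) : ℝ := q * (1 + N ^ 2 * |θ - a / q|)

lemma one_le_arcSize {N : ℕ} {θ : ℝ} {q : ℕ} {a : ℤ} (hq : 1 ≤ q) : 1 ≤ arcSize N θ q a := by
  have h1 : (1 : ℝ) ≤ q := by exact_mod_cast hq
  have h2 : 0 ≤ (N : ℝ) ^ 2 * |θ - a / q| := by positivity
  unfold arcSize
  nlinarith

variable {s r : ℕ} {M : Matrix (Fin s) (Fin s) ℤ}

lemma norm_expSum_le (hM : M.IsSymm) {ι κ : Fin r → Fin s} (h : IsOffMinor M ι κ) {K : ℕ}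
    (hK : 1 ≤ K) (hMK : ∀ i, ∑ j, |M i j| ≤ K) {N : ℕ} (hN : 1 ≤ N) {θ : ℝ} {q : ℕ} {a : ℤ}
    (happ : RatApprox K N θ q a) {Ω : (Fin s → ℤ) → ℂ}
    (hΩ : ∀ x u v, Ω (override ι κ x u v) = Ω x) {g : ℤ → ℂ} (hg : ∀ n, ‖g n‖ ≤ 1) :
    ‖∑ x ∈ intBox (Fin s) (2 * N), Ω x * (∏ i, g (x i)) * ee (θ * (Qf M x : ℤ))‖
      ≤ (9600 * K ^ 2) ^ r * (∑ x ∈ intBox (Fin s) (2 * N), ‖Ω x‖) *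
        (arcSize N θ q a ^ (-(r / 2 : ℝ)) + (N : ℝ) ^ (-(r / 2 : ℝ))) := by
  have hq := happ.one_le
  have key := norm_expSum_sq_le h.left_injective h.right_injective h.ne hM h.det_ne_zero K hK hMK
    (2 * N) (by omega) θ q a hq happ.isCoprime happ.den_le happ.abs_sub_le Ω hΩ g hg
  have hD1 := one_le_arcSize (N := N) (θ := θ) (a := a) hq
  have hNR : (1 : ℝ) ≤ N := by exact_mod_cast hN
  have hqR : (1 : ℝ) ≤ q := by exact_mod_cast hq
  have hKR : (1 : ℝ) ≤ K := by exact_mod_cast hK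
  set D := arcSize N θ q a with hD
  have hle : 1 / (q * (1 + ((2 * N : ℕ) : ℝ) ^ 2 * |θ - a / q|)) + 1 / ((2 * N : ℕ) : ℝ)
      ≤ 1 / D + 1 / N := by
    refine add_le_add ?_ ?_
    · refine one_div_le_one_div_of_le (by positivity) ?_
      rw [hD, arcSize]
      gcongr
      linarith
    · refine one_div_le_one_div_of_le (by positivity) ?_
      push_cast; linarith
  have hsq : ∀ y : ℝ, 0 < y → (1 / y) ^ r = (y ^ (-(r / 2 : ℝ))) ^ 2 := by
    intro y hy
    rw [← Real.rpow_natCast (y ^ _) 2, ← Real.rpow_mul hy.le, one_div, inv_pow,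
      ← Real.rpow_natCast, ← Real.rpow_neg hy.le]
    congr 1
    push_cast; ring
  set u := D ^ (-(r / 2 : ℝ)) with hu
  set v := (N : ℝ) ^ (-(r / 2 : ℝ)) with hv
  have hu0 : 0 ≤ u := by positivity
  have hv0 : 0 ≤ v := by positivity
  have hpow : (1 / D + 1 / N) ^ r ≤ 2 ^ r * (u + v) ^ 2 := by
    calc (1 / D + 1 / N) ^ r ≤ 2 ^ (r - 1) * ((1 / D) ^ r + (1 / N) ^ r) :=
          add_pow_le (by positivity) (by positivity) r
      _ ≤ 2 ^ r * ((1 / D) ^ r + (1 / N) ^ r) := by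
          gcongr
          · norm_num
          · omega
      _ = 2 ^ r * (u ^ 2 + v ^ 2) := by rw [hsq D (by positivity), hsq N (by positivity)]
      _ ≤ 2 ^ r * (u + v) ^ 2 := by gcongr; nlinarith [mul_nonneg hu0 hv0]
  refine (pow_le_pow_iff_left₀ (norm_nonneg _) (by positivity) two_ne_zero).mp ?_
  refine key.trans ?_
  set W := ∑ x ∈ intBox (Fin s) (2 * N), ‖Ω x‖
  calc (4800 * (K : ℝ) ^ 2) ^ r * W ^ 2 * _ ^ r
      ≤ (4800 * (K : ℝ) ^ 2) ^ r * W ^ 2 * (2 ^ r * (u + v) ^ 2) := by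
        refine mul_le_mul_of_nonneg_left ?_ (by positivity)
        exact (pow_le_pow_left₀ (by positivity) hle r).trans hpow
    _ = (9600 * (K : ℝ) ^ 2) ^ r * (W ^ 2 * (u + v) ^ 2) := by
        have : (9600 * (K : ℝ) ^ 2) ^ r = (4800 * (K : ℝ) ^ 2) ^ r * 2 ^ r := by
          rw [← mul_pow]; congr 1; ring
        rw [this]; ring
    _ ≤ ((9600 * (K : ℝ) ^ 2) ^ r) ^ 2 * (W ^ 2 * (u + v) ^ 2) := by
        gcongr
        exact le_self_pow₀ (one_le_pow₀ (by nlinarith)) two_ne_zero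
    _ = _ := by ring

/-- The exponential sum of the form over `A ^ s`. -/
def setSum (M : Matrix (Fin s) (Fin s) ℤ) (A : Finset ℤ) (θ : ℝ) : ℂ :=
  ∑ x ∈ Fintype.piFinset fun _ : Fin s => A, ee (θ * (Qf M x : ℤ))

lemma sum_intBox_indicator {A : Finset ℤ} {t : Fin s → ℤ} {B : ℕ}
    (ht : ∀ a ∈ A, ∀ i, 0 ≤ a + t i ∧ a + t i < B) (F : (Fin s → ℤ) → ℂ) :
    ∑ x ∈ intBox (Fin s) B, (∏ i, if x i - t i ∈ A then (1 : ℂ) else 0) * F x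
      = ∑ y ∈ Fintype.piFinset fun _ : Fin s => A, F (y + t) := by
  have h1 : ∀ x : Fin s → ℤ, (∏ i, if x i - t i ∈ A then (1 : ℂ) else 0) * F x
      = if ∀ i, x i - t i ∈ A then F x else 0 := by
    intro x
    rw [Finset.prod_ite_zero]
    by_cases hx : ∀ i, x i - t i ∈ A <;> simp [hx]
  simp only [h1]
  rw [← Finset.sum_filter]
  refine Finset.sum_nbij' (fun x => x - t) (fun y => y + t) ?_ ?_ ?_ ?_ ?_
  · intro x hx
    exact Fintype.mem_piFinset.mpr (Finset.mem_filter.mp hx).2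
  · intro y hy
    rw [Fintype.mem_piFinset] at hy
    rw [Finset.mem_filter, mem_intBox]
    exact ⟨fun i => ht _ (hy i) i, fun i => by simpa using hy i⟩
  · intro x _; simp
  · intro y _; simp
  · intro x _; simp

lemma norm_setSum_le (hM : M.IsSymm) {ι κ : Fin r → Fin s} (h : IsOffMinor M ι κ) {K : ℕ}
    (hK : 1 ≤ K) (hMK : ∀ i, ∑ j, |M i j| ≤ K) {N : ℕ} (hN : 1 ≤ N) {θ : ℝ} {q : ℕ} {a : ℤ}
    (happ : RatApprox K N θ q a) {A : Finset ℤ} (hA : A ⊆ Finset.Ico 0 (N : ℤ)) :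
    ‖setSum M A θ‖ ≤ (9600 * K ^ 2) ^ r * (2 * N) ^ s *
        (arcSize N θ q a ^ (-(r / 2 : ℝ)) + (N : ℝ) ^ (-(r / 2 : ℝ))) := by
  have h1 := norm_expSum_le hM h hK hMK hN happ (Ω := fun _ => 1) (fun _ _ _ => rfl)
    (g := fun n => if n ∈ A then 1 else 0) (fun n => by split_ifs <;> simp)
  have h2 := sum_intBox_indicator (s := s) (A := A) (t := 0) (B := 2 * N) (fun a ha i => by
    have := Finset.mem_Ico.mp (hA ha)
    rw [Pi.zero_apply]; push_cast; constructor <;> linarith)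
    (fun x => ee (θ * (Qf M x : ℤ)))
  simp only [Pi.zero_apply, sub_zero, add_zero] at h2
  simp only [one_mul, norm_one, Finset.sum_const, card_intBox, Fintype.card_fin,
    nsmul_eq_mul, mul_one, h2] at h1
  push_cast at h1
  exact h1

/-- Averaging over short shifts divisible by the denominator. -/
lemma average_shift_eq (A : Finset ℤ) {N q l : ℕ} (hA : A ⊆ Finset.Ico 0 (N : ℤ))
    (hql : q * l ≤ N) (F : (Fin s → ℤ) → ℂ) :
    ∑ x ∈ intBox (Fin s) (2 * N), (∏ i, (apCount A (x i - q * (l - 1)) q l : ℂ)) * F x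
      = ∑ j ∈ Fintype.piFinset fun _ : Fin s => Finset.range l,
          ∑ y ∈ Fintype.piFinset fun _ : Fin s => A,
            F (y + fun i => (q : ℤ) * (l - 1 - j i)) := by
  have h1 : ∀ x : Fin s → ℤ, (∏ i, (apCount A (x i - q * (l - 1)) q l : ℂ))
      = ∑ j ∈ Fintype.piFinset fun _ : Fin s => Finset.range l,
          ∏ i, if x i - (q : ℤ) * (l - 1 - j i) ∈ A then (1 : ℂ) else 0 := by
    intro x
    refine Eq.trans ?_ (Finset.prod_univ_sum (fun _ : Fin s => Finset.range l)
      fun i (j : ℕ) => if x i - (q : ℤ) * (l - 1 - j) ∈ A then (1 : ℂ) else 0)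
    refine Finset.prod_congr rfl fun i _ => ?_
    rw [apCount, Finset.card_filter]
    push_cast
    refine Finset.sum_congr rfl fun j _ => ?_
    rw [show x i - (q : ℤ) * (l - 1) + q * j = x i - q * (l - 1 - j) by ring]
  simp only [h1, Finset.sum_mul]
  rw [Finset.sum_comm]
  refine Finset.sum_congr rfl fun j hj => ?_
  refine sum_intBox_indicator (t := fun i => (q : ℤ) * (l - 1 - j i)) (fun a ha i => ?_) F
  have hj' : j i + 1 ≤ l := Finset.mem_range.mp (Fintype.mem_piFinset.mp hj i)
  have h2 : (0 : ℤ) ≤ l - 1 - j i := by omega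
  have h3 : (0 : ℤ) ≤ q * (l - 1 - j i) := by positivity
  have h4 : (q : ℤ) * (l - 1 - j i) ≤ q * l := mul_le_mul_of_nonneg_left (by omega) (by positivity)
  have h5 : (q : ℤ) * l ≤ N := by exact_mod_cast hql
  have h6 := Finset.mem_Ico.mp (hA ha)
  push_cast
  constructor <;> linarith

end Pointwise

section SetSum

variable {s : ℕ} {M : Matrix (Fin s) (Fin s) ℤ}

lemma norm_ee_sub_ee_le_of_dvd {θ : ℝ} {q : ℕ} (hq : 1 ≤ q) (a : ℤ) {m n : ℤ}
    (h : (q : ℤ) ∣ m - n) :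
    ‖ee (θ * m) - ee (θ * n)‖ ≤ 2 * Real.pi * (|θ - a / q| * |((m - n : ℤ) : ℝ)|) := by
  obtain ⟨k, hk⟩ := h
  have hqR : (q : ℝ) ≠ 0 := by positivity
  have hk' : (m : ℝ) = n + q * k := by
    have : m = n + q * k := by linarith
    exact_mod_cast this
  have e : θ * m = (θ * n + (θ - a / q) * (q * k)) + ((a * k : ℤ) : ℝ) := by
    rw [hk']; push_cast; field_simp; ring
  rw [e, ee_add_int]
  refine (norm_ee_sub_le _ _).trans (le_of_eq ?_)
  rw [add_sub_cancel_left, abs_mul, hk]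
  push_cast
  rfl

lemma apCount_zero_one {A : Finset ℤ} {N : ℕ} (hA : A ⊆ Finset.Ico 0 (N : ℤ)) :
    A.card ≤ apCount A 0 1 N := by
  refine Finset.card_le_card_of_surjOn (fun j : ℕ => (j : ℤ)) ?_
  intro a ha
  have h := Finset.mem_Ico.mp (hA ha)
  have e : ((a.toNat : ℕ) : ℤ) = a := Int.toNat_of_nonneg h.1
  refine ⟨a.toNat, ?_, e⟩
  rw [Finset.mem_coe, Finset.mem_filter, Finset.mem_range, e]
  refine ⟨by omega, ?_⟩
  rw [Nat.cast_one, one_mul, zero_add]; exact ha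

/-- The exponential sum over a set is controlled by the average over shifts. -/
lemma norm_setSum_le_average (A : Finset ℤ) {N q l : ℕ} (hq : 1 ≤ q) (hl : 1 ≤ l)
    (hA : A ⊆ Finset.Ico 0 (N : ℤ)) (hql : q * l ≤ N) (θ : ℝ) (a : ℤ) :
    ‖(l : ℂ) ^ s * setSum M A θ - ∑ x ∈ intBox (Fin s) (2 * N),
        (∏ i, (apCount A (x i - q * (l - 1)) q l : ℂ)) * ee (θ * (Qf M x : ℤ))‖
      ≤ (l : ℝ) ^ s * (A.card : ℝ) ^ s *
        (2 * Real.pi * (|θ - a / q| * (2 * entrySum M * (2 * N) * (q * l)))) := by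
  rw [average_shift_eq A hA hql fun x => ee (θ * (Qf M x : ℤ))]
  have h1 : (l : ℂ) ^ s * setSum M A θ = ∑ j ∈ Fintype.piFinset fun _ : Fin s => Finset.range l,
      ∑ y ∈ Fintype.piFinset fun _ : Fin s => A, ee (θ * (Qf M y : ℤ)) := by
    rw [Finset.sum_const, Fintype.card_piFinset, Fin.prod_const, Finset.card_range, nsmul_eq_mul,
      setSum]
    push_cast; rfl
  rw [h1, ← Finset.sum_sub_distrib]
  simp only [← Finset.sum_sub_distrib]
  have h2 : ∀ j ∈ Fintype.piFinset fun _ : Fin s => Finset.range l,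
      ‖∑ y ∈ Fintype.piFinset fun _ : Fin s => A, (ee (θ * (Qf M y : ℤ)) -
        ee (θ * (Qf M (y + fun i => (q : ℤ) * (l - 1 - j i)) : ℤ)))‖
      ≤ (A.card : ℝ) ^ s *
        (2 * Real.pi * (|θ - a / q| * (2 * entrySum M * (2 * N) * (q * l)))) := by
    intro j hj
    refine (norm_sum_le_of_le (n := fun _ => 2 * Real.pi * (|θ - a / q| *
      (2 * entrySum M * (2 * N) * (q * l)))) _ (fun y hy => ?_)).trans (le_of_eq ?_)
    · rw [norm_sub_rev]
      refine (norm_ee_sub_ee_le_of_dvd hq a (dvd_Qf_sub fun i => ?_)).trans ?_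
      · rw [Pi.add_apply, add_sub_cancel_left]; exact Dvd.intro _ rfl
      · have h3 : |Qf M (y + fun i => (q : ℤ) * (l - 1 - j i)) - Qf M y|
            ≤ 2 * entrySum M * (2 * N) * (q * l) := by
          have hql' : (q : ℤ) * l ≤ N := by exact_mod_cast hql
          have hy' : ∀ i, 0 ≤ y i ∧ y i < N := fun i =>
            Finset.mem_Ico.mp (hA (Fintype.mem_piFinset.mp hy i))
          have ht : ∀ i, 0 ≤ (q : ℤ) * (l - 1 - j i) ∧ (q : ℤ) * (l - 1 - j i) ≤ q * l := by
            intro i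
            have hj' : j i + 1 ≤ l := Finset.mem_range.mp (Fintype.mem_piFinset.mp hj i)
            have h2 : (0 : ℤ) ≤ l - 1 - j i := by omega
            exact ⟨by positivity, mul_le_mul_of_nonneg_left (by omega) (by positivity)⟩
          refine abs_Qf_sub_le (fun i => ?_) (fun i => ?_) (fun i => ?_)
          · rw [Pi.add_apply, abs_of_nonneg] <;> linarith [hy' i, ht i]
          · rw [abs_of_nonneg] <;> linarith [hy' i]
          · rw [Pi.add_apply, add_sub_cancel_left, abs_of_nonneg (ht i).1]; exact (ht i).2
        have h4 : |((Qf M (y + fun i => (q : ℤ) * (l - 1 - j i)) - Qf M y : ℤ) : ℝ)|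
            ≤ 2 * entrySum M * (2 * N) * (q * l) := by exact_mod_cast h3
        gcongr
    · rw [Finset.sum_const, Fintype.card_piFinset, Fin.prod_const, nsmul_eq_mul]
      push_cast; rfl
  refine (norm_sum_le_of_le _ h2).trans (le_of_eq ?_)
  rw [Finset.sum_const, Fintype.card_piFinset, Fin.prod_const, Finset.card_range, nsmul_eq_mul]
  push_cast; ring

lemma rpow_neg_le_rpow_neg {D x y : ℝ} (hD : 1 ≤ D) (h : y ≤ x) : D ^ (-x) ≤ D ^ (-y) :=
  Real.rpow_le_rpow_of_exponent_le hD (by linarith)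

/-- Pointwise bound for the exponential sum over a set without large density increments. -/
theorem norm_setSum_le_of_regular (hM : M.IsSymm) {ι κ : Fin 5 → Fin s} (h : IsOffMinor M ι κ)
    {K : ℕ} (hK : 1 ≤ K) (hMK : ∀ i, ∑ j, |M i j| ≤ K) :
    ∃ C : ℝ, 0 < C ∧ ∀ N Q : ℕ, 2 ≤ Q → Q ^ 4 ≤ N → ∀ (A : Finset ℤ) (α : ℝ), 0 < α → α ≤ 1 →
      A ⊆ Finset.Ico 0 (N : ℤ) → (Q : ℝ) ^ (-(1 / 4) : ℝ) ≤ α ^ s →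
      (∀ (b : ℤ) (q L : ℕ), 1 ≤ q → q ≤ Q → N ≤ Q ^ 4 * L → L ≤ N →
          (apCount A b q L : ℝ) ≤ 2 * α * L) →
      ∀ (θ : ℝ) (q : ℕ) (a : ℤ), RatApprox K N θ q a →
        ‖setSum M A θ‖ ≤ C * (α ^ s * N ^ s * arcSize N θ q a ^ (-(9 / 4) : ℝ)
          + N ^ s * (N : ℝ) ^ (-(5 / 2) : ℝ)) := by
  set E : ℝ := (9600 * (K : ℝ) ^ 2) ^ 5 with hE
  have hKR : (1 : ℝ) ≤ K := by exact_mod_cast hK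
  have hE0 : 0 < E := by positivity
  have hW0 : (0 : ℝ) ≤ entrySum M := by exact_mod_cast entrySum_nonneg M
  set W : ℝ := (entrySum M : ℝ)
  refine ⟨4 ^ s * E + 2 ^ s * (16 * Real.pi * W), by positivity, ?_⟩
  intro N Q hQ hQN A α hα hα1 hA hQα hreg θ q a happ
  have hq := happ.one_le
  have hN : 1 ≤ N := le_trans (Nat.one_le_pow _ _ (by omega)) hQN
  have hNR : (1 : ℝ) ≤ N := by exact_mod_cast hN
  have hQR : (2 : ℝ) ≤ Q := by exact_mod_cast hQ
  have hD1 := one_le_arcSize (N := N) (θ := θ) (a := a) hq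
  set D := arcSize N θ q a with hD
  have hD0 : 0 < D := by linarith
  have hπ := Real.pi_pos
  rcases lt_or_ge (Q : ℝ) D with hQD | hQD
  · refine (norm_setSum_le hM h hK hMK hN happ hA).trans ?_
    have e1 : D ^ (-((5 : ℕ) / 2 : ℝ)) ≤ α ^ s * D ^ (-(9 / 4) : ℝ) := by
      have : D ^ (-((5 : ℕ) / 2 : ℝ)) = D ^ (-(1 / 4) : ℝ) * D ^ (-(9 / 4) : ℝ) := by
        rw [← Real.rpow_add hD0]; norm_num
      rw [this]
      gcongr
      refine le_trans ?_ hQα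
      exact Real.rpow_le_rpow_of_nonpos (by linarith) hQD.le (by norm_num)
    have e2 : (N : ℝ) ^ (-((5 : ℕ) / 2 : ℝ)) = (N : ℝ) ^ (-(5 / 2) : ℝ) := by norm_num
    rw [e2]
    have e3 : (2 : ℝ) ^ s ≤ 4 ^ s := pow_le_pow_left₀ (by norm_num) (by norm_num) s
    have hpos : (0 : ℝ) ≤ 2 ^ s * (16 * Real.pi * W) := by positivity
    calc E * (2 * (N : ℝ)) ^ s * (D ^ (-((5 : ℕ) / 2 : ℝ)) + (N : ℝ) ^ (-(5 / 2) : ℝ))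
        ≤ E * (2 * (N : ℝ)) ^ s * (α ^ s * D ^ (-(9 / 4) : ℝ) + (N : ℝ) ^ (-(5 / 2) : ℝ)) := by
          gcongr
      _ = 2 ^ s * E * (α ^ s * N ^ s * D ^ (-(9 / 4) : ℝ) + N ^ s * (N : ℝ) ^ (-(5 / 2) : ℝ)) := by
          rw [mul_pow]; ring
      _ ≤ (4 ^ s * E + 2 ^ s * (16 * Real.pi * W)) * (α ^ s * N ^ s * D ^ (-(9 / 4) : ℝ)
            + N ^ s * (N : ℝ) ^ (-(5 / 2) : ℝ)) := by
          refine mul_le_mul_of_nonneg_right ?_ (by positivity)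
          have := mul_le_mul_of_nonneg_right e3 hE0.le
          linarith
  · have hQ4 : 0 < Q ^ 4 := by positivity
    set l := (N + Q ^ 4 - 1) / Q ^ 4 with hl
    have hl1 : N ≤ Q ^ 4 * l := by
      have h1 := Nat.lt_mul_div_succ (N + Q ^ 4 - 1) hQ4
      rw [← hl, mul_add, mul_one] at h1; omega
    have hl2 : Q ^ 4 * l ≤ 2 * N := by
      have := Nat.mul_div_le (N + Q ^ 4 - 1) (Q ^ 4)
      rw [← hl] at this; omega
    have hl0 : 1 ≤ l := by
      rcases Nat.eq_zero_or_pos l with h0 | h0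
      · rw [h0] at hl1; omega
      · exact h0
    have hQ8 : 8 ≤ Q ^ 3 := le_trans (by norm_num) (Nat.pow_le_pow_left hQ 3)
    have hQl : Q * l ≤ N := by
      have : Q ^ 4 * l = Q ^ 3 * (Q * l) := by ring
      nlinarith
    have hqQR : (q : ℝ) ≤ Q := by
      refine le_trans ?_ hQD
      rw [hD, arcSize]
      have : (0 : ℝ) ≤ q * (N ^ 2 * |θ - a / q|) := by positivity
      linarith
    have hqQ : q ≤ Q := by exact_mod_cast hqQR
    have hlN : l ≤ N := le_trans (Nat.le_mul_of_pos_left _ (by omega)) hQl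
    have hql : q * l ≤ N := (Nat.mul_le_mul_right _ hqQ).trans hQl
    have hlR : (0 : ℝ) < l := by positivity
    have hcard : (A.card : ℝ) ≤ 2 * α * N := by
      refine le_trans ?_ (hreg 0 1 N le_rfl (by omega) (Nat.le_mul_of_pos_left _ hQ4) le_rfl)
      exact_mod_cast apCount_zero_one hA
    have havg := norm_setSum_le_average (M := M) A hq hl0 hA hql θ a
    set T := ∑ x ∈ intBox (Fin s) (2 * N),
        (∏ i, (apCount A (x i - q * (l - 1)) q l : ℂ)) * ee (θ * (Qf M x : ℤ)) with hT
    have hTb : ‖T‖ ≤ (2 * α * l) ^ s * (E * (2 * N) ^ s *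
        (D ^ (-(9 / 4) : ℝ) + (N : ℝ) ^ (-(5 / 2) : ℝ))) := by
      have h1 := norm_expSum_le hM h hK hMK hN happ (Ω := fun _ => 1) (fun _ _ _ => rfl)
        (g := fun n => ((apCount A (n - q * (l - 1)) q l / (2 * α * l) : ℝ) : ℂ)) (fun n => by
          rw [Complex.norm_real, Real.norm_of_nonneg (by positivity),
            div_le_one (by positivity)]
          exact hreg _ q l hq hqQ hl1 hlN)
      simp only [one_mul, norm_one, Finset.sum_const, card_intBox, Fintype.card_fin,
        nsmul_eq_mul, mul_one] at h1
      have h2 : T = ((2 * α * l : ℝ) : ℂ) ^ s * ∑ x ∈ intBox (Fin s) (2 * N),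
          (∏ i, ((apCount A (x i - q * (l - 1)) q l / (2 * α * l) : ℝ) : ℂ)) *
            ee (θ * (Qf M x : ℤ)) := by
        rw [hT, Finset.mul_sum]
        refine Finset.sum_congr rfl fun x _ => ?_
        rw [← mul_assoc, ← Fin.prod_const s, ← Finset.prod_mul_distrib]
        congr 1
        refine Finset.prod_congr rfl fun i _ => ?_
        rw [← Complex.ofReal_mul, mul_div_cancel₀ _ (by positivity)]
        norm_cast
      rw [h2, norm_mul, norm_pow, Complex.norm_real, Real.norm_of_nonneg (by positivity)]
      refine mul_le_mul_of_nonneg_left (h1.trans ?_) (by positivity)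
      push_cast
      exact mul_le_mul_of_nonneg_left (add_le_add (rpow_neg_le_rpow_neg hD1 (by norm_num))
        (le_of_eq (by norm_num))) (by positivity)
    have hosc : 2 * Real.pi * (|θ - a / q| * (2 * W * (2 * N) * (q * l)))
        ≤ 16 * Real.pi * W * D ^ (-(9 / 4) : ℝ) := by
      have h1 : q * (N : ℝ) ^ 2 * |θ - a / q| ≤ D := by
        rw [hD, arcSize]
        have : (0 : ℝ) ≤ q := by positivity
        linarith
      have h2 : (Q : ℝ) ^ 4 * l ≤ 2 * N := by exact_mod_cast hl2
      have h3 : q * N * |θ - a / q| * l ≤ 2 * D ^ (-(9 / 4) : ℝ) := by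
        have hD3 : D ^ (4 : ℕ) * D ^ (-(9 / 4) : ℝ) = D * D ^ (3 / 4 : ℝ) := by
          rw [← Real.rpow_natCast, ← Real.rpow_add hD0]
          nth_rewrite 2 [← Real.rpow_one D]
          rw [← Real.rpow_add hD0]; norm_num
        have hD4 : 1 ≤ D ^ (3 / 4 : ℝ) := Real.one_le_rpow hD1 (by norm_num)
        have h4 : D ^ 4 * l ≤ 2 * N := le_trans (by gcongr) h2
        have h5 : D ^ 4 * (q * N * |θ - a / q| * l) ≤ 2 * D := by
          calc D ^ 4 * (q * N * |θ - a / q| * l) = q * N * |θ - a / q| * (D ^ 4 * l) := by ring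
            _ ≤ q * N * |θ - a / q| * (2 * N) := by gcongr
            _ = 2 * (q * (N : ℝ) ^ 2 * |θ - a / q|) := by ring
            _ ≤ 2 * D := by gcongr
        refine le_of_mul_le_mul_left (h5.trans ?_) (show 0 < D ^ 4 by positivity)
        rw [mul_left_comm, hD3]
        nlinarith
      calc 2 * Real.pi * (|θ - a / q| * (2 * W * (2 * N) * (q * l)))
          = 8 * Real.pi * W * (q * N * |θ - a / q| * l) := by ring
        _ ≤ 8 * Real.pi * W * (2 * D ^ (-(9 / 4) : ℝ)) := by gcongr
        _ = _ := by ring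
    have hfin : (l : ℝ) ^ s * ‖setSum M A θ‖ ≤ (l : ℝ) ^ s * ((2 * α * N) ^ s *
        (16 * Real.pi * W * D ^ (-(9 / 4) : ℝ)) + (2 * α) ^ s * (E * (2 * N) ^ s *
        (D ^ (-(9 / 4) : ℝ) + (N : ℝ) ^ (-(5 / 2) : ℝ)))) := by
      have h1 : (l : ℝ) ^ s * ‖setSum M A θ‖ = ‖(l : ℂ) ^ s * setSum M A θ‖ := by
        rw [norm_mul, norm_pow, Complex.norm_natCast]
      rw [h1]
      refine (norm_le_norm_sub_add _ T).trans ?_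
      rw [mul_add]
      refine add_le_add (havg.trans ?_) (hTb.trans (le_of_eq ?_))
      · rw [mul_assoc]
        gcongr
      · rw [mul_pow (2 * α)]; ring
    refine (le_of_mul_le_mul_left hfin (by positivity)).trans ?_
    have e2 : α ^ s ≤ 1 := pow_le_one₀ hα.le hα1
    have e4 : (4 : ℝ) ^ s = 2 ^ s * 2 ^ s := by rw [← mul_pow]; norm_num
    set u := D ^ (-(9 / 4) : ℝ)
    set v := (N : ℝ) ^ (-(5 / 2) : ℝ)
    have hu : 0 ≤ u := by positivity
    have hv : 0 ≤ v := by positivity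
    calc (2 * α * N) ^ s * (16 * Real.pi * W * u) + (2 * α) ^ s * (E * (2 * N) ^ s * (u + v))
        = 2 ^ s * (16 * Real.pi * W) * (α ^ s * N ^ s * u) + 4 ^ s * E * (α ^ s * N ^ s * u)
          + 4 ^ s * E * (N ^ s * v) * α ^ s := by
          rw [e4]; simp only [mul_pow]; ring
      _ ≤ 2 ^ s * (16 * Real.pi * W) * (α ^ s * N ^ s * u) + 4 ^ s * E * (α ^ s * N ^ s * u)
          + 4 ^ s * E * (N ^ s * v) * 1 := by gcongr
      _ ≤ _ := by
          have : 0 ≤ 2 ^ s * (16 * Real.pi * W) * (N ^ s * v) := by positivity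
          linarith

end SetSum

section Integral

open MeasureTheory

lemma exists_ratApprox {K N : ℕ} (hK : 1 ≤ K) (hN : 1 ≤ N) {θ : ℝ} (h0 : 0 ≤ θ) (h1 : θ ≤ 1) :
    ∃ q a : ℕ, a ≤ q ∧ RatApprox K N θ q a := by
  have hn : 0 < 2 * (2 * K) * (2 * N) := by positivity
  obtain ⟨x, hx, hxd⟩ := Real.exists_rat_abs_sub_le_and_den_le θ hn
  have hd : (0 : ℝ) < x.den := by exact_mod_cast x.pos
  have hxe : (x : ℝ) = x.num / x.den := by exact_mod_cast (Rat.num_div_den x).symm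
  rw [hxe] at hx
  have hnR : (0 : ℝ) < ((2 * (2 * K) * (2 * N) : ℕ) : ℝ) := by exact_mod_cast hn
  have hlt : |θ - x.num / x.den| * x.den < 1 := by
    refine (mul_le_mul_of_nonneg_right hx hd.le).trans_lt ?_
    rw [one_div, mul_inv, mul_assoc, inv_mul_cancel₀ hd.ne', mul_one]
    exact inv_lt_one_of_one_lt₀ (by linarith)
  rw [← abs_of_pos hd, ← abs_mul, abs_of_pos hd, sub_mul, div_mul_cancel₀ _ hd.ne', abs_lt] at hlt
  have hnum0 : 0 ≤ x.num := by
    have : (-1 : ℝ) < x.num := by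
      have := mul_nonneg h0 hd.le
      linarith [hlt.2]
    have : (-1 : ℤ) < x.num := by exact_mod_cast this
    omega
  have hnum1 : x.num ≤ x.den := by
    have : (x.num : ℝ) < x.den + 1 := by
      have := mul_le_mul_of_nonneg_right h1 hd.le
      linarith [hlt.1]
    have : x.num < x.den + 1 := by exact_mod_cast this
    omega
  have hcast : ((x.num.toNat : ℕ) : ℤ) = x.num := Int.toNat_of_nonneg hnum0
  refine ⟨x.den, x.num.toNat, by omega, x.pos, ?_, hxd, ?_⟩
  · rw [hcast]; exact Rat.isCoprime_num_den x
  · rw [hcast]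
    refine hx.trans ?_
    refine one_div_le_one_div_of_le (by positivity) ?_
    push_cast
    gcongr
    linarith

lemma integral_sum_ee {β : Type*} (S : Finset β) (φ : β → ℤ) :
    ∫ θ in (0 : ℝ)..1, ∑ x ∈ S, ee (θ * φ x) = ((S.filter fun x => φ x = 0).card : ℂ) := by
  rw [intervalIntegral.integral_finsetSum]
  · simp only [integral_ee_int]
    rw [Finset.sum_ite, Finset.sum_const_zero, add_zero, Finset.sum_const, nsmul_eq_mul, mul_one]
  · intro x _
    refine Continuous.intervalIntegrable ?_ _ _
    unfold ee
    fun_prop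

lemma continuous_bump (N : ℕ) (c : ℝ) :
    Continuous fun θ : ℝ => (1 + ((N : ℝ) ^ 2 * (θ - c)) ^ 2)⁻¹ := by
  refine Continuous.inv₀ (by fun_prop) fun θ => ?_
  positivity

lemma integral_bump_le {N : ℕ} (hN : 1 ≤ N) (c : ℝ) :
    ∫ θ in (0 : ℝ)..1, (1 + ((N : ℝ) ^ 2 * (θ - c)) ^ 2)⁻¹ ≤ Real.pi / N ^ 2 := by
  have hN2 : (0 : ℝ) < (N : ℝ) ^ 2 := by positivity
  have hint : Integrable fun θ : ℝ => (1 + ((N : ℝ) ^ 2 * (θ - c)) ^ 2)⁻¹ :=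
    (integrable_inv_one_add_sq.comp_mul_left' hN2.ne').comp_sub_right c
  rw [intervalIntegral.integral_of_le zero_le_one]
  refine (setIntegral_le_integral hint (Filter.Eventually.of_forall fun θ => by
    rw [Pi.zero_apply]; positivity)).trans (le_of_eq ?_)
  rw [integral_sub_right_eq_self (fun θ : ℝ => (1 + ((N : ℝ) ^ 2 * θ) ^ 2)⁻¹) c,
    Measure.integral_comp_mul_left (fun x : ℝ => (1 + x ^ 2)⁻¹) ((N : ℝ) ^ 2),
    integral_univ_inv_one_add_sq, abs_of_pos (by positivity), smul_eq_mul]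
  field_simp

lemma exists_sum_rpow_le : ∃ Z : ℝ, 0 < Z ∧ ∀ P : ℕ,
    ∑ q ∈ Finset.Icc 1 P, ((q + 1 : ℕ) : ℝ) * (q : ℝ) ^ (-(17 / 8) : ℝ) ≤ Z := by
  have hs : Summable fun n : ℕ => (n : ℝ) ^ (-(9 / 8) : ℝ) :=
    Real.summable_nat_rpow.mpr (by norm_num)
  refine ⟨2 * ∑' n : ℕ, (n : ℝ) ^ (-(9 / 8) : ℝ) + 1, ?_, fun P => ?_⟩
  · have : 0 ≤ ∑' n : ℕ, (n : ℝ) ^ (-(9 / 8) : ℝ) := tsum_nonneg fun n => by positivity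
    positivity
  · calc ∑ q ∈ Finset.Icc 1 P, ((q + 1 : ℕ) : ℝ) * (q : ℝ) ^ (-(17 / 8) : ℝ)
        ≤ ∑ q ∈ Finset.Icc 1 P, 2 * (q : ℝ) ^ (-(9 / 8) : ℝ) := by
          refine Finset.sum_le_sum fun q hq => ?_
          have hq1 : (1 : ℝ) ≤ q := by exact_mod_cast (Finset.mem_Icc.mp hq).1
          have e : (q : ℝ) ^ (-(9 / 8) : ℝ) = q * (q : ℝ) ^ (-(17 / 8) : ℝ) := by
            nth_rewrite 2 [← Real.rpow_one (q : ℝ)]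
            rw [← Real.rpow_add (by positivity)]; norm_num
          rw [e, ← mul_assoc]
          gcongr
          push_cast; linarith
      _ = 2 * ∑ q ∈ Finset.Icc 1 P, (q : ℝ) ^ (-(9 / 8) : ℝ) := by rw [Finset.mul_sum]
      _ ≤ 2 * ∑' n : ℕ, (n : ℝ) ^ (-(9 / 8) : ℝ) := by
          gcongr
          exact hs.sum_le_tsum _ fun n _ => by positivity
      _ ≤ _ := by linarith

/-- A function on the circle which is concentrated near rationals with small denominators has a
small integral. -/
lemma exists_norm_integral_le : ∃ Z : ℝ, 0 < Z ∧ ∀ (N : ℕ) (F : ℝ → ℂ) (B₁ B₂ : ℝ) (P : ℕ),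
    1 ≤ N → 0 ≤ B₁ → 0 ≤ B₂ →
    (∀ θ : ℝ, 0 ≤ θ → θ ≤ 1 → ∃ q a : ℕ, 1 ≤ q ∧ q ≤ P ∧ a ≤ q ∧
      ‖F θ‖ ≤ B₁ * ((q : ℝ) ^ (-(17 / 8) : ℝ) * (1 + ((N : ℝ) ^ 2 * (θ - a / q)) ^ 2)⁻¹) + B₂) →
    ‖∫ θ in (0 : ℝ)..1, F θ‖ ≤ Z * B₁ / N ^ 2 + B₂ := by
  obtain ⟨Z, hZ, hsum⟩ := exists_sum_rpow_le
  refine ⟨Real.pi * Z, mul_pos Real.pi_pos hZ, fun N F B₁ B₂ P hN hB₁ hB₂ hF => ?_⟩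
  set T := (Finset.Icc 1 P).sigma fun q => Finset.range (q + 1) with hT
  set w : (_ : ℕ) × ℕ → ℝ → ℝ := fun t θ =>
    (t.1 : ℝ) ^ (-(17 / 8) : ℝ) * (1 + ((N : ℝ) ^ 2 * (θ - t.2 / t.1)) ^ 2)⁻¹ with hw
  have hw0 : ∀ t θ, 0 ≤ w t θ := fun t θ => by rw [hw]; positivity
  have hwc : ∀ t, Continuous (w t) := fun t => continuous_const.mul (continuous_bump N _)
  have hcont' : Continuous fun θ => B₁ * ∑ t ∈ T, w t θ :=
    continuous_const.mul (continuous_finsetSum _ fun t _ => hwc t)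
  have hcont : Continuous fun θ => B₁ * ∑ t ∈ T, w t θ + B₂ := hcont'.add continuous_const
  have hle : ‖∫ θ in (0 : ℝ)..1, F θ‖ ≤ ∫ θ in (0 : ℝ)..1, (B₁ * ∑ t ∈ T, w t θ + B₂) := by
    refine intervalIntegral.norm_integral_le_of_norm_le zero_le_one
      (Filter.Eventually.of_forall fun θ hθ => ?_) (hcont.intervalIntegrable _ _)
    obtain ⟨q, a, hq, hqP, haq, hb⟩ := hF θ hθ.1.le hθ.2
    refine hb.trans ?_
    gcongr
    exact Finset.single_le_sum (f := fun t => w t θ) (fun t _ => hw0 t θ)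
      (show (⟨q, a⟩ : (_ : ℕ) × ℕ) ∈ T from Finset.mem_sigma.mpr
        ⟨Finset.mem_Icc.mpr ⟨hq, hqP⟩, Finset.mem_range.mpr (Nat.lt_succ_of_le haq)⟩)
  refine hle.trans ?_
  rw [intervalIntegral.integral_add (hcont'.intervalIntegrable _ _)
      (continuous_const.intervalIntegrable _ _), intervalIntegral.integral_const_mul,
    intervalIntegral.integral_finsetSum fun t _ => (hwc t).intervalIntegrable _ _,
    intervalIntegral.integral_const, sub_zero, one_smul]
  gcongr
  have h1 : ∑ t ∈ T, ∫ θ in (0 : ℝ)..1, w t θ ≤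
      ∑ t ∈ T, (t.1 : ℝ) ^ (-(17 / 8) : ℝ) * (Real.pi / N ^ 2) := by
    refine Finset.sum_le_sum fun t _ => ?_
    rw [hw, intervalIntegral.integral_const_mul]
    exact mul_le_mul_of_nonneg_left (integral_bump_le hN _) (by positivity)
  have h2 : ∑ t ∈ T, (t.1 : ℝ) ^ (-(17 / 8) : ℝ) * (Real.pi / N ^ 2) ≤ Z * (Real.pi / N ^ 2) := by
    rw [← Finset.sum_mul, hT, Finset.sum_sigma]
    refine mul_le_mul_of_nonneg_right ?_ (by positivity)
    refine le_trans (le_of_eq ?_) (hsum P)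
    refine Finset.sum_congr rfl fun q _ => ?_
    dsimp only
    rw [Finset.sum_const, Finset.card_range, nsmul_eq_mul]
  calc B₁ * ∑ t ∈ T, ∫ θ in (0 : ℝ)..1, w t θ ≤ B₁ * (Z * (Real.pi / N ^ 2)) :=
        mul_le_mul_of_nonneg_left (h1.trans h2) hB₁
    _ = _ := by ring

end Integral

section Degenerate

lemma arcSize_rpow_mul_le {N : ℕ} {θ : ℝ} {q : ℕ} {a : ℤ} (hq : 1 ≤ q) :
    arcSize N θ q a ^ (-(9 / 4) : ℝ) *
        ((q : ℝ) ^ (1 / 8 : ℝ) * (1 + (N : ℝ) ^ 2 * |θ - a / q|) ^ (1 / 4 : ℝ))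
      ≤ (q : ℝ) ^ (-(17 / 8) : ℝ) * (1 + ((N : ℝ) ^ 2 * (θ - a / q)) ^ 2)⁻¹ := by
  have hqR : (0 : ℝ) < q := by positivity
  set w := (N : ℝ) ^ 2 * |θ - a / q| with hw
  have hw0 : 0 ≤ w := by positivity
  have hw2 : ((N : ℝ) ^ 2 * (θ - a / q)) ^ 2 = w ^ 2 := by
    rw [hw, mul_pow, mul_pow, sq_abs]
  have e : arcSize N θ q a = q * (1 + w) := rfl
  have h1 : (0 : ℝ) < 1 + w := by linarith
  rw [hw2, e, Real.mul_rpow hqR.le h1.le]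
  calc (q : ℝ) ^ (-(9 / 4) : ℝ) * (1 + w) ^ (-(9 / 4) : ℝ) *
        ((q : ℝ) ^ (1 / 8 : ℝ) * (1 + w) ^ (1 / 4 : ℝ))
      = ((q : ℝ) ^ (-(9 / 4) : ℝ) * (q : ℝ) ^ (1 / 8 : ℝ)) *
        ((1 + w) ^ (-(9 / 4) : ℝ) * (1 + w) ^ (1 / 4 : ℝ)) := by ring
    _ = (q : ℝ) ^ (-(17 / 8) : ℝ) * (1 + w) ^ (-(2 : ℕ) : ℝ) := by
        rw [← Real.rpow_add hqR, ← Real.rpow_add h1]; norm_num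
    _ ≤ _ := by
        rw [Real.rpow_neg h1.le, Real.rpow_natCast]
        gcongr
        nlinarith

lemma arcSize_rpow_le {N : ℕ} {θ : ℝ} {q : ℕ} {a : ℤ} (hq : 1 ≤ q) :
    arcSize N θ q a ^ (-(9 / 4) : ℝ)
      ≤ (q : ℝ) ^ (-(17 / 8) : ℝ) * (1 + ((N : ℝ) ^ 2 * (θ - a / q)) ^ 2)⁻¹ := by
  refine le_trans ?_ (arcSize_rpow_mul_le hq)
  have h0 := one_le_arcSize (N := N) (θ := θ) (a := a) hq
  refine le_mul_of_one_le_right (by positivity) ?_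
  have h1 : (1 : ℝ) ≤ (q : ℝ) ^ (1 / 8 : ℝ) := Real.one_le_rpow (by exact_mod_cast hq) (by norm_num)
  have h2 : (1 : ℝ) ≤ (1 + (N : ℝ) ^ 2 * |θ - a / q|) ^ (1 / 4 : ℝ) :=
    Real.one_le_rpow (by have : 0 ≤ (N : ℝ) ^ 2 * |θ - a / q| := by positivity
                         linarith) (by norm_num)
  exact one_le_mul_of_one_le_of_one_le h1 h2

lemma arcSize_le {K N : ℕ} {θ : ℝ} {q : ℕ} {a : ℤ} (hK : 1 ≤ K) (hN : 1 ≤ N)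
    (h : RatApprox K N θ q a) : arcSize N θ q a ≤ 9 * K * N := by
  have hq : (1 : ℝ) ≤ q := by exact_mod_cast h.one_le
  have hKR : (1 : ℝ) ≤ K := by exact_mod_cast hK
  have hNR : (1 : ℝ) ≤ N := by exact_mod_cast hN
  have h1 : (q : ℝ) ≤ 2 * (2 * K) * (2 * N) := by exact_mod_cast h.den_le
  have h2 := h.abs_sub_le
  rw [le_div_iff₀ (by positivity)] at h2
  push_cast at h2
  have h3 : q * ((N : ℝ) ^ 2 * |θ - a / q|) ≤ N := by
    have : 0 ≤ (N : ℝ) * (q * |θ - a / q|) := by positivity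
    have h4 : |θ - a / q| * (2 * (2 * K) * (2 * N) * q) = 8 * K * (N * (q * |θ - a / q|)) := by ring
    rw [h4] at h2
    have h5 : (N : ℝ) * (q * |θ - a / q|) ≤ 1 := by nlinarith
    calc q * ((N : ℝ) ^ 2 * |θ - a / q|) = N * (N * (q * |θ - a / q|)) := by ring
      _ ≤ N * 1 := by gcongr
      _ = N := mul_one _
  unfold arcSize
  nlinarith

lemma card_diagonal_mul_le {s : ℕ} {i j : Fin s} (hij : i ≠ j) (B : ℕ) :
    ((intBox (Fin s) B).filter fun x => x i = x j).card * B ≤ B ^ s := by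
  have h1 : (intBox (Fin s) B).card = B ^ s := by rw [card_intBox, Fintype.card_fin]
  have h2 : (Finset.Ico (0 : ℤ) B).card = B := by simp
  rw [← h1]
  nth_rewrite 2 [← h2]
  rw [← Finset.card_product]
  refine Finset.card_le_card_of_injOn (fun p => Function.update p.1 i p.2) ?_ ?_
  · intro p hp
    rw [Finset.mem_coe, Finset.mem_product, Finset.mem_filter, mem_intBox, Finset.mem_Ico] at hp
    rw [Finset.mem_coe, mem_intBox]
    intro k
    by_cases hk : k = i
    · subst hk; simpa using hp.2
    · dsimp only
      rw [Function.update_of_ne hk]; exact hp.1.1 k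
  · intro p hp p' hp' heq
    rw [Finset.mem_coe, Finset.mem_product, Finset.mem_filter] at hp hp'
    have hk : ∀ k, k ≠ i → p.1 k = p'.1 k := by
      intro k hk
      have := congrFun heq k
      simpa [Function.update_of_ne hk] using this
    refine Prod.ext (funext fun k => ?_) ?_
    · by_cases hki : k = i
      · rw [hki, hp.1.2, hp'.1.2]; exact hk j hij.symm
      · exact hk k hki
    · simpa using congrFun heq i

variable {s : ℕ} {M : Matrix (Fin s) (Fin s) ℤ}

/-- Few zeros of the form have two equal coordinates. -/
theorem exists_card_degenerate_le (hM : M.IsSymm) {ι κ : Fin 5 → Fin s} (h : IsOffMinor M ι κ) :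
    ∃ C : ℝ, 0 < C ∧ ∀ N : ℕ, 1 ≤ N → ∀ A : Finset ℤ, A ⊆ Finset.Ico 0 (N : ℤ) →
      ∀ i j : Fin s, i ≠ j →
        ((((Fintype.piFinset fun _ : Fin s => A).filter fun x => x i = x j).filter
          fun x => Qf M x = 0).card : ℝ) ≤ C * (N ^ s * (N : ℝ) ^ (-(9 / 4) : ℝ)) := by
  obtain ⟨K, hK, hMK⟩ := exists_row_bound M
  obtain ⟨Z, hZ, hint⟩ := exists_norm_integral_le
  have hKR : (1 : ℝ) ≤ K := by exact_mod_cast hK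
  set E : ℝ := (9600 * (K : ℝ) ^ 2) ^ 3 * 2 ^ s with hE
  have hE0 : 0 < E := by positivity
  refine ⟨Z * (E * (9 * K)) + E, by positivity, fun N hN A hA i j hij => ?_⟩
  obtain ⟨ι', κ', h', ⟨hi1, hi2⟩, hj1, hj2⟩ := h.exists_avoiding_two i j
  have hNR : (1 : ℝ) ≤ N := by exact_mod_cast hN
  have hN0 : (0 : ℝ) < N := by linarith
  set S := (Fintype.piFinset fun _ : Fin s => A).filter fun x => x i = x j with hS
  have hsum : ∀ θ : ℝ, ∑ x ∈ S, ee (θ * (Qf M x : ℤ)) = ∑ x ∈ intBox (Fin s) (2 * N),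
      (if x i = x j then (1 : ℂ) else 0) * (∏ k, if x k ∈ A then (1 : ℂ) else 0) *
        ee (θ * (Qf M x : ℤ)) := by
    intro θ
    have h1 := sum_intBox_indicator (s := s) (A := A) (t := 0) (B := 2 * N) (fun a ha i => by
      have := Finset.mem_Ico.mp (hA ha)
      rw [Pi.zero_apply]; push_cast; constructor <;> linarith)
      (fun x => (if x i = x j then (1 : ℂ) else 0) * ee (θ * (Qf M x : ℤ)))
    simp only [Pi.zero_apply, sub_zero, add_zero] at h1
    rw [hS, Finset.sum_filter]
    refine Eq.trans ?_ (h1.symm.trans (Finset.sum_congr rfl fun x _ => by ring))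
    refine Finset.sum_congr rfl fun x _ => ?_
    split_ifs <;> simp
  have hWB : ∑ x ∈ intBox (Fin s) (2 * N), ‖(if x i = x j then (1 : ℂ) else 0)‖
      ≤ 2 ^ s * N ^ s / N := by
    have e : ∑ x ∈ intBox (Fin s) (2 * N), ‖(if x i = x j then (1 : ℂ) else 0)‖
        = (((intBox (Fin s) (2 * N)).filter fun x => x i = x j).card : ℝ) := by
      rw [Finset.card_filter]
      push_cast
      refine Finset.sum_congr rfl fun x _ => ?_
      split_ifs <;> simp
    rw [e, le_div_iff₀ hN0]
    have h1 := card_diagonal_mul_le hij (2 * N)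
    have h2 : (((intBox (Fin s) (2 * N)).filter fun x => x i = x j).card : ℝ) * (2 * N)
        ≤ (2 * N) ^ s := by exact_mod_cast h1
    rw [mul_pow] at h2
    have h3 : (0 : ℝ) ≤ (((intBox (Fin s) (2 * N)).filter fun x => x i = x j).card : ℝ) * N := by
      positivity
    linarith
  have hpt := hint N (fun θ => ∑ x ∈ S, ee (θ * (Qf M x : ℤ)))
    (E * N ^ s / N * (9 * K * (N : ℝ) ^ (3 / 4 : ℝ))) (E * N ^ s / N * (N : ℝ) ^ (-(3 / 2) : ℝ))
    (2 * (2 * K) * (2 * N)) hN (by positivity) (by positivity) fun θ hθ0 hθ1 => by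
      obtain ⟨q, a, haq, happ⟩ := exists_ratApprox hK hN hθ0 hθ1
      refine ⟨q, a, happ.one_le, happ.den_le, haq, ?_⟩
      have hD1 := one_le_arcSize (N := N) (θ := θ) (a := a) happ.one_le
      have hDN := arcSize_le hK hN happ
      have hDq := arcSize_rpow_le (N := N) (θ := θ) (a := a) happ.one_le
      set D := arcSize N θ q a with hD
      have hD0 : 0 < D := by linarith
      rw [hsum]
      refine (norm_expSum_le hM h' hK hMK hN happ (fun x u v => by
        rw [override_other x u v hi1 hi2, override_other x u v hj1 hj2])
        (g := fun n => if n ∈ A then 1 else 0) (fun n => by split_ifs <;> simp)).trans ?_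
      have e1 : D ^ (-((3 : ℕ) / 2) : ℝ) ≤ 9 * K * (N : ℝ) ^ (3 / 4 : ℝ) *
          ((q : ℝ) ^ (-(17 / 8) : ℝ) * (1 + ((N : ℝ) ^ 2 * (θ - a / q)) ^ 2)⁻¹) := by
        have : D ^ (-((3 : ℕ) / 2) : ℝ) = D ^ (3 / 4 : ℝ) * D ^ (-(9 / 4) : ℝ) := by
          rw [← Real.rpow_add hD0]; norm_num
        rw [this]
        refine mul_le_mul ?_ hDq (by positivity) (by positivity)
        calc D ^ (3 / 4 : ℝ) ≤ (9 * K * N) ^ (3 / 4 : ℝ) :=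
              Real.rpow_le_rpow hD0.le hDN (by norm_num)
          _ = (9 * K) ^ (3 / 4 : ℝ) * (N : ℝ) ^ (3 / 4 : ℝ) :=
              Real.mul_rpow (by positivity) (by positivity)
          _ ≤ 9 * K * (N : ℝ) ^ (3 / 4 : ℝ) := by
              gcongr
              exact Real.rpow_le_self_of_one_le (by linarith) (by norm_num)
      have e2 : (N : ℝ) ^ (-((3 : ℕ) / 2) : ℝ) = (N : ℝ) ^ (-(3 / 2) : ℝ) := by norm_num
      rw [e2]
      refine (mul_le_mul (mul_le_mul_of_nonneg_left hWB (by positivity))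
        (add_le_add_left e1 _) (by positivity) (by positivity)).trans (le_of_eq ?_)
      rw [hE]
      ring
  simp only [integral_sum_ee, Complex.norm_natCast] at hpt
  refine hpt.trans (le_of_eq_of_le
    (b := Z * (E * (9 * K)) * (N ^ s * (N : ℝ) ^ (-(9 / 4) : ℝ)) +
      E * (N ^ s * (N : ℝ) ^ (-(5 / 2) : ℝ))) ?_ ?_)
  · have e1 : (N : ℝ) ^ (-(9 / 4) : ℝ) = (N : ℝ) ^ (3 / 4 : ℝ) / N ^ 3 := by
      rw [← Real.rpow_natCast, ← Real.rpow_sub hN0]; norm_num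
    have e2 : (N : ℝ) ^ (-(5 / 2) : ℝ) = (N : ℝ) ^ (-(3 / 2) : ℝ) / N := by
      nth_rewrite 3 [← Real.rpow_one (N : ℝ)]
      rw [← Real.rpow_sub hN0]; norm_num
    rw [e1, e2]
    field_simp
  · rw [add_mul]
    have := Real.rpow_le_rpow_of_exponent_le hNR (show (-(5 / 2) : ℝ) ≤ -(9 / 4) by norm_num)
    gcongr

end Degenerate

section Comparison

variable {s : ℕ} {M : Matrix (Fin s) (Fin s) ℤ}

/-- `1` minus the average of the characters of the first `H` multiples of `Q`. -/
def coKernel (Q H : ℕ) (θ : ℝ) : ℂ :=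
  1 - (H : ℂ)⁻¹ * ∑ h ∈ Finset.range H, ee (θ * (-(Q * h : ℤ) : ℤ))

lemma coKernel_eq {Q H : ℕ} (hH : 1 ≤ H) (θ : ℝ) :
    coKernel Q H θ = (H : ℂ)⁻¹ * ∑ h ∈ Finset.range H, (1 - ee (θ * (-(Q * h : ℤ) : ℤ))) := by
  have : (H : ℂ) ≠ 0 := by exact_mod_cast (by omega : H ≠ 0)
  rw [coKernel, Finset.sum_sub_distrib, Finset.sum_const, Finset.card_range, nsmul_eq_mul, mul_one,
    mul_sub, inv_mul_cancel₀ this]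

lemma norm_coKernel_le_of_forall {Q H : ℕ} (hH : 1 ≤ H) (θ : ℝ) {B : ℝ}
    (h : ∀ h ∈ Finset.range H, ‖1 - ee (θ * (-(Q * h : ℤ) : ℤ))‖ ≤ B) :
    ‖coKernel Q H θ‖ ≤ B := by
  have hH0 : (0 : ℝ) < H := by exact_mod_cast hH
  rw [coKernel_eq hH, norm_mul, norm_inv, Complex.norm_natCast, inv_mul_le_iff₀ hH0]
  refine (norm_sum_le_of_le _ h).trans (le_of_eq ?_)
  rw [Finset.sum_const, Finset.card_range, nsmul_eq_mul]

lemma norm_coKernel_le_two {Q H : ℕ} (hH : 1 ≤ H) (θ : ℝ) : ‖coKernel Q H θ‖ ≤ 2 := by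
  refine norm_coKernel_le_of_forall hH θ fun h _ => (norm_sub_le _ _).trans ?_
  rw [norm_one, norm_ee]; norm_num

lemma norm_coKernel_le {Q H q : ℕ} (hH : 1 ≤ H) (hq : 1 ≤ q) (hqQ : q ∣ Q) (θ : ℝ) (a : ℤ) :
    ‖coKernel Q H θ‖ ≤ 7 * (Q * H) * |θ - a / q| := by
  refine norm_coKernel_le_of_forall hH θ fun h hh => ?_
  have hh' : (h : ℝ) ≤ H := by exact_mod_cast (Finset.mem_range.mp hh).le
  have h1 := norm_ee_sub_ee_le_of_dvd (θ := θ) hq a (m := 0) (n := -(Q * h : ℤ)) (by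
    rw [sub_neg_eq_add, zero_add]
    exact Dvd.dvd.mul_right (Int.natCast_dvd_natCast.mpr hqQ) _)
  rw [Int.cast_zero, mul_zero, ee_zero] at h1
  refine h1.trans ?_
  have e : |((0 - -(Q * h : ℤ) : ℤ) : ℝ)| = Q * h := by
    rw [sub_neg_eq_add, zero_add]; push_cast
    rw [abs_of_nonneg (by positivity)]
  rw [e]
  have hπ : 2 * Real.pi ≤ 7 := by linarith [Real.pi_lt_d2]
  calc 2 * Real.pi * (|θ - a / q| * (Q * h)) ≤ 7 * (|θ - a / q| * (Q * H)) := by gcongr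
    _ = _ := by ring

/-- Interpolation of the trivial bound and the bound near rationals with small denominators. -/
lemma norm_coKernel_le_rpow {Q₀ H N q : ℕ} {δ : ℝ} (hδ : 0 < δ) (hH : 1 ≤ H) (hQ₀ : 1 ≤ Q₀)
    (hq : 1 ≤ q) (hHδ : (Q₀.factorial : ℝ) * H ≤ 2 * (δ * N ^ 2)) (θ : ℝ) (a : ℤ) :
    ‖coKernel Q₀.factorial H θ‖ ≤ 4 * (δ ^ (1 / 4 : ℝ) + (Q₀ : ℝ) ^ (-(1 / 8) : ℝ)) *
      ((q : ℝ) ^ (1 / 8 : ℝ) * (1 + (N : ℝ) ^ 2 * |θ - a / q|) ^ (1 / 4 : ℝ)) := by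
  set w := (N : ℝ) ^ 2 * |θ - a / q| with hw
  have hw0 : 0 ≤ w := by positivity
  have hw1 : 1 ≤ (1 + w) ^ (1 / 4 : ℝ) := Real.one_le_rpow (by linarith) (by norm_num)
  have hqR : (1 : ℝ) ≤ q := by exact_mod_cast hq
  have hQR : (1 : ℝ) ≤ Q₀ := by exact_mod_cast hQ₀
  have hq1 : 1 ≤ (q : ℝ) ^ (1 / 8 : ℝ) := Real.one_le_rpow hqR (by norm_num)
  have hδ0 : 0 < δ ^ (1 / 4 : ℝ) := by positivity
  have hQ0 : 0 < (Q₀ : ℝ) ^ (-(1 / 8) : ℝ) := by positivity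
  set X := (q : ℝ) ^ (1 / 8 : ℝ) * (1 + w) ^ (1 / 4 : ℝ) with hX
  have h2 := norm_coKernel_le_two (Q := Q₀.factorial) hH θ
  rcases le_or_gt q Q₀ with hqQ | hqQ
  · have h1 := norm_coKernel_le hH hq (Nat.dvd_factorial hq hqQ) θ a
    have h3 : ‖coKernel Q₀.factorial H θ‖ ≤ 14 * δ * w := by
      refine h1.trans ?_
      calc 7 * ((Q₀.factorial : ℝ) * H) * |θ - a / q| ≤ 7 * (2 * (δ * N ^ 2)) * |θ - a / q| := by
            gcongr
        _ = _ := by rw [hw]; ring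
    have h4 : ‖coKernel Q₀.factorial H θ‖ ≤ 2 * (16 * δ * (1 + w)) ^ (1 / 4 : ℝ) := by
      rcases le_or_gt 1 (16 * δ * (1 + w)) with hy | hy
      · have := Real.one_le_rpow hy (show (0 : ℝ) ≤ 1 / 4 by norm_num)
        linarith
      · have h5 := Real.rpow_le_rpow_of_exponent_ge (by positivity) hy.le
          (show (1 / 4 : ℝ) ≤ 1 by norm_num)
        rw [Real.rpow_one] at h5
        have h6 : 0 ≤ δ * w := by positivity
        linarith
    have h5 : (16 * δ * (1 + w)) ^ (1 / 4 : ℝ) = 2 * δ ^ (1 / 4 : ℝ) * (1 + w) ^ (1 / 4 : ℝ) := by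
      have h16 : (16 : ℝ) ^ (1 / 4 : ℝ) = 2 := by
        rw [show (16 : ℝ) = 2 ^ (4 : ℝ) by norm_num, ← Real.rpow_mul (by norm_num)]
        norm_num
      rw [Real.mul_rpow (by positivity) (by positivity), Real.mul_rpow (by norm_num) hδ.le, h16]
    rw [h5] at h4
    calc ‖coKernel Q₀.factorial H θ‖ ≤ 4 * δ ^ (1 / 4 : ℝ) * (1 * (1 + w) ^ (1 / 4 : ℝ)) := by
          linarith
      _ ≤ 4 * (δ ^ (1 / 4 : ℝ) + (Q₀ : ℝ) ^ (-(1 / 8) : ℝ)) * X := by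
          rw [hX]; gcongr; linarith
  · have h3 : 1 ≤ (Q₀ : ℝ) ^ (-(1 / 8) : ℝ) * (q : ℝ) ^ (1 / 8 : ℝ) := by
      have h4 : (Q₀ : ℝ) ^ (1 / 8 : ℝ) ≤ (q : ℝ) ^ (1 / 8 : ℝ) :=
        Real.rpow_le_rpow (by positivity) (by exact_mod_cast hqQ.le) (by norm_num)
      rw [Real.rpow_neg (by positivity), ← div_eq_inv_mul, one_le_div (by positivity)]
      exact h4
    have h4 : 1 ≤ (Q₀ : ℝ) ^ (-(1 / 8) : ℝ) * X := by
      rw [hX, ← mul_assoc]; exact one_le_mul_of_one_le_of_one_le h3 hw1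
    have h5 : 0 ≤ δ ^ (1 / 4 : ℝ) * X := by positivity
    linarith

/-- The integral of the exponential sum against the complementary kernel. -/
lemma integral_setSum_mul_coKernel (A : Finset ℤ) (Q H : ℕ) :
    ∫ θ in (0 : ℝ)..1, setSum M A θ * coKernel Q H θ
      = ((((Fintype.piFinset fun _ : Fin s => A).filter fun x => Qf M x = 0).card : ℝ) -
        (H : ℝ)⁻¹ * ((((Fintype.piFinset fun _ : Fin s => A) ×ˢ Finset.range H).filter
          fun p => Qf M p.1 + -(Q * p.2 : ℤ) = 0).card : ℝ) : ℝ) := by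
  have h1 : ∀ θ : ℝ, setSum M A θ * coKernel Q H θ =
      (∑ x ∈ Fintype.piFinset fun _ : Fin s => A, ee (θ * (Qf M x : ℤ))) - (H : ℂ)⁻¹ *
        ∑ p ∈ (Fintype.piFinset fun _ : Fin s => A) ×ˢ Finset.range H,
          ee (θ * (Qf M p.1 + -(Q * p.2 : ℤ) : ℤ)) := by
    intro θ
    have h2 : ∑ p ∈ (Fintype.piFinset fun _ : Fin s => A) ×ˢ Finset.range H,
        ee (θ * (Qf M p.1 + -(Q * p.2 : ℤ) : ℤ)) =
        setSum M A θ * ∑ h ∈ Finset.range H, ee (θ * (-(Q * h : ℤ) : ℤ)) := by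
      rw [setSum, Finset.sum_mul_sum, Finset.sum_product]
      refine Finset.sum_congr rfl fun x _ => Finset.sum_congr rfl fun h _ => ?_
      rw [← ee_add, Int.cast_add, mul_add]
    rw [h2, coKernel, setSum]; ring
  have hc : ∀ {β : Type} (S : Finset β) (φ : β → ℤ), Continuous fun θ : ℝ =>
      ∑ x ∈ S, ee (θ * φ x) := by
    intro β S φ
    unfold ee
    fun_prop
  have hc2 : Continuous fun θ : ℝ => (H : ℂ)⁻¹ *
      ∑ p ∈ (Fintype.piFinset fun _ : Fin s => A) ×ˢ Finset.range H,
        ee (θ * (Qf M p.1 + -(Q * p.2 : ℤ) : ℤ)) := continuous_const.mul (hc _ _)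
  simp only [h1]
  rw [intervalIntegral.integral_sub ((hc _ _).intervalIntegrable _ _)
    (hc2.intervalIntegrable _ _), intervalIntegral.integral_const_mul,
    integral_sum_ee, integral_sum_ee]
  push_cast
  rfl

/-- Comparison of the number of zeros with the number of points at which the form is small and
highly divisible. -/
theorem exists_card_small_le (hM : M.IsSymm) {ι κ : Fin 5 → Fin s} (h : IsOffMinor M ι κ) :
    ∃ C : ℝ, 0 < C ∧ ∀ N Q : ℕ, 2 ≤ Q → Q ^ 4 ≤ N → ∀ (A : Finset ℤ) (α : ℝ), 0 < α → α ≤ 1 →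
      A ⊆ Finset.Ico 0 (N : ℤ) → (Q : ℝ) ^ (-(1 / 4) : ℝ) ≤ α ^ s →
      (∀ (b : ℤ) (q L : ℕ), 1 ≤ q → q ≤ Q → N ≤ Q ^ 4 * L → L ≤ N →
          (apCount A b q L : ℝ) ≤ 2 * α * L) →
      ∀ (Q₀ : ℕ) (δ : ℝ), 1 ≤ Q₀ → 0 < δ → (Q₀.factorial : ℝ) ≤ δ * N ^ 2 →
        Q₀.factorial / (2 * (δ * N ^ 2)) * (((Fintype.piFinset fun _ : Fin s => A).filter fun x =>
          (Q₀.factorial : ℤ) ∣ Qf M x ∧ 0 ≤ Qf M x ∧ (Qf M x : ℝ) < δ * N ^ 2).card : ℝ)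
        ≤ (((Fintype.piFinset fun _ : Fin s => A).filter fun x => Qf M x = 0).card : ℝ) +
          C * ((δ ^ (1 / 4 : ℝ) + (Q₀ : ℝ) ^ (-(1 / 8) : ℝ)) * (α ^ s * N ^ s / N ^ 2) +
            N ^ s * (N : ℝ) ^ (-(5 / 2) : ℝ)) := by
  obtain ⟨K, hK, hMK⟩ := exists_row_bound M
  obtain ⟨Z, hZ, hint⟩ := exists_norm_integral_le
  obtain ⟨C, hC, hS⟩ := norm_setSum_le_of_regular hM h hK hMK
  refine ⟨4 * C * Z + 2 * C, by positivity, ?_⟩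
  intro N Q hQ hQN A α hα hα1 hA hQα hreg Q₀ δ hQ₀ hδ hfac
  have hN : 1 ≤ N := le_trans (Nat.one_le_pow _ _ (by omega)) hQN
  have hNR : (1 : ℝ) ≤ N := by exact_mod_cast hN
  have hP0 : 0 < Q₀.factorial := Nat.factorial_pos _
  set P := Q₀.factorial with hP
  have hPR : (0 : ℝ) < P := by exact_mod_cast hP0
  set Y := δ * (N : ℝ) ^ 2 with hY
  have hY0 : 0 < Y := by positivity
  set H := ⌈Y / P⌉₊ with hH
  have hH1 : 1 ≤ H := Nat.ceil_pos.mpr (by positivity)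
  have hHR : (0 : ℝ) < H := by exact_mod_cast hH1
  have hHle : (P : ℝ) * H ≤ 2 * Y := by
    have h1 : (H : ℝ) < Y / P + 1 := Nat.ceil_lt_add_one (by positivity)
    have h2 : (P : ℝ) * H ≤ P * (Y / P + 1) := by gcongr
    rw [mul_add, mul_div_cancel₀ _ hPR.ne', mul_one] at h2
    linarith
  have hHge : Y ≤ P * H := by
    have h1 : Y / P ≤ H := Nat.le_ceil _
    rw [div_le_iff₀ hPR] at h1; linarith
  set τ := δ ^ (1 / 4 : ℝ) + (Q₀ : ℝ) ^ (-(1 / 8) : ℝ) with hτ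
  have hτ0 : 0 ≤ τ := by positivity
  have hpt := hint N (fun θ => setSum M A θ * coKernel P H θ) (4 * C * τ * (α ^ s * N ^ s))
    (2 * C * (N ^ s * (N : ℝ) ^ (-(5 / 2) : ℝ))) (2 * (2 * K) * (2 * N)) hN (by positivity)
    (by positivity) fun θ hθ0 hθ1 => by
      obtain ⟨q, a, haq, happ⟩ := exists_ratApprox hK hN hθ0 hθ1
      refine ⟨q, a, happ.one_le, happ.den_le, haq, ?_⟩
      have h1 := hS N Q hQ hQN A α hα hα1 hA hQα hreg θ q a happ
      have h2 := norm_coKernel_le_two (Q := P) hH1 θ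
      have h3 := norm_coKernel_le_rpow hδ hH1 hQ₀ happ.one_le hHle θ a
      have h4 := arcSize_rpow_mul_le (N := N) (θ := θ) (a := a) happ.one_le
      rw [norm_mul]
      set D := arcSize N θ q a ^ (-(9 / 4) : ℝ) with hD
      have hD0 : 0 ≤ D := by
        have := one_le_arcSize (N := N) (θ := θ) (a := a) happ.one_le
        positivity
      set X := (q : ℝ) ^ (1 / 8 : ℝ) * (1 + (N : ℝ) ^ 2 * |θ - (a : ℤ) / q|) ^ (1 / 4 : ℝ)
      calc ‖setSum M A θ‖ * ‖coKernel P H θ‖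
          ≤ C * (α ^ s * N ^ s * D + N ^ s * (N : ℝ) ^ (-(5 / 2) : ℝ)) * ‖coKernel P H θ‖ := by
            gcongr
        _ = C * (α ^ s * N ^ s) * D * ‖coKernel P H θ‖ +
            C * (N ^ s * (N : ℝ) ^ (-(5 / 2) : ℝ)) * ‖coKernel P H θ‖ := by ring
        _ ≤ C * (α ^ s * N ^ s) * D * (4 * τ * X) +
            C * (N ^ s * (N : ℝ) ^ (-(5 / 2) : ℝ)) * 2 := by
            gcongr
        _ = 4 * C * τ * (α ^ s * N ^ s) * (D * X) +
            2 * C * (N ^ s * (N : ℝ) ^ (-(5 / 2) : ℝ)) := by ring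
        _ ≤ _ := add_le_add (mul_le_mul_of_nonneg_left h4 (by positivity)) le_rfl
  rw [integral_setSum_mul_coKernel, Complex.norm_real, Real.norm_eq_abs, abs_sub_comm] at hpt
  have hpt' := (le_abs_self _).trans hpt
  set R := (((Fintype.piFinset fun _ : Fin s => A).filter fun x => Qf M x = 0).card : ℝ)
  have hcount : ((Fintype.piFinset fun _ : Fin s => A).filter fun x =>
      (P : ℤ) ∣ Qf M x ∧ 0 ≤ Qf M x ∧ (Qf M x : ℝ) < Y).card ≤
      (((Fintype.piFinset fun _ : Fin s => A) ×ˢ Finset.range H).filter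
          fun p => Qf M p.1 + -(P * p.2 : ℤ) = 0).card := by
    refine Finset.card_le_card_of_injOn (fun x => (x, (Qf M x / P).toNat)) ?_ ?_
    · intro x hx
      rw [Finset.mem_coe, Finset.mem_filter] at hx
      obtain ⟨hx, ⟨k, hk⟩, hx0, hxY⟩ := hx
      have hPZ : (0 : ℤ) < P := by exact_mod_cast hP0
      have hk' : Qf M x / P = k := by rw [hk, Int.mul_ediv_cancel_left _ hPZ.ne']
      have hk0 : 0 ≤ k := by
        rw [hk] at hx0; exact nonneg_of_mul_nonneg_right hx0 hPZ
      have hkn : ((k.toNat : ℕ) : ℤ) = k := Int.toNat_of_nonneg hk0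
      have hkH : k < H := by
        have h1 : (P : ℝ) * k < P * H := by
          have : (Qf M x : ℝ) = P * k := by rw [hk]; push_cast; rfl
          rw [← this]; linarith
        have h2 : (k : ℝ) < H := lt_of_mul_lt_mul_left h1 hPR.le
        exact_mod_cast h2
      rw [Finset.mem_coe, Finset.mem_filter, Finset.mem_product, Finset.mem_range]
      dsimp only
      rw [hk', hkn, hk]
      exact ⟨⟨hx, by omega⟩, by ring⟩
    · intro x _ y _ hxy
      exact congrArg Prod.fst hxy
  have hcR : (((Fintype.piFinset fun _ : Fin s => A).filter fun x =>
      (P : ℤ) ∣ Qf M x ∧ 0 ≤ Qf M x ∧ (Qf M x : ℝ) < Y).card : ℝ) ≤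
      ((((Fintype.piFinset fun _ : Fin s => A) ×ˢ Finset.range H).filter
          fun p => Qf M p.1 + -(P * p.2 : ℤ) = 0).card : ℝ) := by exact_mod_cast hcount
  have hPH : (P : ℝ) / (2 * Y) ≤ (H : ℝ)⁻¹ := by
    rw [div_le_iff₀ (by positivity), ← div_eq_inv_mul, le_div_iff₀ hHR]
    exact hHle
  refine (mul_le_mul hPH hcR (by positivity) (by positivity)).trans ?_
  have hrest : Z * (4 * C * τ * (α ^ s * N ^ s)) / N ^ 2 +
      2 * C * (N ^ s * (N : ℝ) ^ (-(5 / 2) : ℝ)) ≤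
      (4 * C * Z + 2 * C) * (τ * (α ^ s * N ^ s / N ^ 2) + N ^ s * (N : ℝ) ^ (-(5 / 2) : ℝ)) := by
    have h1 : 0 ≤ 2 * C * (τ * (α ^ s * N ^ s / N ^ 2)) := by positivity
    have h2 : 0 ≤ 4 * C * Z * (N ^ s * (N : ℝ) ^ (-(5 / 2) : ℝ)) := by positivity
    have e : Z * (4 * C * τ * (α ^ s * N ^ s)) / N ^ 2 =
      4 * C * Z * (τ * (α ^ s * N ^ s / N ^ 2)) := by ring
    rw [e]; linarith
  linarith

end Comparison

section Zeros

variable {s : ℕ} {M : Matrix (Fin s) (Fin s) ℤ}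

lemma exists_nat_rpow_neg_le {a v : ℝ} (ha : 0 < a) (hv : 0 < v) :
    ∃ n₀ : ℕ, 1 ≤ n₀ ∧ ∀ n : ℕ, n₀ ≤ n → (n : ℝ) ^ (-a) ≤ v := by
  have h1 := ((tendsto_rpow_neg_atTop ha).comp tendsto_natCast_atTop_atTop).eventually_le_const hv
  obtain ⟨n₀, hn₀⟩ := Filter.eventually_atTop.mp h1
  exact ⟨max n₀ 1, le_max_right _ _, fun n hn => hn₀ n ((le_max_left _ _).trans hn)⟩

lemma exists_pos_le_rpow_quarter_le {δ₀ u : ℝ} (hδ₀ : 0 < δ₀) (hu : 0 < u) :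
    ∃ δ, 0 < δ ∧ δ ≤ δ₀ ∧ δ ^ (1 / 4 : ℝ) ≤ u := by
  refine ⟨min δ₀ (u ^ 4), by positivity, min_le_left _ _, ?_⟩
  calc (min δ₀ (u ^ 4)) ^ (1 / 4 : ℝ) ≤ (u ^ 4) ^ (1 / 4 : ℝ) := by
        gcongr; exact min_le_right _ _
    _ = u := by
        rw [← Real.rpow_natCast, ← Real.rpow_mul hu.le]; norm_num

/-- If every zero of `f` in a box has a repeated coordinate, the zeros are counted by the
degenerate ones. -/
lemma card_zeros_le_of_forall_not_injective {D : ℝ} {A : Finset ℤ}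
    (hD : ∀ i j : Fin s, i ≠ j → ((((Fintype.piFinset fun _ : Fin s => A).filter
      fun x => x i = x j).filter fun x => Qf M x = 0).card : ℝ) ≤ D) (hD0 : 0 ≤ D)
    (hx : ∀ x : Fin s → ℤ, (∀ i, x i ∈ A) → Qf M x = 0 → ¬ Function.Injective x) :
    (((Fintype.piFinset fun _ : Fin s => A).filter fun x => Qf M x = 0).card : ℝ) ≤
      (s : ℝ) ^ 2 * D := by
  classical
  set U := (Finset.univ : Finset (Fin s × Fin s)).filter fun p => p.1 ≠ p.2
  have hsub : ((Fintype.piFinset fun _ : Fin s => A).filter fun x => Qf M x = 0) ⊆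
      U.biUnion fun p => ((Fintype.piFinset fun _ : Fin s => A).filter
        fun x => x p.1 = x p.2).filter fun x => Qf M x = 0 := by
    intro x hxm
    rw [Finset.mem_filter, Fintype.mem_piFinset] at hxm
    have h1 := hx x hxm.1 hxm.2
    simp only [Function.Injective, not_forall] at h1
    obtain ⟨i, j, hij, hne⟩ := h1
    simp only [Finset.mem_biUnion, Finset.mem_filter, Fintype.mem_piFinset]
    exact ⟨(i, j), by simp [U, hne], ⟨hxm.1, hij⟩, hxm.2⟩
  have hU : (U.card : ℝ) ≤ (s : ℝ) ^ 2 := by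
    have : U.card ≤ s ^ 2 := (Finset.card_filter_le _ _).trans (by simp [sq])
    exact_mod_cast this
  calc (((Fintype.piFinset fun _ : Fin s => A).filter fun x => Qf M x = 0).card : ℝ)
      ≤ ∑ p ∈ U, ((((Fintype.piFinset fun _ : Fin s => A).filter
        fun x => x p.1 = x p.2).filter fun x => Qf M x = 0).card : ℝ) := by
        exact_mod_cast (Finset.card_le_card hsub).trans Finset.card_biUnion_le
    _ ≤ ∑ p ∈ U, D := Finset.sum_le_sum fun p hp => hD _ _ (Finset.mem_filter.mp hp).2
    _ = U.card * D := by rw [Finset.sum_const, nsmul_eq_mul]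
    _ ≤ _ := by gcongr

/-- A set which is nowhere much denser on progressions contains a nondegenerate zero of `f`. -/
theorem exists_injective_zero_of_regular (hM : M.IsSymm) (htri : TransInv M)
    (hind : Indefinite M) {ι κ : Fin 5 → Fin s} (h : IsOffMinor M ι κ) :
    ∃ m Q₁ : ℕ, 1 ≤ m ∧ ∀ N Q : ℕ, Q₁ ≤ Q → Q ^ 8 ≤ N → ∀ (A : Finset ℤ) (α : ℝ), 0 < α → α ≤ 1 →
      A ⊆ Finset.Ico 0 (N : ℤ) → α * N ≤ A.card → (Q : ℝ) ^ (-(1 / 4) : ℝ) ≤ α ^ s →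
      (∀ (b : ℤ) (q L : ℕ), 1 ≤ q → N ≤ Q ^ 4 * L → L ≤ N →
          (apCount A b q L : ℝ) ≤ (1 + 1 / (4 * m)) * α * L) →
      ∃ x : Fin s → ℤ, (∀ i, x i ∈ A) ∧ Function.Injective x ∧ Qf M x = 0 := by
  obtain ⟨c, hc, δ₀, hδ₀, hlow⟩ := exists_le_card_filter_dvd_small hM htri hind h
  obtain ⟨C, hC, hcomp⟩ := exists_card_small_le hM h
  obtain ⟨D, hD, hdeg⟩ := exists_card_degenerate_le hM h
  obtain ⟨δ, hδ, hδle, hδu⟩ := exists_pos_le_rpow_quarter_le hδ₀ (u := c / (16 * C)) (by positivity)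
  obtain ⟨Q₀, hQ₀, hQ₀u⟩ := exists_nat_rpow_neg_le (a := 1 / 8) (v := c / (16 * C)) (by norm_num)
    (by positivity)
  obtain ⟨n₀, hn₀, hn₀u⟩ := exists_nat_rpow_neg_le (a := 7 / 32)
    (v := c / (8 * (C + s ^ 2 * D))) (by norm_num) (by positivity)
  have hP0 : 0 < Q₀.factorial := Nat.factorial_pos _
  obtain ⟨m, hm, hlow⟩ := hlow δ hδ hδle Q₀.factorial hP0
  refine ⟨m, max (max 2 (2 * m)) (max n₀ ⌈Q₀.factorial / δ⌉₊), hm, ?_⟩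
  intro N Q hQ hQN A α hα hα1 hA hcard hQα hreg
  simp only [max_le_iff] at hQ
  obtain ⟨⟨hQ2, hQm⟩, hQn, hQf⟩ := hQ
  have hpow : ∀ k : ℕ, k ≤ 8 → Q ^ k ≤ N := fun k hk =>
    (Nat.pow_le_pow_right (by omega) hk).trans hQN
  have hQleN : Q ≤ N := by simpa using hpow 1 (by norm_num)
  have hN1 : 1 ≤ N := by omega
  have hNR : (1 : ℝ) ≤ N := by exact_mod_cast hN1
  have hm4 : (1 : ℝ) / (4 * m) ≤ 1 := by
    have : (1 : ℝ) ≤ m := by exact_mod_cast hm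
    rw [div_le_one (by positivity)]; linarith
  have hfac : (Q₀.factorial : ℝ) ≤ δ * N ^ 2 := by
    have h1 : (Q₀.factorial : ℝ) / δ ≤ N :=
      (Nat.le_ceil _).trans (by exact_mod_cast hQf.trans hQleN)
    rw [div_le_iff₀ hδ] at h1
    nlinarith
  have h1 := hlow N (by nlinarith [hpow 2 (by norm_num)]) A α hα hA hcard fun b L hL hLN =>
    hreg b _ L hP0 (hL.trans (Nat.mul_le_mul_right _ (by
      calc m ≤ Q := by omega
        _ ≤ Q ^ 4 := Nat.le_self_pow (by norm_num) Q))) hLN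
  have h2 := hcomp N Q hQ2 (hpow 4 (by norm_num)) A α hα hα1 hA hQα (fun b q L hq _ hL hLN =>
    (hreg b q L hq hL hLN).trans (by gcongr; linarith)) Q₀ δ hQ₀ hδ hfac
  by_contra hcon
  push Not at hcon
  have h3 := card_zeros_le_of_forall_not_injective (hdeg N hN1 A hA) (by positivity)
    fun x hx hx0 hinj => hcon x hx hinj hx0
  set R := (((Fintype.piFinset fun _ : Fin s => A).filter fun x => Qf M x = 0).card : ℝ)
  set T := α ^ s * N ^ s / N ^ 2 with hT
  have hT0 : 0 < T := by positivity
  have h4 : c / 2 * T ≤ R + C * ((δ ^ (1 / 4 : ℝ) + (Q₀ : ℝ) ^ (-(1 / 8) : ℝ)) * T +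
      N ^ s * (N : ℝ) ^ (-(5 / 2) : ℝ)) := by
    refine le_trans (le_of_eq ?_) ((mul_le_mul_of_nonneg_left h1 (by positivity)).trans h2)
    have : (Q₀.factorial : ℝ) ≠ 0 := by exact_mod_cast hP0.ne'
    rw [hT]; field_simp
  have h5 : C * ((δ ^ (1 / 4 : ℝ) + (Q₀ : ℝ) ^ (-(1 / 8) : ℝ)) * T) ≤ c / 8 * T := by
    calc C * ((δ ^ (1 / 4 : ℝ) + (Q₀ : ℝ) ^ (-(1 / 8) : ℝ)) * T)
        ≤ C * ((c / (16 * C) + c / (16 * C)) * T) := by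
          gcongr; exact hQ₀u Q₀ le_rfl
      _ = c / 8 * T := by field_simp; ring
  have h6 : (N : ℝ) ^ s * (N : ℝ) ^ (-(5 / 2) : ℝ) ≤ N ^ s * (N : ℝ) ^ (-(9 / 4) : ℝ) :=
    mul_le_mul_of_nonneg_left (Real.rpow_le_rpow_of_exponent_le hNR (by norm_num)) (by positivity)
  have h7 : (N : ℝ) ^ (-(1 / 32) : ℝ) ≤ α ^ s := by
    refine le_trans ?_ hQα
    have : (Q : ℝ) ^ (8 : ℝ) ≤ N := by exact_mod_cast hQN
    have hQ0 : (0 : ℝ) < Q := by exact_mod_cast (by omega : 0 < Q)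
    calc (N : ℝ) ^ (-(1 / 32) : ℝ) ≤ ((Q : ℝ) ^ (8 : ℝ)) ^ (-(1 / 32) : ℝ) :=
          Real.rpow_le_rpow_of_nonpos (by positivity) this (by norm_num)
      _ = _ := by rw [← Real.rpow_mul hQ0.le]; norm_num
  have h8 : (C + s ^ 2 * D) * (N ^ s * (N : ℝ) ^ (-(9 / 4) : ℝ)) ≤ c / 8 * T := by
    have e1 : (N : ℝ) ^ (-(9 / 4) : ℝ) =
        ((N : ℝ) ^ 2)⁻¹ * (N : ℝ) ^ (-(1 / 32) : ℝ) * (N : ℝ) ^ (-(7 / 32) : ℝ) := by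
      rw [← Real.rpow_natCast, ← Real.rpow_neg (by positivity), ← Real.rpow_add (by positivity),
        ← Real.rpow_add (by positivity)]
      norm_num
    calc (C + s ^ 2 * D) * (N ^ s * (N : ℝ) ^ (-(9 / 4) : ℝ))
        ≤ (C + s ^ 2 * D) * (N ^ s * (((N : ℝ) ^ 2)⁻¹ * α ^ s * (c / (8 * (C + s ^ 2 * D))))) := by
          rw [e1]
          gcongr
          exact hn₀u N (hQn.trans hQleN)
      _ = c / 8 * T := by
          rw [hT]; field_simp
  have h9 : C * (N ^ s * (N : ℝ) ^ (-(5 / 2) : ℝ)) ≤ C * (N ^ s * (N : ℝ) ^ (-(9 / 4) : ℝ)) :=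
    mul_le_mul_of_nonneg_left h6 hC.le
  nlinarith [mul_pos hc hT0]

end Zeros

section Density

lemma apCount_le (A : Finset ℤ) (b : ℤ) (q L : ℕ) : apCount A b q L ≤ L :=
  (Finset.card_filter_le _ _).trans (Finset.card_range L).le

/-- Among all arithmetic progressions of length at most `N₀` there is one maximizing the number of
points of `A`, weighted by a power of the length. -/
lemma exists_apCount_div_max (A : Finset ℤ) {N₀ : ℕ} (hN₀ : 1 ≤ N₀) (w : ℕ → ℝ) :
    ∃ (b : ℤ) (d N : ℕ), 1 ≤ d ∧ 1 ≤ N ∧ N ≤ N₀ ∧ ∀ (b' : ℤ) (d' L : ℕ), 1 ≤ d' → 1 ≤ L → L ≤ N₀ →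
      (apCount A b' d' L : ℝ) / w L ≤ (apCount A b d N : ℝ) / w N := by
  classical
  set S := ((Finset.range (N₀ + 1)) ×ˢ (Finset.Icc 1 N₀)).filter fun p : ℕ × ℕ =>
    ∃ (b : ℤ) (d : ℕ), 1 ≤ d ∧ apCount A b d p.2 = p.1
  have hmem : ∀ (b' : ℤ) (d' L : ℕ), 1 ≤ d' → 1 ≤ L → L ≤ N₀ → (apCount A b' d' L, L) ∈ S := by
    intro b' d' L hd hL hLN
    have := apCount_le A b' d' L
    simp only [S, Finset.mem_filter, Finset.mem_product, Finset.mem_range, Finset.mem_Icc]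
    exact ⟨⟨by omega, hL, hLN⟩, b', d', hd, rfl⟩
  obtain ⟨⟨c, N⟩, hp, hmax⟩ := S.exists_max_image (fun p => (p.1 : ℝ) / w p.2)
    ⟨_, hmem 0 1 N₀ le_rfl hN₀ le_rfl⟩
  simp only [S, Finset.mem_filter, Finset.mem_product, Finset.mem_range, Finset.mem_Icc] at hp
  obtain ⟨⟨-, hN1, hNN⟩, b, d, hd, rfl⟩ := hp
  exact ⟨b, d, N, hd, hN1, hNN, fun b' d' L hd' hL hLN => hmax _ (hmem b' d' L hd' hL hLN)⟩

/-- Rescaling of a set along an arithmetic progression of length `N`. -/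
def apRescale (A : Finset ℤ) (b : ℤ) (d N : ℕ) : Finset ℤ :=
  (Finset.Ico 0 (N : ℤ)).filter fun n => b + d * n ∈ A

lemma card_apRescale (A : Finset ℤ) (b : ℤ) (d N : ℕ) :
    (apRescale A b d N).card = apCount A b d N := by
  refine (Finset.card_bij (fun (j : ℕ) _ => (j : ℤ)) ?_ ?_ ?_).symm
  · intro j hj
    rw [Finset.mem_filter, Finset.mem_range] at hj
    rw [apRescale, Finset.mem_filter, Finset.mem_Ico]
    exact ⟨⟨by omega, by omega⟩, hj.2⟩
  · intro i _ j _ hij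
    exact_mod_cast hij
  · intro n hn
    rw [apRescale, Finset.mem_filter, Finset.mem_Ico] at hn
    have hn' : ((n.toNat : ℕ) : ℤ) = n := Int.toNat_of_nonneg hn.1.1
    refine ⟨n.toNat, ?_, hn'⟩
    rw [Finset.mem_filter, Finset.mem_range, hn']
    exact ⟨by omega, hn.2⟩

lemma apCount_apRescale_le (A : Finset ℤ) (b : ℤ) (d N : ℕ) (b' : ℤ) (q L : ℕ) :
    apCount (apRescale A b d N) b' q L ≤ apCount A (b + d * b') (d * q) L := by
  refine Finset.card_le_card fun j hj => ?_
  rw [Finset.mem_filter] at hj ⊢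
  refine ⟨hj.1, ?_⟩
  have h1 := (Finset.mem_filter.mp hj.2).2
  convert h1 using 1
  push_cast; ring

variable {s : ℕ} {M : Matrix (Fin s) (Fin s) ℤ}

/-- A sufficiently dense set of integers contains a nondegenerate zero of `f`. -/
theorem exists_injective_zero_of_dense (hM : M.IsSymm) (htri : TransInv M)
    (hind : Indefinite M) {ι κ : Fin 5 → Fin s} (h : IsOffMinor M ι κ) :
    ∃ (c : ℝ) (Q₁ : ℕ), ∀ N₀ Q : ℕ, Q₁ ≤ Q → c * Real.log Q ^ 2 ≤ Real.log N₀ →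
      ∀ A : Finset ℤ, A ⊆ Finset.Ico 0 (N₀ : ℤ) →
      (Q : ℝ) ^ (-(1 / 4) : ℝ) ≤ ((A.card : ℝ) / N₀) ^ s →
      ∃ x : Fin s → ℤ, (∀ i, x i ∈ A) ∧ Function.Injective x ∧ Qf M x = 0 := by
  obtain ⟨m, Q₁, hm, hmain⟩ := exists_injective_zero_of_regular hM htri hind h
  have hmR : (1 : ℝ) ≤ m := by exact_mod_cast hm
  set ε : ℝ := 1 / (4 * m) with hε
  have hε0 : 0 < ε := by positivity
  have hε1 : ε ≤ 1 := by rw [hε, div_le_one (by positivity)]; linarith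
  set lam := Real.log (1 + ε) with hlam
  have hlam0 : 0 < lam := Real.log_pos (by linarith)
  have hlam1 : lam ≤ 1 := by
    have := Real.log_le_sub_one_of_pos (show 0 < 1 + ε by linarith); linarith
  refine ⟨8 + 1 / lam, max Q₁ 3, ?_⟩
  intro N₀ Q hQ hlog A hA hdens
  obtain ⟨hQ1, hQ3⟩ := max_le_iff.mp hQ
  have hQR : (3 : ℝ) ≤ Q := by exact_mod_cast hQ3
  have hlQ : 1 ≤ Real.log Q := by
    rw [Real.le_log_iff_exp_le (by positivity)]
    exact (Real.exp_one_lt_d9.le.trans (by norm_num)).trans hQR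
  have hlN : 0 < Real.log N₀ := lt_of_lt_of_le (by positivity) hlog
  have hN₀ : 1 ≤ N₀ := by
    rcases Nat.eq_zero_or_pos N₀ with h0 | h0
    · simp [h0] at hlN
    · exact h0
  have hN₀R : (1 : ℝ) ≤ N₀ := by exact_mod_cast hN₀
  have hs : s ≠ 0 := fun h0 => by
    have := (ι 0).2
    omega
  set η := lam / (4 * Real.log Q) with hη
  have hη0 : 0 < η := by positivity
  set α₀ := (A.card : ℝ) / N₀ with hα₀
  have hA0 : A.card ≤ N₀ := by
    simpa using Finset.card_le_card hA
  have hα₀1 : α₀ ≤ 1 := div_le_one_of_le₀ (by exact_mod_cast hA0) (by positivity)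
  have hα₀0 : 0 ≤ α₀ := by positivity
  have hα₀Q : (Q : ℝ) ^ (-(1 / 4) : ℝ) ≤ α₀ :=
    hdens.trans (pow_le_of_le_one hα₀0 hα₀1 hs)
  have hα₀pos : 0 < α₀ := lt_of_lt_of_le (by positivity) hα₀Q
  obtain ⟨b, d, N, hd, hN1, hNN, hmax⟩ :=
    exists_apCount_div_max A hN₀ fun L => (L : ℝ) ^ (1 - η)
  have hNR : (1 : ℝ) ≤ N := by exact_mod_cast hN1
  set A' := apRescale A b d N with hA'
  have hcA' : A'.card = apCount A b d N := card_apRescale A b d N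
  set α := (A'.card : ℝ) / N with hα
  have hweight : ∀ n : ℕ, 1 ≤ n → ∀ x : ℝ, x / (n : ℝ) ^ (1 - η) = x / n * (n : ℝ) ^ η := by
    intro n hn x
    have hn0 : (0 : ℝ) < n := by exact_mod_cast hn
    rw [Real.rpow_sub hn0, Real.rpow_one]
    field_simp
  have hα1 : α ≤ 1 := by
    rw [hα, hcA']
    exact div_le_one_of_le₀ (by exact_mod_cast apCount_le A b d N) (by positivity)
  have hmax0 : α₀ * (N₀ : ℝ) ^ η ≤ α * (N : ℝ) ^ η := by
    have h1 := hmax 0 1 N₀ le_rfl hN₀ le_rfl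
    rw [hweight N hN1, hweight N₀ hN₀, ← hcA'] at h1
    refine le_trans ?_ h1
    have := apCount_zero_one hA
    gcongr
    rw [hα₀]
    gcongr
  have hαα₀ : α₀ ≤ α := by
    have h1 : (N : ℝ) ^ η ≤ (N₀ : ℝ) ^ η := by gcongr
    have h2 : 0 < (N : ℝ) ^ η := by positivity
    exact le_of_mul_le_mul_right ((mul_le_mul_of_nonneg_left h1 hα₀0).trans hmax0) h2
  have hαpos : 0 < α := hα₀pos.trans_le hαα₀
  have hQN : Q ^ 8 ≤ N := by
    have h1 : (Q : ℝ) ^ (-(1 / 4) : ℝ) * (N₀ : ℝ) ^ η ≤ (N : ℝ) ^ η :=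
      calc (Q : ℝ) ^ (-(1 / 4) : ℝ) * (N₀ : ℝ) ^ η ≤ α₀ * (N₀ : ℝ) ^ η := by gcongr
        _ ≤ α * (N : ℝ) ^ η := hmax0
        _ ≤ 1 * (N : ℝ) ^ η := by gcongr
        _ = _ := one_mul _
    have h2 := Real.log_le_log (by positivity) h1
    rw [Real.log_mul (by positivity) (by positivity), Real.log_rpow (by positivity),
      Real.log_rpow (by positivity), Real.log_rpow (by positivity)] at h2
    have h3 : 8 * Real.log Q ≤ Real.log N := by
      have h4 : η * (4 * Real.log Q) = lam := by rw [hη]; field_simp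
      have h5 : 8 * Real.log Q + Real.log Q ^ 2 / lam ≤ Real.log N₀ := by
        refine le_trans ?_ hlog
        have : 8 * Real.log Q ≤ 8 * Real.log Q ^ 2 := by nlinarith
        calc _ ≤ 8 * Real.log Q ^ 2 + Real.log Q ^ 2 / lam := by linarith
          _ = _ := by ring
      have h6 : η * (8 * Real.log Q + Real.log Q ^ 2 / lam) ≤ η * Real.log N₀ := by gcongr
      have h7 : η * (Real.log Q ^ 2 / lam) = Real.log Q / 4 := by
        rw [hη]; field_simp
      have h8 : η * (8 * Real.log Q) ≤ η * Real.log N := by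
        rw [mul_add, h7] at h6; linarith
      exact le_of_mul_le_mul_left h8 hη0
    have h9 : Real.log ((Q : ℝ) ^ 8) ≤ Real.log N := by
      rw [Real.log_pow]; exact_mod_cast h3
    have h10 := (Real.log_le_log_iff (by positivity) (by positivity)).mp h9
    exact_mod_cast h10
  have hreg : ∀ (b' : ℤ) (q L : ℕ), 1 ≤ q → N ≤ Q ^ 4 * L → L ≤ N →
      (apCount A' b' q L : ℝ) ≤ (1 + 1 / (4 * m)) * α * L := by
    intro b' q L hq hL hLN
    have hL1 : 1 ≤ L := by
      rcases Nat.eq_zero_or_pos L with h0 | h0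
      · simp [h0] at hL; omega
      · exact h0
    have hLR : (0 : ℝ) < L := by exact_mod_cast hL1
    have h1 := hmax (b + d * b') (d * q) L (Nat.mul_pos hd hq) hL1 (hLN.trans hNN)
    rw [hweight N hN1, hweight L hL1, ← hcA', ← hα] at h1
    have h2 : (N : ℝ) ^ η ≤ (1 + ε) * (L : ℝ) ^ η := by
      have h3 : (N : ℝ) ≤ (Q : ℝ) ^ (4 : ℝ) * L := by exact_mod_cast hL
      calc (N : ℝ) ^ η ≤ ((Q : ℝ) ^ (4 : ℝ) * L) ^ η := by gcongr
        _ = (Q : ℝ) ^ (4 * η) * (L : ℝ) ^ η := by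
          rw [Real.mul_rpow (by positivity) hLR.le, ← Real.rpow_mul (by positivity)]
        _ = (1 + ε) * (L : ℝ) ^ η := by
          congr 1
          rw [Real.rpow_def_of_pos (by positivity), ← Real.exp_log (show 0 < 1 + ε by linarith),
            ← hlam, hη]
          congr 1
          field_simp
    have h4 : (apCount A' b' q L : ℝ) ≤ apCount A (b + d * b') (d * q) L := by
      exact_mod_cast apCount_apRescale_le A b d N b' q L
    have hLη : 0 < (L : ℝ) ^ η := by positivity
    have h5 : (apCount A (b + d * b') (d * q) L : ℝ) / L ≤ (1 + ε) * α := by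
      refine le_of_mul_le_mul_right (h1.trans ?_) hLη
      calc α * (N : ℝ) ^ η ≤ α * ((1 + ε) * (L : ℝ) ^ η) := by gcongr
        _ = _ := by ring
    rw [div_le_iff₀ hLR] at h5
    exact h4.trans h5
  obtain ⟨x, hxA, hxinj, hx0⟩ := hmain N Q hQ1 hQN A' α hαpos hα1 (Finset.filter_subset _ _)
    (by rw [hα, div_mul_cancel₀ _ (by positivity)])
    (hdens.trans (pow_le_pow_left₀ hα₀0 hαα₀ s)) hreg
  refine ⟨fun i => b + d * x i, fun i => (Finset.mem_filter.mp (hxA i)).2, ?_, ?_⟩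
  · intro i j hij
    have hd0 : (d : ℤ) ≠ 0 := by exact_mod_cast (by omega : d ≠ 0)
    exact hxinj (mul_left_cancel₀ hd0 (add_left_cancel hij))
  · have h1 := Qf_add_const hM htri ((d : ℤ) • x) b
    rw [Qf_smul, hx0, mul_zero] at h1
    rw [← h1]
    congr 1
    ext i
    simp [add_comm]

end Density

/-- Growth conditions on `log X` needed to deduce the density bound. -/
lemma exists_forall_log_growth (c : ℝ) (k Q₁ : ℕ) : ∃ X₀ : ℝ, ∀ X : ℝ, X₀ ≤ X →
    2 ≤ X ∧ 2 ≤ Real.log X ∧ (Q₁ : ℝ) ≤ Real.log X ∧ 1 ≤ Real.log (Real.log X) ∧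
      c * (k * Real.log (Real.log X)) ^ 2 ≤ Real.log X := by
  have ht := Real.tendsto_log_atTop
  have h5 : ∀ᶠ y : ℝ in Filter.atTop, c * (k * Real.log y) ^ 2 ≤ y := by
    have h := ((Real.isLittleO_pow_log_id_atTop (n := 2)).const_mul_left (c * k ^ 2)).bound
      (one_pos)
    filter_upwards [h, Filter.eventually_ge_atTop 0] with y hy hy0
    rw [Real.norm_eq_abs, one_mul, id, Real.norm_of_nonneg hy0] at hy
    exact le_trans (le_of_eq (by ring)) ((le_abs_self _).trans hy)
  obtain ⟨X₀, hX₀⟩ := Filter.eventually_atTop.mp ((Filter.eventually_ge_atTop (2 : ℝ)).and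
    ((ht.eventually_ge_atTop 2).and ((ht.eventually_ge_atTop (Q₁ : ℝ)).and
      (((ht.comp ht).eventually_ge_atTop 1).and (ht.eventually h5)))))
  exact ⟨X₀, hX₀⟩

/-- Sets of relative density more than `(log log X) ^ (-1/80)` in the primes have density at least
`(log X) ^ (-2)` in the integers. -/
lemma one_div_sq_log_le {X : ℝ} {n : ℕ} (hX : 2 ≤ X) (hy : 2 ≤ Real.log X)
    (hz : 1 ≤ Real.log (Real.log X))
    (hn : X / Real.log X * Real.log (Real.log X) ^ (-(1 / 80 : ℝ)) < n) :
    (Real.log X ^ 2)⁻¹ ≤ (n : ℝ) / ((⌊X⌋₊ + 1 : ℕ) : ℝ) := by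
  set y := Real.log X
  set z := Real.log y
  have hy0 : 0 < y := by linarith
  have h1 : z ≤ y / 2 := by
    have e1 : z = Real.log (y / 2) + Real.log 2 := by
      rw [Real.log_div (by positivity) (by norm_num)]; ring
    have e2 := Real.log_le_sub_one_of_pos (show 0 < y / 2 by positivity)
    have e3 := Real.log_two_lt_d9
    linarith
  have h2 : z⁻¹ ≤ z ^ (-(1 / 80 : ℝ)) := by
    rw [← Real.rpow_neg_one]
    exact Real.rpow_le_rpow_of_exponent_le hz (by norm_num)
  have h3 : (y / 2)⁻¹ ≤ z⁻¹ := by gcongr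
  have hN : ((⌊X⌋₊ + 1 : ℕ) : ℝ) ≤ 2 * X := by
    push_cast
    have := Nat.floor_le (show 0 ≤ X by linarith)
    linarith
  rw [le_div_iff₀ (by positivity)]
  calc (y ^ 2)⁻¹ * ((⌊X⌋₊ + 1 : ℕ) : ℝ) ≤ (y ^ 2)⁻¹ * (2 * X) := by gcongr
    _ = X / y * (y / 2)⁻¹ := by field_simp
    _ ≤ X / y * z ^ (-(1 / 80 : ℝ)) := by
        gcongr
        exact h3.trans h2
    _ ≤ n := hn.le

theorem statement0 (s : ℕ) (M : Matrix (Fin s) (Fin s) ℤ) (hs : 10 ≤ s)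
    (hsym : M.IsSymm) (htri : TransInv M) (hind : Indefinite M) (hrank : RankOffGe M 5) :
    ∃ C > 0, ∃ X0 : ℝ, ∀ X : ℝ, X0 ≤ X →
      ∀ A : Finset ℕ, (∀ p ∈ A, Nat.Prime p ∧ (p : ℝ) ≤ X) →
        (¬ ∃ p : Fin s → ℕ, (∀ i, p i ∈ A) ∧ Function.Injective p ∧
            Qf M (fun i => (p i : ℤ)) = 0) →
        (A.card : ℝ) ≤ C * (X / Real.log X) * Real.log (Real.log X) ^ (-(1 / 80 : ℝ)) := by
  obtain ⟨ι, κ, h⟩ := hrank.exists_isOffMinor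
  obtain ⟨c, Q₁, hmain⟩ := exists_injective_zero_of_dense hsym htri hind h
  obtain ⟨X₀, hX₀⟩ := exists_forall_log_growth |c| (8 * s + 1) Q₁
  refine ⟨1, one_pos, X₀, ?_⟩
  intro X hX A hA hno
  obtain ⟨hX2, hy2, hyQ, hz1, hgrow⟩ := hX₀ X hX
  by_contra! hlt
  rw [one_mul] at hlt
  have hdens := one_div_sq_log_le hX2 hy2 hz1 hlt
  set y := Real.log X with hy
  have hy0 : 0 < y := by linarith
  set N₀ := ⌊X⌋₊ + 1 with hN₀
  set Q := ⌈y ^ (8 * s)⌉₊ with hQ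
  have hypow : y ^ (8 * s) ≤ Q := Nat.le_ceil _
  have hy1 : y ≤ y ^ (8 * s) := le_self_pow₀ (by linarith) (by omega)
  have hQ0 : (0 : ℝ) < Q := by linarith
  have hQ₁ : Q₁ ≤ Q := by
    have : (Q₁ : ℝ) ≤ Q := by linarith
    exact_mod_cast this
  have hlogQ : Real.log Q ≤ ((8 * s + 1 : ℕ) : ℝ) * Real.log y := by
    rw [← Real.log_pow]
    refine Real.log_le_log hQ0 ?_
    have := Nat.ceil_lt_add_one (show 0 ≤ y ^ (8 * s) by positivity)
    rw [pow_succ]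
    nlinarith
  have hlogQ0 : 0 ≤ Real.log Q := Real.log_nonneg (by linarith)
  have hyN : y ≤ Real.log N₀ := by
    refine Real.log_le_log (by linarith) ?_
    rw [hN₀]; push_cast
    exact (Nat.lt_floor_add_one X).le
  obtain ⟨x, hxA, hxinj, hx0⟩ := hmain N₀ Q hQ₁
    (calc c * Real.log Q ^ 2 ≤ |c| * Real.log Q ^ 2 := by gcongr; exact le_abs_self c
      _ ≤ |c| * (((8 * s + 1 : ℕ) : ℝ) * Real.log y) ^ 2 := by gcongr
      _ ≤ _ := hgrow.trans hyN)
    (A.map Nat.castEmbedding)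
    (by
      intro a ha
      obtain ⟨p, hp, rfl⟩ := Finset.mem_map.mp ha
      have h1 : p ≤ ⌊X⌋₊ := Nat.le_floor (hA p hp).2
      rw [Finset.mem_Ico, Nat.castEmbedding_apply]
      omega)
    (by
      rw [Finset.card_map]
      calc (Q : ℝ) ^ (-(1 / 4) : ℝ) ≤ (y ^ (8 * s)) ^ (-(1 / 4) : ℝ) :=
            Real.rpow_le_rpow_of_nonpos (by positivity) hypow (by norm_num)
        _ = ((y ^ 2)⁻¹) ^ s := by
            rw [inv_pow, ← pow_mul, ← Real.rpow_natCast, ← Real.rpow_natCast,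
              ← Real.rpow_mul hy0.le, ← Real.rpow_neg hy0.le]
            congr 1
            push_cast
            ring
        _ ≤ _ := by gcongr)
  choose p hpA hpx using fun i => Finset.mem_map.mp (hxA i)
  have hpx' : (fun i => (p i : ℤ)) = x := funext hpx
  refine hno ⟨p, hpA, fun i j hij => hxinj ?_, by rw [hpx', hx0]⟩
  rw [← hpx i, ← hpx j, hij]
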